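/- Let t ∈ (0,∞), ε > 0, α ∈ (0,1), and let w be a non-negative function in L^1(|dz|) on 𝕋. Then there exists a sequence of polynomials {p_k}_k with ∫_𝕋 |p_k|^t w |dz| → 0 and ∫_𝔻 |p_k - 1|^t exp(-ε (1-|z|)^{α-1}) dA(z) → 0 (equivalently, the space P^t(μ) with dμ = exp(-ε(1-|z|)^{α-1}) dA + w |dz| splits) if and only if ∫_E log w |dz| = -∞ for every α-Carleson set E ⊂ 𝕋 of positive arclength measure. -/

import Mathlib

open MeasureTheory Set Filter Topology

noncomputable section

local instance : Fact (0 < 2 * Real.pi) := ⟨by positivity⟩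

/-- The unit circle `𝕋`, modelled as `ℝ / 2πℤ` with its arclength (Haar) measure,
of total mass `2π`. -/
abbrev UnitCircle := AddCircle (2 * Real.pi)

/-- A gauge function: continuous, increasing on `[0,∞)`, vanishing at `0`, with
`(R1)` `h x / x` decreasing and `(R2)` `h x / x → ∞` as `x → 0+`. -/
structure IsGauge (h : ℝ → ℝ) : Prop where
  continuousOn : ContinuousOn h (Set.Ici 0)
  mono : MonotoneOn h (Set.Ici 0)
  zero : h 0 = 0
  r1 : ∀ ⦃x y : ℝ⦄, 0 < x → x ≤ y → h y / y ≤ h x / x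
  r2 : Filter.Tendsto (fun x => h x / x) (nhdsWithin 0 (Set.Ioi 0)) Filter.atTop

/-- An arc of the circle: a connected subset (the empty set is allowed as a
degenerate arc). -/
def IsArc (I : Set UnitCircle) : Prop := IsPreconnected I

/-- An `h`-Carleson set: a closed subset of the circle whose complement is a countable
disjoint union of open arcs `I_k` (namely its maximal complementary arcs) with
`Σ_k h(|I_k|) < ∞`. -/
def IsHCarleson (h : ℝ → ℝ) (E : Set UnitCircle) : Prop :=
  IsClosed E ∧ ∃ I : ℕ → Set UnitCircle,
    (∀ k, IsOpen (I k) ∧ IsPreconnected (I k)) ∧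
    (∀ k l, k ≠ l → Disjoint (I k) (I l)) ∧
    (⋃ k, I k) = Eᶜ ∧
    (∑' k, ENNReal.ofReal (h (volume (I k)).toReal)) < ⊤

/-- `nlog t = log⁺(1/t)`, valued in `[0,∞]`, with `nlog 0 = ∞`. For `w ≥ 0` this is
the function `R = log⁺(1/w)` of Khrushchev; moreover, since the positive part of
`log w` is automatically integrable for `w ∈ L¹`, the divergence condition
`∫_E log w |dζ| = -∞` is faithfully expressed as `∫⁻_E nlog (w ζ) |dζ| = ∞`. -/
def nlog (t : ℝ) : ENNReal := if t = 0 then ⊤ else ENNReal.ofReal (Real.log t⁻¹)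

/-- The embedding of `𝕋 = ℝ/2πℤ` into `ℂ`, `θ ↦ e^{iθ}`. -/
def circleEmbed (ζ : UnitCircle) : ℂ := (AddCircle.toCircle ζ : ℂ)

/-- An `α`-Carleson set: a closed subset of the circle whose maximal complementary
open arcs `I_k` satisfy `Σ_k |I_k|^α < ∞`. -/
def IsAlphaCarlesonSet (α : ℝ) (E : Set UnitCircle) : Prop :=
  IsClosed E ∧ ∃ I : ℕ → Set UnitCircle,
    (∀ k, IsOpen (I k) ∧ IsPreconnected (I k)) ∧
    (∀ k l, k ≠ l → Disjoint (I k) (I l)) ∧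
    (⋃ k, I k) = Eᶜ ∧
    (∑' k, ENNReal.ofReal ((volume (I k)).toReal ^ α)) < ⊤

namespace AlphaSplitting

lemma circleEmbed_coe (θ : ℝ) : circleEmbed (θ : UnitCircle) = Complex.exp (θ * Complex.I) := by
  have : 2 * Real.pi / (2 * Real.pi) = 1 := div_self (by positivity)
  rw [circleEmbed, AddCircle.toCircle_apply_mk, Circle.coe_exp, this, one_mul]

lemma circleEmbed_add (x y : UnitCircle) :
    circleEmbed (x + y) = circleEmbed x * circleEmbed y := by
  simp [circleEmbed, AddCircle.toCircle_add]

@[simp] lemma norm_circleEmbed (x : UnitCircle) : ‖circleEmbed x‖ = 1 :=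
  Circle.norm_coe _

lemma circleEmbed_ne_zero (x : UnitCircle) : circleEmbed x ≠ 0 := by
  simp [circleEmbed]

lemma circleEmbed_neg (x : UnitCircle) : circleEmbed (-x) = (circleEmbed x)⁻¹ := by
  simp [circleEmbed, AddCircle.toCircle_neg]

lemma circleEmbed_neg' (x : UnitCircle) :
    circleEmbed (-x) = (starRingEnd ℂ) (circleEmbed x) := by
  rw [circleEmbed, circleEmbed, AddCircle.toCircle_neg, Circle.coe_inv_eq_conj]

@[fun_prop] lemma continuous_circleEmbed : Continuous circleEmbed :=
  continuous_subtype_val.comp AddCircle.continuous_toCircle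

lemma exists_circleEmbed_eq {z : ℂ} (hz : ‖z‖ = 1) : ∃ x, circleEmbed x = z := by
  refine ⟨((z.arg : ℝ) : UnitCircle), ?_⟩
  rw [circleEmbed_coe]
  have := Complex.norm_mul_exp_arg_mul_I z
  rwa [hz, Complex.ofReal_one, one_mul] at this

lemma exists_polar (z : ℂ) : ∃ x, z = ‖z‖ * circleEmbed x := by
  refine ⟨((z.arg : ℝ) : UnitCircle), ?_⟩
  rw [circleEmbed_coe]
  exact (Complex.norm_mul_exp_arg_mul_I z).symm

lemma circleAverage_eq_integral {F : Type*} [NormedAddCommGroup F] [NormedSpace ℝ F]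
    (f : ℂ → F) :
    Real.circleAverage f 0 1 = (2 * Real.pi)⁻¹ • ∫ x : UnitCircle, f (circleEmbed x) := by
  rw [Real.circleAverage_def, ← AddCircle.intervalIntegral_preimage (2 * Real.pi) 0, zero_add]
  congr 2
  ext θ
  rw [circleEmbed_coe, circleMap]
  simp

/-- The Poisson kernel of the unit disk on the circle, normalised to have integral `1`. -/
def pker (r : ℝ) (x : UnitCircle) : ℝ :=
  (2 * Real.pi)⁻¹ * ((1 - r ^ 2) / ‖1 - r * circleEmbed x‖ ^ 2)

lemma one_sub_le_norm {r : ℝ} (h0 : 0 ≤ r) (x : UnitCircle) :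
    1 - r ≤ ‖1 - r * circleEmbed x‖ := by
  have := norm_sub_norm_le (1 : ℂ) (r * circleEmbed x)
  simpa [abs_of_nonneg h0] using this

lemma continuous_pker {r : ℝ} (h0 : 0 ≤ r) (h1 : r < 1) : Continuous (pker r) := by
  unfold pker
  refine continuous_const.mul (continuous_const.div (by fun_prop) fun x => ?_)
  have := one_sub_le_norm h0 x
  have : 0 < ‖1 - r * circleEmbed x‖ := by linarith
  positivity

lemma pker_nonneg {r : ℝ} (h0 : 0 ≤ r) (h1 : r < 1) (x : UnitCircle) : 0 ≤ pker r x := by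
  have : 0 ≤ 1 - r ^ 2 := by nlinarith
  unfold pker
  positivity

lemma pker_neg (r : ℝ) (x : UnitCircle) : pker r (-x) = pker r x := by
  unfold pker
  rw [circleEmbed_neg', ← Complex.norm_conj (1 - r * circleEmbed x)]
  simp

lemma pker_sub_eq (r : ℝ) (x y : UnitCircle) :
    pker r (x - y) = (2 * Real.pi)⁻¹ * poissonKernel 0 (r * circleEmbed x) (circleEmbed y) := by
  unfold pker poissonKernel
  congr 1
  have : circleEmbed y * (1 - r * circleEmbed (x - y)) = circleEmbed y - r * circleEmbed x := by
    rw [sub_eq_add_neg x y, circleEmbed_add, circleEmbed_neg]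
    field_simp [circleEmbed_ne_zero y]
  have h2 : ‖circleEmbed y - r * circleEmbed x‖ = ‖1 - r * circleEmbed (x - y)‖ := by
    rw [← this]; simp
  simp [h2]

lemma integral_pker_mul_eq {F : Type*} [NormedAddCommGroup F] [NormedSpace ℂ F] [CompleteSpace F]
    {f : ℂ → F} (hf : DiffContOnCl ℂ f (Metric.ball 0 1)) {r : ℝ} (h0 : 0 ≤ r)
    (h1 : r < 1) (x : UnitCircle) :
    ∫ y, pker r (x - y) • f (circleEmbed y) = f (r * circleEmbed x) := by
  have hw : (r * circleEmbed x : ℂ) ∈ Metric.ball (0 : ℂ) 1 := by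
    simpa [abs_of_nonneg h0] using h1
  rw [← hf.circleAverage_poissonKernel_smul hw, circleAverage_eq_integral, ← integral_smul]
  congr 1
  ext y
  rw [pker_sub_eq, Pi.smul_apply', mul_smul]

lemma integral_pker_sub {r : ℝ} (h0 : 0 ≤ r) (h1 : r < 1) (x : UnitCircle) :
    ∫ y, pker r (x - y) = 1 := by
  have := integral_pker_mul_eq (f := fun _ => (1 : ℂ)) diffContOnCl_const h0 h1 x
  simp only [Complex.real_smul, mul_one] at this
  rw [integral_complex_ofReal] at this
  exact_mod_cast this

lemma integrable_of_continuous {φ : UnitCircle → ℝ} (hφ : Continuous φ) : Integrable φ :=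
  hφ.integrable_of_hasCompactSupport (HasCompactSupport.of_compactSpace φ)

lemma integral_pker_mul_re {A : Polynomial ℂ} {r : ℝ} (h0 : 0 ≤ r)
    (h1 : r < 1) (x : UnitCircle) :
    ∫ y, pker r (x - y) * (A.eval (circleEmbed y)).re = (A.eval (r * circleEmbed x)).re := by
  have hA : DiffContOnCl ℂ (fun z => A.eval z) (Metric.ball 0 1) :=
    A.differentiable.diffContOnCl
  rw [← integral_pker_mul_eq hA h0 h1 x]
  have hc : Continuous fun y => pker r (x - y) • A.eval (circleEmbed y) :=
    ((continuous_pker h0 h1).comp (by fun_prop)).smul (A.continuous.comp continuous_circleEmbed)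
  have := integral_re (hc.integrable_of_hasCompactSupport (μ := volume)
    (HasCompactSupport.of_compactSpace _))
  simp only [RCLike.re_eq_complex_re] at this
  rw [← this]
  congr 1
  ext y
  simp

/-- Real parts of polynomials are uniformly dense in the real continuous functions
on the circle. -/
lemma exists_polynomial_re_near {φ : UnitCircle → ℝ} (hφ : Continuous φ) {δ : ℝ} (hδ : 0 < δ) :
    ∃ A : Polynomial ℂ, ∀ x, |φ x - (A.eval (circleEmbed x)).re| < δ := by
  let Φ : C(UnitCircle, ℂ) := ⟨fun x => (φ x : ℂ), by fun_prop⟩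
  have hΦ : Φ ∈ (Submodule.span ℂ (range (fourier (T := 2 * Real.pi)))).topologicalClosure := by
    rw [span_fourier_closure_eq_top]; trivial
  obtain ⟨h, hh, hd⟩ := Metric.mem_closure_iff.1 hΦ δ hδ
  have key : ∀ h ∈ Submodule.span ℂ (range (fourier (T := 2 * Real.pi))),
      ∃ A : Polynomial ℂ, ∀ x, (h x).re = (A.eval (circleEmbed x)).re := by
    intro h hh
    have key2 : ∀ c : ℂ, ∃ A : Polynomial ℂ, ∀ x, (c * h x).re = (A.eval (circleEmbed x)).re := by
      induction hh using Submodule.span_induction with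
      | mem f hf =>
        obtain ⟨n, rfl⟩ := hf
        intro c
        have hn : ∀ k : ℕ, ∀ x : UnitCircle, fourier (k : ℤ) x = circleEmbed x ^ k := by
          intro k x
          rw [fourier_apply, circleEmbed, natCast_zsmul, AddCircle.toCircle_nsmul]
          simp
        obtain ⟨k, rfl | rfl⟩ := n.eq_nat_or_neg
        · refine ⟨Polynomial.C c * Polynomial.X ^ k, fun x => ?_⟩
          rw [hn]; simp
        · refine ⟨Polynomial.C (starRingEnd ℂ c) * Polynomial.X ^ k, fun x => ?_⟩
          rw [fourier_neg, hn, ← Complex.conj_re]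
          simp
      | zero => exact fun c => ⟨0, fun x => by simp⟩
      | add f g _ _ hf hg =>
        intro c
        obtain ⟨A, hA⟩ := hf c
        obtain ⟨B, hB⟩ := hg c
        refine ⟨A + B, fun x => ?_⟩
        rw [ContinuousMap.add_apply, mul_add, Complex.add_re, hA, hB]; simp
      | smul a f _ hf =>
        intro c
        obtain ⟨A, hA⟩ := hf (c * a)
        refine ⟨A, fun x => ?_⟩
        rw [← hA, ContinuousMap.smul_apply, smul_eq_mul, mul_assoc]
    simpa using key2 1
  obtain ⟨A, hA⟩ := key h hh
  refine ⟨A, fun x => ?_⟩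
  have h1 : dist (Φ x) (h x) < δ := (ContinuousMap.dist_apply_le_dist x).trans_lt hd
  rw [Complex.dist_eq] at h1
  refine lt_of_le_of_lt ?_ h1
  rw [← hA]
  have := Complex.abs_re_le_norm (Φ x - h x)
  simpa [Φ] using this

/-- The function `log (max |p| η)` is dominated by its Poisson integral. -/
lemma log_max_le_poisson (q : Polynomial ℂ) {η : ℝ} (hη : 0 < η) {r : ℝ} (h0 : 0 ≤ r)
    (h1 : r < 1) (x : UnitCircle) :
    Real.log (max ‖q.eval (r * circleEmbed x)‖ η) ≤
      ∫ y, pker r (x - y) * Real.log (max ‖q.eval (circleEmbed y)‖ η) := by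
  set φ : UnitCircle → ℝ := fun y => Real.log (max ‖q.eval (circleEmbed y)‖ η) with hφ
  have hφc : Continuous φ := by
    refine Continuous.log ?_ fun y => (lt_max_of_lt_right hη).ne'
    exact ((q.continuous.comp continuous_circleEmbed).norm).max continuous_const
  have hkc : Continuous fun y => pker r (x - y) := (continuous_pker h0 h1).comp (by fun_prop)
  refine le_of_forall_pos_le_add fun δ hδ => ?_
  obtain ⟨A, hA⟩ := exists_polynomial_re_near hφc (half_pos hδ)
  have hw : (r * circleEmbed x : ℂ) ∈ closure (Metric.ball (0 : ℂ) 1) :=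
    subset_closure (by simpa [abs_of_nonneg h0] using h1)
  have hmax : ∀ p : Polynomial ℂ,
      (∀ y, ‖p.eval (circleEmbed y)‖ ≤ max ‖q.eval (circleEmbed y)‖ η) →
      ‖p.eval (r * circleEmbed x)‖ ≤ Real.exp ((A.eval (r * circleEmbed x)).re + δ / 2) := by
    intro p hp
    have hd : DiffContOnCl ℂ (fun z => p.eval z * Complex.exp (-A.eval z))
        (Metric.ball (0 : ℂ) 1) :=
      (p.differentiable.mul A.differentiable.neg.cexp).diffContOnCl
    have := Complex.norm_le_of_forall_mem_frontier_norm_le Metric.isBounded_ball hd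
      (C := Real.exp (δ / 2)) ?_ hw
    · rw [norm_mul, Complex.norm_exp, Complex.neg_re, Real.exp_neg, ← div_eq_mul_inv,
        div_le_iff₀ (Real.exp_pos _), ← Real.exp_add, add_comm] at this
      exact this
    · intro z hz
      rw [frontier_ball _ one_ne_zero] at hz
      obtain ⟨y, rfl⟩ := exists_circleEmbed_eq (mem_sphere_zero_iff_norm.1 hz)
      rw [norm_mul, Complex.norm_exp, Complex.neg_re, Real.exp_neg, ← div_eq_mul_inv,
        div_le_iff₀ (Real.exp_pos _), ← Real.exp_add]
      refine (hp y).trans ?_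
      rw [← Real.exp_log (lt_max_of_lt_right hη : 0 < max ‖q.eval (circleEmbed y)‖ η)]
      have := abs_lt.1 (hA y)
      apply Real.exp_le_exp.2
      change φ y ≤ _
      linarith
  have hAle : (A.eval (r * circleEmbed x)).re ≤ (∫ y, pker r (x - y) * φ y) + δ / 2 := by
    have i1 := integrable_of_continuous (hkc.mul hφc)
    have i2 : Integrable fun y => pker r (x - y) * (δ / 2) :=
      integrable_of_continuous (hkc.mul continuous_const)
    have i3 : Integrable fun y => pker r (x - y) * (A.eval (circleEmbed y)).re :=
      integrable_of_continuous (hkc.mul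
        (Complex.continuous_re.comp (A.continuous.comp continuous_circleEmbed)))
    have h2 : ∫ y, (pker r (x - y) * φ y + pker r (x - y) * (δ / 2)) =
        (∫ y, pker r (x - y) * φ y) + δ / 2 := by
      refine (integral_add i1 i2).trans ?_
      rw [integral_mul_const, integral_pker_sub h0 h1, one_mul]
      rfl
    rw [← integral_pker_mul_re h0 h1 x, ← h2]
    refine integral_mono i3 (i1.add i2) fun y => ?_
    have e := abs_lt.1 (hA y)
    have e' := mul_le_mul_of_nonneg_left (show (A.eval (circleEmbed y)).re ≤ φ y + δ / 2 by
      linarith) (pker_nonneg h0 h1 (x - y))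
    simpa [mul_add] using e'
  have e1 := hmax q fun y => le_max_left _ _
  have e2 := hmax (Polynomial.C (η : ℂ)) fun y => by simp [abs_of_pos hη]
  simp only [Polynomial.eval_C, Complex.norm_real, Real.norm_eq_abs, abs_of_pos hη] at e2
  have := Real.log_le_log (lt_max_of_lt_right hη) (max_le e1 e2)
  rw [Real.log_exp] at this
  change _ ≤ (∫ y, pker r (x - y) * φ y) + δ
  linarith

lemma volume_real_univ : (volume : Measure UnitCircle).real univ = 2 * Real.pi := by
  rw [Measure.real, AddCircle.measure_univ, ENNReal.toReal_ofReal (by positivity)]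

lemma integral_const_circle (c : ℝ) : ∫ _ : UnitCircle, c = 2 * Real.pi * c := by
  rw [integral_const, volume_real_univ, smul_eq_mul]

lemma rpow_max_le {a b t : ℝ} (ha : 0 ≤ a) (hb : 0 ≤ b) :
    (max a b) ^ t ≤ a ^ t + b ^ t := by
  rcases le_total a b with h | h
  · rw [max_eq_right h]; have := Real.rpow_nonneg ha t; linarith
  · rw [max_eq_left h]; have := Real.rpow_nonneg hb t; linarith

/-- `log y ≤ log c + y / c - 1`. -/
lemma log_le_tangent {c y : ℝ} (hc : 0 < c) (hy : 0 < y) :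
    Real.log y ≤ Real.log c + y / c - 1 := by
  have := Real.log_le_sub_one_of_pos (div_pos hy hc)
  rw [Real.log_div hy.ne' hc.ne'] at this
  linarith

lemma pker_zero (x : UnitCircle) : pker 0 x = (2 * Real.pi)⁻¹ := by
  simp [pker]

lemma continuous_log_max (q : Polynomial ℂ) {η : ℝ} (hη : 0 < η) (r : ℝ) :
    Continuous fun y => Real.log (max ‖q.eval (r * circleEmbed y)‖ η) := by
  refine Continuous.log ?_ fun y => (lt_max_of_lt_right hη).ne'
  exact ((q.continuous.comp (by fun_prop)).norm).max continuous_const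

lemma log_max_zero_le (q : Polynomial ℂ) {η : ℝ} (hη : 0 < η) :
    2 * Real.pi * Real.log (max ‖q.eval 0‖ η) ≤
      ∫ y, Real.log (max ‖q.eval (circleEmbed y)‖ η) := by
  have := log_max_le_poisson q hη le_rfl zero_lt_one 0
  simp only [pker_zero, Complex.ofReal_zero, zero_mul] at this
  rw [integral_const_mul, inv_mul_eq_div, le_div_iff₀ (by positivity)] at this
  linarith

lemma rpow_norm_zero_le (q : Polynomial ℂ) {t : ℝ} (ht : 0 < t) :
    2 * Real.pi * ‖q.eval 0‖ ^ t ≤ ∫ x, ‖q.eval (circleEmbed x)‖ ^ t := by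
  have hc0 : Continuous fun x => ‖q.eval (circleEmbed x)‖ :=
    (q.continuous.comp continuous_circleEmbed).norm
  have hpi : 0 < 2 * Real.pi := by positivity
  have key : ∀ η : ℝ, 0 < η →
      2 * Real.pi * ‖q.eval 0‖ ^ t ≤ (∫ x, ‖q.eval (circleEmbed x)‖ ^ t) +
        2 * Real.pi * η ^ t := by
    intro η hη
    set F : UnitCircle → ℝ := fun x => (max ‖q.eval (circleEmbed x)‖ η) ^ t with hF
    have hFc : Continuous F := (hc0.max continuous_const).rpow_const fun _ => Or.inr ht.le
    have hmax : ∀ a : ℝ, 0 < max a η := fun a => lt_max_of_lt_right hη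
    have hFpos : ∀ x, η ^ t ≤ F x := fun x =>
      Real.rpow_le_rpow hη.le (le_max_right _ _) ht.le
    set c := (2 * Real.pi)⁻¹ * ∫ x, F x with hc
    have hcpos : 0 < c := by
      have : ∫ _ : UnitCircle, η ^ t ≤ ∫ x, F x :=
        integral_mono (integrable_const _) (integrable_of_continuous hFc) hFpos
      rw [integral_const_circle] at this
      have : 0 < ∫ x, F x := lt_of_lt_of_le (by positivity) this
      positivity
    have hFint : ∫ x, F x = 2 * Real.pi * c := by rw [hc]; field_simp
    have h1 := log_max_zero_le q hη
    have hlc : Continuous fun x => Real.log (max ‖q.eval (circleEmbed x)‖ η) :=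
      (hc0.max continuous_const).log fun x => (hmax _).ne'
    have h2 : ∫ x, t * Real.log (max ‖q.eval (circleEmbed x)‖ η) ≤
        ∫ x, ((Real.log c - 1) + F x * c⁻¹) := by
      refine integral_mono (integrable_of_continuous (hlc.const_mul t))
        (integrable_of_continuous (by fun_prop)) fun x => ?_
      have := log_le_tangent hcpos (Real.rpow_pos_of_pos (hmax ‖q.eval (circleEmbed x)‖) t)
      rw [Real.log_rpow (hmax _)] at this
      change _ ≤ Real.log c - 1 + F x * c⁻¹
      rw [← div_eq_mul_inv]
      change _ ≤ _ + F x / c - 1 at this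
      linarith
    rw [integral_const_mul, integral_add (integrable_const _)
      (integrable_of_continuous (by fun_prop)), integral_const_circle, integral_mul_const,
      hFint, mul_assoc (2 * Real.pi), mul_inv_cancel₀ hcpos.ne'] at h2
    have h3 : t * Real.log (max ‖q.eval 0‖ η) ≤ Real.log c := by
      have := mul_le_mul_of_nonneg_left h1 ht.le
      nlinarith
    have h4 : (max ‖q.eval 0‖ η) ^ t ≤ c := by
      rwa [← Real.log_rpow (hmax _), Real.log_le_log_iff
        (Real.rpow_pos_of_pos (hmax _) t) hcpos] at h3
    have h5 : ‖q.eval 0‖ ^ t ≤ c :=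
      (Real.rpow_le_rpow (norm_nonneg _) (le_max_left _ _) ht.le).trans h4
    have h6 : ∫ x, F x ≤ ∫ x, (‖q.eval (circleEmbed x)‖ ^ t + η ^ t) := by
      refine integral_mono (integrable_of_continuous hFc)
        (integrable_of_continuous ?_) fun x => rpow_max_le (norm_nonneg _) hη.le
      exact (hc0.rpow_const fun _ => Or.inr ht.le).add continuous_const
    rw [integral_add (integrable_of_continuous (hc0.rpow_const fun _ => Or.inr ht.le))
      (integrable_const _), integral_const_circle] at h6
    calc _ ≤ 2 * Real.pi * c := by gcongr
      _ = ∫ x, F x := hFint.symm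
      _ ≤ _ := h6
  have hlim : Tendsto (fun η : ℝ => (∫ x, ‖q.eval (circleEmbed x)‖ ^ t) +
      2 * Real.pi * η ^ t) (𝓝[>] 0) (𝓝 ((∫ x, ‖q.eval (circleEmbed x)‖ ^ t) +
      2 * Real.pi * 0 ^ t)) := by
    refine Tendsto.const_add _ (Tendsto.const_mul _ ?_)
    exact ((Real.continuousAt_rpow_const 0 t (Or.inr ht.le)).tendsto).mono_left
      nhdsWithin_le_nhds
  rw [Real.zero_rpow ht.ne', mul_zero, add_zero] at hlim
  exact ge_of_tendsto hlim (by filter_upwards [self_mem_nhdsWithin] with η hη using key η hη)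

lemma enorm_rpow_zero_le (q : Polynomial ℂ) {t : ℝ} (ht : 0 < t) :
    ENNReal.ofReal (2 * Real.pi) * (‖q.eval 0‖₊ : ENNReal) ^ t ≤
      ∫⁻ x, (‖q.eval (circleEmbed x)‖₊ : ENNReal) ^ t := by
  have e : ∀ z : ℂ, (‖z‖₊ : ENNReal) ^ t = ENNReal.ofReal (‖z‖ ^ t) := fun z => by
    rw [← ENNReal.ofReal_rpow_of_nonneg (norm_nonneg _) ht.le]
    congr 1
    exact (ofReal_norm z).symm
  simp only [e]
  have hc0 : Continuous fun x => ‖q.eval (circleEmbed x)‖ ^ t :=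
    (q.continuous.comp continuous_circleEmbed).norm.rpow_const fun _ => Or.inr ht.le
  rw [← ofReal_integral_eq_lintegral_ofReal (integrable_of_continuous hc0)
    (ae_of_all _ fun x => by positivity), ← ENNReal.ofReal_mul (by positivity)]
  exact ENNReal.ofReal_le_ofReal (rpow_norm_zero_le q ht)

lemma lintegral_ball_rotate (x : UnitCircle) (R : ℝ) (F : ℂ → ENNReal) :
    ∫⁻ z in Metric.ball (0 : ℂ) R, F (circleEmbed x * z) = ∫⁻ z in Metric.ball (0 : ℂ) R, F z := by
  have h := (rotation (AddCircle.toCircle x)).measurePreserving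
  have h2 := h.setLIntegral_comp_preimage_emb
    (rotation (AddCircle.toCircle x)).toHomeomorph.measurableEmbedding F (Metric.ball (0 : ℂ) R)
  rw [← h2]
  have : (rotation (AddCircle.toCircle x)) ⁻¹' Metric.ball (0 : ℂ) R = Metric.ball (0 : ℂ) R := by
    ext z; simp [-LinearIsometryEquiv.preimage_ball, Circle.norm_coe]
  rw [this]
  rfl

/-- The area sub-mean value property of `|f|^t`. -/
lemma enorm_rpow_mul_volume_le (f : Polynomial ℂ) {t : ℝ} (ht : 0 < t) (z : ℂ) (R : ℝ) :
    (‖f.eval z‖₊ : ENNReal) ^ t * volume (Metric.ball z R) ≤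
      ∫⁻ y in Metric.ball z R, (‖f.eval y‖₊ : ENNReal) ^ t := by
  set F : ℂ → ENNReal := fun y => (‖f.eval (z + y)‖₊ : ENNReal) ^ t with hF
  have hFm : Measurable F := by
    refine Measurable.pow_const ?_ t
    exact (f.continuous.comp (by fun_prop : Continuous fun y => z + y)).measurable.nnnorm.coe_nnreal_ennreal
  have h1 : ∫⁻ y in Metric.ball z R, (‖f.eval y‖₊ : ENNReal) ^ t =
      ∫⁻ y in Metric.ball (0 : ℂ) R, F y := by
    have h := measurePreserving_add_left (volume : Measure ℂ) z
    have h2 := h.setLIntegral_comp_preimage_emb (measurableEmbedding_addLeft z)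
      (fun y => (‖f.eval y‖₊ : ENNReal) ^ t) (Metric.ball z R)
    rw [← h2]
    have : (fun y => z + y) ⁻¹' Metric.ball z R = Metric.ball (0 : ℂ) R := by
      ext y; simp
    rw [this]
  have h0 : volume (Metric.ball z R) = volume (Metric.ball (0 : ℂ) R) :=
    Measure.addHaar_ball_center volume z R
  rw [h1, h0]
  have hpi : ENNReal.ofReal (2 * Real.pi) ≠ 0 := by simp [Real.pi_pos]
  rw [← ENNReal.mul_le_mul_iff_right hpi ENNReal.ofReal_ne_top]
  have hm2 : Measurable (Function.uncurry fun (x : UnitCircle) (y : ℂ) =>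
      F (circleEmbed x * y)) := by
    refine hFm.comp ?_
    exact (continuous_circleEmbed.comp continuous_fst |>.mul continuous_snd).measurable
  calc ENNReal.ofReal (2 * Real.pi) * ((‖f.eval z‖₊ : ENNReal) ^ t * volume (Metric.ball (0 : ℂ) R))
      = ∫⁻ y in Metric.ball (0 : ℂ) R,
          ENNReal.ofReal (2 * Real.pi) * (‖f.eval z‖₊ : ENNReal) ^ t := by
        rw [setLIntegral_const, mul_assoc]
    _ ≤ ∫⁻ y in Metric.ball (0 : ℂ) R, ∫⁻ x : UnitCircle, F (circleEmbed x * y) := by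
        refine lintegral_mono fun y => ?_
        have := enorm_rpow_zero_le (f.comp (Polynomial.C z + Polynomial.C y * Polynomial.X)) ht
        simp only [Polynomial.eval_comp, Polynomial.eval_add, Polynomial.eval_C,
          Polynomial.eval_mul, Polynomial.eval_X, mul_zero, add_zero] at this
        refine this.trans (le_of_eq ?_)
        simp only [hF, mul_comm]
    _ = ∫⁻ x : UnitCircle, ∫⁻ y in Metric.ball (0 : ℂ) R, F (circleEmbed x * y) :=
        (lintegral_lintegral_swap hm2.aemeasurable).symm
    _ = ENNReal.ofReal (2 * Real.pi) * ∫⁻ y in Metric.ball (0 : ℂ) R, F y := by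
        simp only [lintegral_ball_rotate]
        rw [lintegral_const, AddCircle.measure_univ, mul_comm]

/-- The weighted area integral `∫ |f|^t exp(-ε (1-|z|)^(α-1)) dA`. -/
def areaInt (t ε α : ℝ) (f : ℂ → ℂ) : ENNReal :=
  ∫⁻ z in Metric.ball (0 : ℂ) 1, (‖f z‖₊ : ENNReal) ^ t *
    ENNReal.ofReal (Real.exp (-ε * (1 - ‖z‖) ^ (α - 1)))

lemma enorm_rpow_mul_le_areaInt {t ε α : ℝ} (ht : 0 < t) (hε : 0 < ε) (hα1 : α < 1)
    (f : Polynomial ℂ) {z : ℂ} (hz : ‖z‖ < 1) :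
    (‖f.eval z‖₊ : ENNReal) ^ t * volume (Metric.ball z ((1 - ‖z‖) / 2)) *
      ENNReal.ofReal (Real.exp (-ε * ((1 - ‖z‖) / 2) ^ (α - 1))) ≤
    areaInt t ε α fun y => f.eval y := by
  set d := 1 - ‖z‖ with hd
  have hd0 : 0 < d := by linarith
  have hsub : Metric.ball z (d / 2) ⊆ {y | d / 2 ≤ 1 - ‖y‖} := by
    intro y hy
    rw [Metric.mem_ball, dist_eq_norm] at hy
    have := norm_sub_norm_le y z
    simp only [mem_ofPred_eq]; linarith
  have hsub1 : Metric.ball z (d / 2) ⊆ Metric.ball 0 1 := by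
    intro y hy
    have := hsub hy
    simp only [mem_ofPred_eq] at this
    rw [mem_ball_zero_iff]; linarith
  calc _ ≤ (∫⁻ y in Metric.ball z (d / 2), (‖f.eval y‖₊ : ENNReal) ^ t) *
        ENNReal.ofReal (Real.exp (-ε * (d / 2) ^ (α - 1))) := by
        gcongr; exact enorm_rpow_mul_volume_le f ht z _
    _ = ∫⁻ y in Metric.ball z (d / 2), (‖f.eval y‖₊ : ENNReal) ^ t *
        ENNReal.ofReal (Real.exp (-ε * (d / 2) ^ (α - 1))) :=
        (lintegral_mul_const _ (f.continuous.measurable.nnnorm.coe_nnreal_ennreal.pow_const t)).symm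
    _ ≤ ∫⁻ y in Metric.ball z (d / 2), (‖f.eval y‖₊ : ENNReal) ^ t *
        ENNReal.ofReal (Real.exp (-ε * (1 - ‖y‖) ^ (α - 1))) := by
        refine setLIntegral_mono' Metric.isOpen_ball.measurableSet fun y hy => ?_
        refine mul_le_mul' le_rfl (ENNReal.ofReal_le_ofReal (Real.exp_le_exp.2 ?_))
        have h1 : (1 - ‖y‖) ^ (α - 1) ≤ (d / 2) ^ (α - 1) :=
          Real.rpow_le_rpow_of_nonpos (by linarith) (hsub hy) (by linarith)
        nlinarith
    _ ≤ _ := lintegral_mono_set hsub1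

lemma norm_rpow_mul_le_one {t ε α : ℝ} (ht : 0 < t) (hε : 0 < ε) (hα1 : α < 1)
    (f : Polynomial ℂ) {A : ℝ} (hA : 0 ≤ A)
    (hf : areaInt t ε α (fun y => f.eval y) ≤ ENNReal.ofReal A) {z : ℂ} (hz : ‖z‖ < 1) :
    ‖f.eval z‖ ^ t * (((1 - ‖z‖) / 2) ^ 2 * Real.pi) *
      Real.exp (-ε * ((1 - ‖z‖) / 2) ^ (α - 1)) ≤ A := by
  have h := (enorm_rpow_mul_le_areaInt ht hε hα1 f hz).trans hf
  have hd0 : 0 ≤ (1 - ‖z‖) / 2 := by linarith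
  have e : (‖f.eval z‖₊ : ENNReal) ^ t = ENNReal.ofReal (‖f.eval z‖ ^ t) := by
    rw [← ENNReal.ofReal_rpow_of_nonneg (norm_nonneg _) ht.le]
    congr 1
    exact (ofReal_norm _).symm
  have e2 : volume (Metric.ball z ((1 - ‖z‖) / 2)) =
      ENNReal.ofReal (((1 - ‖z‖) / 2) ^ 2 * Real.pi) := by
    rw [Complex.volume_ball, ENNReal.ofReal_mul (by positivity), ENNReal.ofReal_pow hd0]
    congr 1
    rw [← NNReal.coe_real_pi, ENNReal.ofReal_coe_nnreal]
  rw [e, e2, ← ENNReal.ofReal_mul (by positivity), ← ENNReal.ofReal_mul (by positivity)] at h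
  exact (ENNReal.ofReal_le_ofReal_iff hA).1 h

lemma exists_log_growth {t ε α : ℝ} (ht : 0 < t) (hε : 0 < ε) (hα1 : α < 1) :
    ∃ C : ℝ, 0 < C ∧ ∀ p : Polynomial ℂ, areaInt t ε α (fun y => p.eval y - 1) ≤ 1 →
      ∀ z : ℂ, ‖z‖ < 1 → Real.log (max ‖p.eval z‖ 1) ≤ C * (1 - ‖z‖) ^ (α - 1) := by
  set C1 : ℝ := (ε * 2 ^ (1 - α) + 2 / (1 - α) + 2) / t with hC1
  have h1α : 0 < 1 - α := by linarith
  have hC1pos : 0 < C1 := by positivity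
  refine ⟨1 + C1, by linarith, fun p hp z hz => ?_⟩
  set d := 1 - ‖z‖ with hd
  have hd0 : 0 < d := by linarith
  have hd1 : d ≤ 1 := by have := norm_nonneg z; linarith
  set D := d ^ (α - 1) with hD
  have hD1 : 1 ≤ D := Real.one_le_rpow_of_pos_of_le_one_of_nonpos hd0 hd1 (by linarith)
  set f : Polynomial ℂ := p - 1 with hf
  have hfe : ∀ y, f.eval y = p.eval y - 1 := fun y => by simp [hf]
  have h := norm_rpow_mul_le_one ht hε hα1 f zero_le_one (by simpa [hfe] using hp) hz
  have hfz : 0 < ‖f.eval z‖ → Real.log ‖f.eval z‖ ≤ C1 * D := by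
    intro hpos
    have hl := Real.log_le_log (by positivity) h
    rw [Real.log_one, Real.log_mul (by positivity) (by positivity), Real.log_exp,
      Real.log_mul (by positivity) (by positivity), Real.log_mul (by positivity) (by positivity),
      Real.log_pow, Real.log_div hd0.ne' two_ne_zero, Real.log_rpow hpos,
      Real.div_rpow hd0.le zero_le_two] at hl
    have h2 : (2 : ℝ) ^ (α - 1) = (2 ^ (1 - α))⁻¹ := by
      rw [← Real.rpow_neg zero_le_two]; ring_nf
    rw [h2, div_inv_eq_mul] at hl
    have h3 : 0 ≤ Real.log Real.pi := Real.log_nonneg (by linarith [Real.pi_gt_three])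
    have h4 : Real.log 2 ≤ 1 := by linarith [Real.log_two_lt_d9]
    have h5 : - Real.log d ≤ D / (1 - α) := by
      have := Real.log_le_rpow_div (inv_nonneg.2 hd0.le) h1α
      rw [Real.log_inv, Real.inv_rpow hd0.le, ← Real.rpow_neg hd0.le] at this
      rwa [hD, show α - 1 = -(1 - α) by ring]
    have h6 : t * Real.log ‖f.eval z‖ ≤ (ε * 2 ^ (1 - α) + 2 / (1 - α) + 2) * D := by
      push_cast at hl
      have : 2 / (1 - α) * D = 2 * (D / (1 - α)) := by ring
      nlinarith
    rw [hC1, div_mul_eq_mul_div, le_div_iff₀ ht]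
    linarith
  have hle : max ‖p.eval z‖ 1 ≤ 2 * max ‖f.eval z‖ 1 := by
    have : ‖p.eval z‖ ≤ ‖f.eval z‖ + 1 := by
      have := norm_add_le (f.eval z) 1
      rw [hfe] at this ⊢
      simpa using this
    refine max_le ?_ ?_
    · linarith [le_max_left ‖f.eval z‖ 1, le_max_right ‖f.eval z‖ 1]
    · linarith [le_max_right ‖f.eval z‖ 1]
  have hl1 := Real.log_le_log (by positivity) hle
  rw [Real.log_mul two_ne_zero (by positivity)] at hl1
  have h4 : Real.log 2 ≤ 1 := by linarith [Real.log_two_lt_d9]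
  have : Real.log (max ‖f.eval z‖ 1) ≤ C1 * D := by
    rcases le_total ‖f.eval z‖ 1 with h | h
    · rw [max_eq_right h, Real.log_one]; positivity
    · rw [max_eq_left h]; exact hfz (by linarith)
  nlinarith

lemma exists_norm_zero_ge {t ε α : ℝ} (ht : 0 < t) (hε : 0 < ε) (hα1 : α < 1) :
    ∃ A : ℝ, 0 < A ∧ ∀ p : Polynomial ℂ,
      areaInt t ε α (fun y => p.eval y - 1) ≤ ENNReal.ofReal A → 1 / 2 ≤ ‖p.eval 0‖ := by
  set κ := ((1 / 2 : ℝ) ^ 2 * Real.pi) * Real.exp (-ε * (1 / 2) ^ (α - 1)) with hκ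
  have hκ0 : 0 < κ := by positivity
  refine ⟨(1 / 2) ^ t * κ, by positivity, fun p hp => ?_⟩
  set f : Polynomial ℂ := p - 1 with hf
  have hfe : ∀ y, f.eval y = p.eval y - 1 := fun y => by simp [hf]
  have h := norm_rpow_mul_le_one ht hε hα1 f (A := (1 / 2) ^ t * κ) (by positivity)
    (by simpa only [hfe] using hp) (z := 0) (by simp)
  rw [norm_zero, sub_zero, mul_assoc, ← hκ] at h
  have h1 := le_of_mul_le_mul_right h hκ0
  rw [Real.rpow_le_rpow_iff (norm_nonneg _) (by norm_num) ht, hfe] at h1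
  have := norm_sub_norm_le (1 : ℂ) (1 - p.eval 0)
  rw [norm_sub_rev 1 (p.eval 0), sub_sub_cancel, norm_one] at this
  linarith

/-- Bounded measurable functions on the circle. -/
def BddMeas (φ : UnitCircle → ℝ) : Prop := Measurable φ ∧ ∃ C, ∀ x, |φ x| ≤ C

lemma BddMeas.integrable {φ : UnitCircle → ℝ} (h : BddMeas φ) : Integrable φ := by
  obtain ⟨hm, C, hC⟩ := h
  exact Integrable.of_bound hm.aestronglyMeasurable C (ae_of_all _ hC)

lemma BddMeas.mul {φ ψ : UnitCircle → ℝ} (h : BddMeas φ) (h' : BddMeas ψ) :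
    BddMeas fun x => φ x * ψ x := by
  obtain ⟨hm, C, hC⟩ := h
  obtain ⟨hm', C', hC'⟩ := h'
  refine ⟨hm.mul hm', C * C', fun x => ?_⟩
  rw [abs_mul]
  exact mul_le_mul (hC x) (hC' x) (abs_nonneg _) ((abs_nonneg _).trans (hC x))

lemma BddMeas.sub {φ ψ : UnitCircle → ℝ} (h : BddMeas φ) (h' : BddMeas ψ) :
    BddMeas fun x => φ x - ψ x := by
  obtain ⟨hm, C, hC⟩ := h
  obtain ⟨hm', C', hC'⟩ := h'
  exact ⟨hm.sub hm', C + C', fun x => (abs_sub _ _).trans (add_le_add (hC x) (hC' x))⟩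

lemma BddMeas.add {φ ψ : UnitCircle → ℝ} (h : BddMeas φ) (h' : BddMeas ψ) :
    BddMeas fun x => φ x + ψ x := by
  obtain ⟨hm, C, hC⟩ := h
  obtain ⟨hm', C', hC'⟩ := h'
  exact ⟨hm.add hm', C + C', fun x => (abs_add_le _ _).trans (add_le_add (hC x) (hC' x))⟩

lemma BddMeas.const (c : ℝ) : BddMeas fun _ => c := ⟨measurable_const, |c|, fun _ => le_rfl⟩

lemma BddMeas.of_continuous {φ : UnitCircle → ℝ} (h : Continuous φ) : BddMeas φ := by
  refine ⟨h.measurable, ?_⟩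
  obtain ⟨C, hC⟩ := isCompact_univ.exists_bound_of_continuousOn h.continuousOn
  exact ⟨C, fun x => hC x (mem_univ x)⟩

lemma BddMeas.indicator {φ : UnitCircle → ℝ} (h : BddMeas φ) {s : Set UnitCircle}
    (hs : MeasurableSet s) : BddMeas (s.indicator φ) := by
  obtain ⟨hm, C, hC⟩ := h
  refine ⟨hm.indicator hs, C, fun x => ?_⟩
  by_cases hx : x ∈ s
  · simpa [hx] using hC x
  · simpa [hx] using (abs_nonneg _).trans (hC x)

/-- The Poisson integral of `φ` at radius `r`. -/
def pint (r : ℝ) (φ : UnitCircle → ℝ) (x : UnitCircle) : ℝ := ∫ y, pker r (x - y) * φ y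

lemma BddMeas.pker {r : ℝ} (h0 : 0 ≤ r) (h1 : r < 1) (x : UnitCircle) :
    BddMeas fun y => pker r (x - y) :=
  BddMeas.of_continuous ((continuous_pker h0 h1).comp (by fun_prop))

lemma pint_mono {r : ℝ} (h0 : 0 ≤ r) (h1 : r < 1) {φ ψ : UnitCircle → ℝ} (h : BddMeas φ)
    (h' : BddMeas ψ) (hle : ∀ x, φ x ≤ ψ x) (x : UnitCircle) : pint r φ x ≤ pint r ψ x :=
  integral_mono ((BddMeas.pker h0 h1 x).mul h).integrable
    ((BddMeas.pker h0 h1 x).mul h').integrable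
    fun y => mul_le_mul_of_nonneg_left (hle y) (pker_nonneg h0 h1 _)

lemma pint_const {r : ℝ} (h0 : 0 ≤ r) (h1 : r < 1) (c : ℝ) (x : UnitCircle) :
    pint r (fun _ => c) x = c := by
  rw [pint, integral_mul_const, integral_pker_sub h0 h1, one_mul]

lemma pint_add {r : ℝ} (h0 : 0 ≤ r) (h1 : r < 1) {φ ψ : UnitCircle → ℝ} (h : BddMeas φ)
    (h' : BddMeas ψ) (x : UnitCircle) :
    pint r (fun y => φ y + ψ y) x = pint r φ x + pint r ψ x := by
  simp only [pint, mul_add]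
  exact integral_add ((BddMeas.pker h0 h1 x).mul h).integrable
    ((BddMeas.pker h0 h1 x).mul h').integrable

lemma pint_sub {r : ℝ} (h0 : 0 ≤ r) (h1 : r < 1) {φ ψ : UnitCircle → ℝ} (h : BddMeas φ)
    (h' : BddMeas ψ) (x : UnitCircle) :
    pint r (fun y => φ y - ψ y) x = pint r φ x - pint r ψ x := by
  simp only [pint, mul_sub]
  exact integral_sub ((BddMeas.pker h0 h1 x).mul h).integrable
    ((BddMeas.pker h0 h1 x).mul h').integrable

lemma BddMeas.pint {r : ℝ} (h0 : 0 ≤ r) (h1 : r < 1) {φ : UnitCircle → ℝ} (h : BddMeas φ) :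
    BddMeas (pint r φ) := by
  obtain ⟨C, hC⟩ := h.2
  constructor
  · have : StronglyMeasurable (Function.uncurry fun x y : UnitCircle =>
        AlphaSplitting.pker r (x - y) * φ y) := by
      refine Measurable.stronglyMeasurable (Measurable.mul ?_ (h.1.comp measurable_snd))
      exact ((continuous_pker h0 h1).comp (by fun_prop)).measurable
    exact this.integral_prod_right.measurable
  · refine ⟨C, fun x => abs_le.2 ⟨?_, ?_⟩⟩
    · rw [← pint_const h0 h1 (-C) x]
      exact pint_mono h0 h1 (BddMeas.const _) h (fun y => (abs_le.1 (hC y)).1) x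
    · rw [← pint_const h0 h1 C x]
      exact pint_mono h0 h1 h (BddMeas.const _) (fun y => (abs_le.1 (hC y)).2) x

lemma integral_pint_mul {r : ℝ} (h0 : 0 ≤ r) (h1 : r < 1) {φ ψ : UnitCircle → ℝ}
    (h : Integrable φ) (h' : BddMeas ψ) :
    ∫ x, pint r φ x * ψ x = ∫ y, φ y * pint r ψ y := by
  obtain ⟨C, hC⟩ := h'.2
  have hk : BddMeas (AlphaSplitting.pker r) := BddMeas.of_continuous (continuous_pker h0 h1)
  obtain ⟨D, hD⟩ := hk.2
  have herglotz : Integrable (Function.uncurry fun x y : UnitCircle => pker r (x - y) * φ y * ψ x)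
      (volume.prod volume) := by
    have hb : Integrable (fun z : UnitCircle × UnitCircle => φ z.2)
        (volume.prod volume) := h.comp_snd _
    have hm : AEStronglyMeasurable (fun z : UnitCircle × UnitCircle =>
        pker r (z.1 - z.2) * ψ z.1) (volume.prod volume) := by
      refine Measurable.aestronglyMeasurable (Measurable.mul ?_ (h'.1.comp measurable_fst))
      exact ((continuous_pker h0 h1).comp (by fun_prop)).measurable
    have := hb.bdd_mul (c := D * C) hm (ae_of_all _ fun z => by
      rw [Real.norm_eq_abs, abs_mul]
      exact mul_le_mul (hD _) (hC _) (abs_nonneg _) ((abs_nonneg _).trans (hD 0)))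
    refine this.congr (ae_of_all _ fun z => ?_)
    simp only [Function.uncurry]
    ring
  simp only [pint, ← integral_mul_const, ← integral_const_mul]
  rw [integral_integral_swap herglotz]
  congr 1
  ext y
  congr 1
  ext x
  rw [← pker_neg, neg_sub]
  ring

lemma norm_one_sub_circleEmbed (x : UnitCircle) : 2 / Real.pi * ‖x‖ ≤ ‖1 - circleEmbed x‖ := by
  obtain ⟨θ, hθ, hx⟩ : ∃ θ : ℝ, |θ| ≤ Real.pi ∧ ((θ : ℝ) : UnitCircle) = x := by
    have := AddCircle.coe_image_Icc_eq (2 * Real.pi) (-Real.pi)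
    have hx : x ∈ ((↑) : ℝ → UnitCircle) '' Icc (-Real.pi) (-Real.pi + 2 * Real.pi) := by
      rw [this]; trivial
    obtain ⟨θ, hθ, hx⟩ := hx
    exact ⟨θ, abs_le.2 ⟨hθ.1, by linarith [hθ.2]⟩, hx⟩
  subst hx
  have hp : 0 < 2 * Real.pi := by positivity
  have hn : ‖((θ : ℝ) : UnitCircle)‖ = |θ| := by
    refine (AddCircle.norm_coe_eq_abs_iff (p := 2 * Real.pi) (x := θ) hp.ne').2 ?_
    rw [abs_of_pos hp]
    linarith
  rw [circleEmbed_coe, norm_sub_rev, mul_comm (θ : ℂ), Complex.norm_exp_I_mul_ofReal_sub_one,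
    norm_mul, hn]
  have h1 := Real.mul_le_sin (x := |θ| / 2) (by positivity) (by linarith)
  have h2 : |Real.sin (θ / 2)| = Real.sin (|θ| / 2) := by
    rcases le_total 0 θ with h | h
    · rw [abs_of_nonneg h, abs_of_nonneg]
      exact Real.sin_nonneg_of_nonneg_of_le_pi (by linarith) (by linarith [abs_le.1 hθ])
    · rw [abs_of_nonpos h, neg_div, Real.sin_neg, abs_of_nonpos]
      have := abs_le.1 hθ
      exact Real.sin_nonpos_of_nonpos_of_neg_pi_le (by linarith) (by linarith)
  simp only [Real.norm_eq_abs, h2, abs_two]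
  linarith

lemma pker_le_of_le_norm {r s : ℝ} (h0 : 0 ≤ r) (h1 : r < 1) (hs : 0 < s) (hs1 : s ≤ 3.2)
    {x : UnitCircle} (hx : s ≤ ‖x‖) :
    pker r x ≤ 128 * ((1 - r) / s) * pker (1 - s / 4) x := by
  set a := ‖1 - (r : ℂ) * circleEmbed x‖ with ha
  set b := ‖1 - ((1 - s / 4 : ℝ) : ℂ) * circleEmbed x‖ with hb
  set n := ‖1 - circleEmbed x‖ with hn
  have hapos : 0 < a := lt_of_lt_of_le (by linarith) (one_sub_le_norm h0 x)
  have hbpos : 0 < b :=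
    lt_of_lt_of_le (by linarith) (one_sub_le_norm (r := 1 - s / 4) (by linarith) x)
  have hns : s / 2 ≤ n := by
    have h3 := norm_one_sub_circleEmbed x
    have : 1 / 2 ≤ 2 / Real.pi := by
      rw [div_le_div_iff₀ two_pos Real.pi_pos]; linarith [Real.pi_le_four]
    nlinarith [norm_nonneg x]
  have hdiff : ∀ u : ℝ, u ≤ 1 → ‖(1 - (u : ℂ) * circleEmbed x) - (1 - circleEmbed x)‖ = 1 - u := by
    intro u hu
    have : (1 - (u : ℂ) * circleEmbed x) - (1 - circleEmbed x) =
      ((1 - u : ℝ) : ℂ) * circleEmbed x := by push_cast; ring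
    rw [this, norm_mul, norm_circleEmbed, mul_one, Complex.norm_real, Real.norm_eq_abs,
      abs_of_nonneg (by linarith)]
  have hbn : b ≤ n + s / 4 := by
    have h3 := norm_sub_norm_le (1 - ((1 - s / 4 : ℝ) : ℂ) * circleEmbed x) (1 - circleEmbed x)
    rw [hdiff _ (by linarith)] at h3
    linarith
  have hna : n ≤ a + (1 - r) := by
    have h3 := norm_sub_norm_le (1 - circleEmbed x) (1 - (r : ℂ) * circleEmbed x)
    rw [norm_sub_rev (1 - circleEmbed x), hdiff _ h1.le] at h3
    linarith
  have hab : b ≤ 4 * a := by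
    have := one_sub_le_norm h0 x
    linarith
  have hr2 : 0 ≤ 1 - r := by linarith
  have e1 : (1 - r ^ 2) / a ^ 2 ≤ 32 * (1 - r) / b ^ 2 := by
    rw [div_le_div_iff₀ (by positivity) (by positivity)]
    have h5 : b ^ 2 ≤ 16 * a ^ 2 := by nlinarith
    have h6 : 1 - r ^ 2 ≤ 2 * (1 - r) := by nlinarith
    have h7 : 0 ≤ 1 - r ^ 2 := by nlinarith
    calc _ ≤ (2 * (1 - r)) * (16 * a ^ 2) := mul_le_mul h6 h5 (by positivity) (by linarith)
      _ = _ := by ring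
  have e2 : 32 * (1 - r) / b ^ 2 ≤ 128 * ((1 - r) / s) * ((1 - (1 - s / 4) ^ 2) / b ^ 2) := by
    rw [← mul_div_assoc]
    refine div_le_div_of_nonneg_right ?_ (by positivity)
    have : s / 4 ≤ 1 - (1 - s / 4) ^ 2 := by nlinarith
    calc 32 * (1 - r) = 128 * ((1 - r) / s) * (s / 4) := by field_simp; ring
      _ ≤ _ := mul_le_mul_of_nonneg_left this (by positivity)
  unfold pker
  calc _ ≤ (2 * Real.pi)⁻¹ * (128 * ((1 - r) / s) * ((1 - (1 - s / 4) ^ 2) / b ^ 2)) :=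
        mul_le_mul_of_nonneg_left (e1.trans e2) (by positivity)
    _ = _ := by ring

/-- The Poisson integral of an indicator decays away from the set. -/
lemma pint_indicator_le {r : ℝ} (h0 : 0 ≤ r) (h1 : r < 1) {E : Set UnitCircle}
    (hE : MeasurableSet E) {s : ℝ} (hs : 0 < s) (hs1 : s ≤ 3.2) {x : UnitCircle}
    (hx : ∀ y ∈ E, s ≤ ‖x - y‖) :
    pint r (E.indicator fun _ => 1) x ≤ 128 * ((1 - r) / s) := by
  have h2 : 0 ≤ 1 - s / 4 := by linarith
  have h3 : 1 - s / 4 < 1 := by linarith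
  have hr : 0 ≤ (1 - r) / s := div_nonneg (by linarith) hs.le
  calc pint r (E.indicator fun _ => 1) x
      ≤ ∫ y, 128 * ((1 - r) / s) * pker (1 - s / 4) (x - y) := by
        refine integral_mono
          ((BddMeas.pker h0 h1 x).mul ((BddMeas.const 1).indicator hE)).integrable
          ((BddMeas.const _).mul (BddMeas.pker h2 h3 x)).integrable fun y => ?_
        by_cases hy : y ∈ E
        · simpa [hy] using pker_le_of_le_norm h0 h1 hs hs1 (hx y hy)
        · simp only [hy, not_false_eq_true, indicator_of_notMem, mul_zero]
          have := pker_nonneg h2 h3 (x - y)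
          positivity
    _ = _ := by rw [integral_const_mul, integral_pker_sub h2 h3, mul_one]

lemma volume_arc_inter_thickening_le {E I : Set UnitCircle} (hE : IsClosed E) (hne : E.Nonempty)
    (hI : IsOpen I) (hIc : IsPreconnected I) (hd : Disjoint I E) {ρ : ℝ} (hρ : 0 ≤ ρ) :
    volume (I ∩ {x | Metric.infDist x E ≤ ρ}) ≤ ENNReal.ofReal (2 * ρ) := by
  obtain ⟨a', ha'⟩ := hne
  obtain ⟨a, rfl⟩ := QuotientAddGroup.mk_surjective a'
  let h := AddCircle.openPartialHomeomorphCoe (2 * Real.pi) a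
  have hIsub : I ⊆ h.target := fun x hx hxa => by
    rw [mem_singleton_iff.1 hxa] at hx
    exact disjoint_left.1 hd hx ha'
  set J : Set ℝ := h.symm '' I with hJ
  have hJc : OrdConnected J :=
    (hIc.image h.symm (h.continuousOn_symm.mono hIsub)).ordConnected
  have hJsub : J ⊆ Ioo a (a + 2 * Real.pi) := by
    rintro _ ⟨x, hx, rfl⟩
    exact h.map_target (hIsub hx)
  have hJI : ∀ θ ∈ J, ((θ : ℝ) : UnitCircle) ∈ I := by
    rintro _ ⟨x, hx, rfl⟩
    have : h (h.symm x) = x := h.right_inv (hIsub hx)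
    change h (h.symm x) ∈ I
    rwa [this]
  have hmem : ∀ θ ∈ Ioc a (a + 2 * Real.pi), ((θ : ℝ) : UnitCircle) ∈ I → θ ∈ J := by
    intro θ hθ hx
    have hθ' : θ ∈ h.source := by
      refine ⟨hθ.1, lt_of_le_of_ne hθ.2 fun he => ?_⟩
      rw [he, AddCircle.coe_add_period] at hx
      exact disjoint_left.1 hd hx ha'
    exact ⟨h θ, hx, h.left_inv hθ'⟩
  have hm : MeasurableSet (I ∩ {x | Metric.infDist x E ≤ ρ}) :=
    hI.measurableSet.inter (isClosed_le (Metric.continuous_infDist_pt E)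
      continuous_const).measurableSet
  rw [← (AddCircle.measurePreserving_mk (2 * Real.pi) a).measure_preimage hm.nullMeasurableSet]
  rw [Measure.restrict_apply (AddCircle.measurable_mk' hm)]
  have hsub : ((↑) : ℝ → UnitCircle) ⁻¹' (I ∩ {x | Metric.infDist x E ≤ ρ}) ∩
      Ioc a (a + 2 * Real.pi) ⊆ Icc (sInf J) (sInf J + ρ) ∪ Icc (sSup J - ρ) (sSup J) := by
    rintro θ ⟨⟨hxI, hxE⟩, hθ⟩
    have hθJ := hmem θ hθ hxI
    have hbb : BddBelow J := ⟨a, fun y hy => (hJsub hy).1.le⟩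
    have hba : BddAbove J := ⟨a + 2 * Real.pi, fun y hy => (hJsub hy).2.le⟩
    obtain ⟨y, hyE, hy⟩ := hE.isCompact.exists_infDist_eq_dist ⟨_, ha'⟩ (θ : UnitCircle)
    have hdist : ‖y - (θ : UnitCircle)‖ ≤ ρ := by
      rw [← dist_eq_norm, dist_comm, ← hy]; exact hxE
    obtain ⟨τ, hτ, hτn⟩ : ∃ τ : ℝ, ((τ : ℝ) : UnitCircle) = y - θ ∧ |τ| ≤ ρ := by
      obtain ⟨σ, hσ⟩ := QuotientAddGroup.mk_surjective (y - (θ : UnitCircle))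
      rw [← hσ] at hdist
      change ‖((σ : ℝ) : UnitCircle)‖ ≤ ρ at hdist
      rw [AddCircle.norm_eq] at hdist
      refine ⟨_, ?_, hdist⟩
      rw [← hσ]
      rw [AddCircle.coe_sub, sub_eq_self]
      rw [← zsmul_eq_mul, AddCircle.coe_zsmul, AddCircle.coe_period, smul_zero]
    have hnot : θ + τ ∉ J := fun hc => by
      have := hJI _ hc
      rw [AddCircle.coe_add, hτ, add_sub_cancel] at this
      exact disjoint_left.1 hd this hyE
    have h1 := csInf_le hbb hθJ
    have h2 := le_csSup hba hθJ
    have h3 := abs_le.1 hτn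
    by_contra hcon
    rw [mem_union, mem_Icc, mem_Icc] at hcon
    push Not at hcon
    have h4 := hcon.1 h1
    have h5 : θ < sSup J - ρ := by
      by_contra h6
      exact absurd (hcon.2 (not_lt.1 h6)) (not_lt.2 h2)
    obtain ⟨u, hu, hu'⟩ := exists_lt_of_csInf_lt ⟨θ, hθJ⟩ (show sInf J < θ + τ by linarith)
    obtain ⟨v, hv, hv'⟩ := exists_lt_of_lt_csSup ⟨θ, hθJ⟩ (show θ + τ < sSup J by linarith)
    exact hnot (hJc.out hu hv ⟨hu'.le, hv'.le⟩)
  refine (measure_mono hsub).trans ((measure_union_le _ _).trans (le_of_eq ?_))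
  rw [Real.volume_Icc, Real.volume_Icc, ← ENNReal.ofReal_add (by linarith) (by linarith)]
  congr 1; ring

lemma sum_geom_mul_min_le {q α ℓ : ℝ} (hq : q = 2 ^ (1 - α)) (hq1 : 1 < q) (hα1 : α < 1)
    (hℓ : 0 < ℓ) {n : ℕ} (hmin : ∀ m < n, ℓ < (1 / 2 : ℝ) ^ m) :
    ∑ i ∈ Finset.range n, q ^ i * min ℓ (8 * (1 / 2) ^ i) ≤ q / (q - 1) * ℓ ^ α := by
  have hq0 : 0 < q := by linarith
  rcases Nat.eq_zero_or_pos n with h | h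
  · rw [h]; simp only [Finset.range_zero, Finset.sum_empty]
    exact mul_nonneg (div_nonneg hq0.le (by linarith)) (by positivity)
  have hlt := hmin (n - 1) (by omega)
  have e1 : q ^ n = q * q ^ (n - 1) := by
    rw [← pow_succ']; congr 1; omega
  have e2 : q ^ (n - 1) * ℓ ^ (1 - α) ≤ 1 := by
    have : q ^ (n - 1) = ((2 : ℝ) ^ (n - 1)) ^ (1 - α) := by
      rw [hq, ← Real.rpow_natCast, ← Real.rpow_mul zero_le_two, mul_comm,
        Real.rpow_mul zero_le_two, Real.rpow_natCast]
    rw [this, ← Real.mul_rpow (by positivity) hℓ.le]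
    refine Real.rpow_le_one (by positivity) ?_ (by linarith)
    calc (2 : ℝ) ^ (n - 1) * ℓ ≤ 2 ^ (n - 1) * (1 / 2) ^ (n - 1) := by gcongr
      _ = 1 := by rw [← mul_pow]; norm_num
  have e3 : ℓ = ℓ ^ (1 - α) * ℓ ^ α := by
    rw [← Real.rpow_add hℓ]; simp
  have e4 : q ^ n * ℓ ≤ q * ℓ ^ α := by
    calc q ^ n * ℓ = q * ℓ ^ α * (q ^ (n - 1) * ℓ ^ (1 - α)) := by
          rw [e1]; nth_rewrite 1 [e3]; ring
      _ ≤ q * ℓ ^ α * 1 := mul_le_mul_of_nonneg_left e2 (by positivity)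
      _ = _ := mul_one _
  calc ∑ i ∈ Finset.range n, q ^ i * min ℓ (8 * (1 / 2) ^ i)
      ≤ ∑ i ∈ Finset.range n, q ^ i * ℓ := by
        refine Finset.sum_le_sum fun i _ => ?_
        exact mul_le_mul_of_nonneg_left (min_le_left _ _) (by positivity)
    _ = (q ^ n - 1) / (q - 1) * ℓ := by
        rw [← Finset.sum_mul, geom_sum_eq hq1.ne']
    _ ≤ q ^ n / (q - 1) * ℓ := by
        refine mul_le_mul_of_nonneg_right ?_ hℓ.le
        exact div_le_div_of_nonneg_right (by linarith) (by linarith)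
    _ ≤ q / (q - 1) * ℓ ^ α := by
        rw [div_mul_eq_mul_div, div_mul_eq_mul_div]
        exact div_le_div_of_nonneg_right e4 (by linarith)

lemma tsum_tail_geom_mul_min_le {q α ℓ : ℝ} (hκ : q / 2 = (1 / 2 : ℝ) ^ α) (hq0 : 0 < q)
    (hq2 : q < 2) (hα0 : 0 < α) {n : ℕ} (hn : (1 / 2 : ℝ) ^ n ≤ ℓ) :
    ∑' i : ℕ, ENNReal.ofReal (q ^ (i + n) * min ℓ (8 * (1 / 2) ^ (i + n))) ≤
      ENNReal.ofReal (8 / (1 - q / 2) * ℓ ^ α) := by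
  have hκ0 : 0 < q / 2 := by positivity
  have hκ1 : q / 2 < 1 := by linarith
  calc ∑' i : ℕ, ENNReal.ofReal (q ^ (i + n) * min ℓ (8 * (1 / 2) ^ (i + n)))
      ≤ ∑' i : ℕ, ENNReal.ofReal ((8 * (q / 2) ^ n) * (q / 2) ^ i) := by
        refine ENNReal.tsum_le_tsum fun i => ENNReal.ofReal_le_ofReal ?_
        calc _ ≤ q ^ (i + n) * (8 * (1 / 2) ^ (i + n)) :=
              mul_le_mul_of_nonneg_left (min_le_right _ _) (by positivity)
          _ = 8 * (q * (1 / 2)) ^ (i + n) := by rw [mul_pow]; ring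
          _ = _ := by rw [pow_add, ← div_eq_mul_one_div]; ring
    _ = ENNReal.ofReal ((8 * (q / 2) ^ n) * (1 - q / 2)⁻¹) := by
        rw [← ENNReal.ofReal_tsum_of_nonneg (fun i => by positivity)
          ((summable_geometric_of_lt_one hκ0.le hκ1).mul_left _), tsum_mul_left,
          tsum_geometric_of_lt_one hκ0.le hκ1]
    _ ≤ _ := by
        apply ENNReal.ofReal_le_ofReal
        have : (q / 2) ^ n ≤ ℓ ^ α := by
          rw [hκ, ← Real.rpow_natCast, ← Real.rpow_mul (by norm_num), mul_comm,
            Real.rpow_mul (by norm_num), Real.rpow_natCast]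
          exact Real.rpow_le_rpow (by positivity) hn hα0.le
        have h3 : 0 < (1 - q / 2)⁻¹ := inv_pos.2 (by linarith)
        calc _ ≤ (8 * ℓ ^ α) * (1 - q / 2)⁻¹ := by gcongr
          _ = _ := by rw [div_eq_mul_inv]; ring

/-- `∑ₙ qⁿ min(ℓ, 8·2⁻ⁿ) ≤ C ℓ^α` for `q = 2^(1-α)`. -/
lemma exists_tsum_min_le {α : ℝ} (hα0 : 0 < α) (hα1 : α < 1) :
    ∃ C : ℝ, 0 ≤ C ∧ ∀ ℓ : ℝ, 0 < ℓ →
      ∑' n : ℕ, ENNReal.ofReal (((2 : ℝ) ^ (1 - α)) ^ n * min ℓ (8 * (1 / 2) ^ n)) ≤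
        ENNReal.ofReal (C * ℓ ^ α) := by
  obtain ⟨q, hq⟩ : ∃ q : ℝ, q = 2 ^ (1 - α) := ⟨_, rfl⟩
  rw [← hq]
  have hq1 : 1 < q := by rw [hq]; exact Real.one_lt_rpow one_lt_two (by linarith)
  have hq2 : q < 2 := by
    calc q = 2 ^ (1 - α) := hq
      _ < 2 ^ (1 : ℝ) := Real.rpow_lt_rpow_of_exponent_lt one_lt_two (by linarith)
      _ = 2 := Real.rpow_one 2
  have hq0 : 0 < q := by linarith
  have hκ : q / 2 = (1 / 2 : ℝ) ^ α := by
    rw [hq, Real.rpow_sub two_pos, Real.rpow_one, Real.div_rpow zero_le_one zero_le_two,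
      Real.one_rpow, div_div, mul_comm, ← div_div, div_self two_ne_zero]
  have hA : 0 ≤ q / (q - 1) := div_nonneg hq0.le (by linarith)
  have hB : 0 ≤ 8 / (1 - q / 2) := div_nonneg (by norm_num) (by linarith)
  refine ⟨q / (q - 1) + 8 / (1 - q / 2), add_nonneg hA hB, fun ℓ hℓ => ?_⟩
  have hex : ∃ n : ℕ, (1 / 2 : ℝ) ^ n ≤ ℓ := by
    obtain ⟨n, hn⟩ := exists_pow_lt_of_lt_one hℓ (by norm_num : (1 / 2 : ℝ) < 1)
    exact ⟨n, hn.le⟩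
  obtain ⟨n, hspec, hmin⟩ : ∃ n : ℕ, (1 / 2 : ℝ) ^ n ≤ ℓ ∧ ∀ m < n, ℓ < (1 / 2 : ℝ) ^ m := by
    classical
    exact ⟨Nat.find hex, Nat.find_spec hex, fun m hm => not_le.1 (Nat.find_min hex hm)⟩
  have h1 : ∑ i ∈ Finset.range n, ENNReal.ofReal (q ^ i * min ℓ (8 * (1 / 2) ^ i)) ≤
      ENNReal.ofReal (q / (q - 1) * ℓ ^ α) := by
    rw [← ENNReal.ofReal_sum_of_nonneg (fun i _ => mul_nonneg (pow_nonneg hq0.le i)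
      (le_min hℓ.le (by positivity)))]
    exact ENNReal.ofReal_le_ofReal (sum_geom_mul_min_le hq hq1 hα1 hℓ hmin)
  have h2 := tsum_tail_geom_mul_min_le hκ hq0 hq2 hα0 hspec
  have hα : 0 ≤ ℓ ^ α := Real.rpow_nonneg hℓ.le α
  rw [add_mul, ENNReal.ofReal_add (mul_nonneg hA hα) (mul_nonneg hB hα)]
  rw [← Summable.sum_add_tsum_nat_add' (k := n) ENNReal.summable]
  exact add_le_add h1 h2

/-- The closed neighbourhood of `E` of radius `4·2⁻ⁿ`. -/
def nbhd (E : Set UnitCircle) (n : ℕ) : Set UnitCircle :=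
  {x | Metric.infDist x E ≤ 4 * (1 / 2) ^ n}

lemma isClosed_nbhd (E : Set UnitCircle) (n : ℕ) : IsClosed (nbhd E n) :=
  isClosed_le (Metric.continuous_infDist_pt E) continuous_const

lemma subset_nbhd (E : Set UnitCircle) (n : ℕ) : E ⊆ nbhd E n := fun x hx => by
  change Metric.infDist x E ≤ _
  rw [Metric.infDist_zero_of_mem hx]; positivity

lemma nbhd_succ_subset (E : Set UnitCircle) (n : ℕ) : nbhd E (n + 1) ⊆ nbhd E n := fun x hx => by
  refine le_trans (show Metric.infDist x E ≤ _ from hx) ?_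
  exact mul_le_mul_of_nonneg_left
    (pow_le_pow_of_le_one (by norm_num) (by norm_num) n.le_succ) (by norm_num)

lemma infDist_le (E : Set UnitCircle) (hne : E.Nonempty) (x : UnitCircle) :
    Metric.infDist x E ≤ Real.pi := by
  obtain ⟨y, hy⟩ := hne
  refine (Metric.infDist_le_dist_of_mem hy).trans ?_
  rw [dist_eq_norm]
  have := AddCircle.norm_le_half_period (2 * Real.pi) (x := x - y) (by positivity)
  rw [abs_of_pos (by positivity)] at this
  linarith

lemma nbhd_zero (E : Set UnitCircle) (hne : E.Nonempty) : nbhd E 0 = univ := by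
  refine eq_univ_of_forall fun x => ?_
  change Metric.infDist x E ≤ _
  rw [pow_zero, mul_one]
  exact (infDist_le E hne x).trans Real.pi_le_four

lemma summable_nbhd {α : ℝ} (hα0 : 0 < α) (hα1 : α < 1) {E : Set UnitCircle}
    (hE : IsAlphaCarlesonSet α E) (hne : E.Nonempty) :
    Summable fun n : ℕ => ((2 : ℝ) ^ (1 - α)) ^ n * volume.real (nbhd E n \ E) := by
  obtain ⟨hEc, I, hI, hdis, hU, hsum⟩ := hE
  obtain ⟨C, hC0, hC⟩ := exists_tsum_min_le hα0 hα1
  set q : ℝ := 2 ^ (1 - α) with hq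
  have hq0 : 0 < q := by positivity
  have hIE : ∀ k, Disjoint (I k) E := fun k => by
    rw [← subset_compl_iff_disjoint_right, ← hU]
    exact subset_iUnion I k
  have hvol : ∀ n, volume (nbhd E n \ E) = ∑' k, volume (I k ∩ nbhd E n) := by
    intro n
    have : nbhd E n \ E = ⋃ k, I k ∩ nbhd E n := by
      rw [← iUnion_inter, hU, sdiff_eq, inter_comm]
    rw [this, measure_iUnion]
    · exact fun i j hij => (hdis i j hij).mono inter_subset_left inter_subset_left
    · exact fun k => (hI k).1.measurableSet.inter (isClosed_nbhd E n).measurableSet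
  have hk : ∀ k n, ENNReal.ofReal (q ^ n) * volume (I k ∩ nbhd E n) ≤
      ENNReal.ofReal (q ^ n * min (volume (I k)).toReal (8 * (1 / 2) ^ n)) := by
    intro k n
    rw [ENNReal.ofReal_mul (by positivity)]
    refine mul_le_mul' le_rfl ?_
    rw [ENNReal.ofReal_min]
    refine le_min ?_ ?_
    · rw [ENNReal.ofReal_toReal (measure_ne_top _ _)]
      exact measure_mono inter_subset_left
    · refine (volume_arc_inter_thickening_le hEc hne (hI k).1 (hI k).2 (hIE k)
        (by positivity)).trans (le_of_eq ?_)
      congr 1; ring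
  have hfin : ∑' n : ℕ, ENNReal.ofReal (q ^ n * volume.real (nbhd E n \ E)) ≠ ⊤ := by
    have h1 : ∀ n, ENNReal.ofReal (q ^ n * volume.real (nbhd E n \ E)) =
        ∑' k, ENNReal.ofReal (q ^ n) * volume (I k ∩ nbhd E n) := by
      intro n
      rw [ENNReal.tsum_mul_left, ← hvol, ENNReal.ofReal_mul (by positivity), Measure.real,
        ENNReal.ofReal_toReal (measure_ne_top _ _)]
    simp only [h1]
    rw [ENNReal.tsum_comm]
    refine ne_top_of_le_ne_top (b := ∑' k, ENNReal.ofReal (C * (volume (I k)).toReal ^ α)) ?_ ?_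
    · simp only [ENNReal.ofReal_mul hC0]
      rw [ENNReal.tsum_mul_left]
      exact ENNReal.mul_ne_top ENNReal.ofReal_ne_top hsum.ne
    · refine ENNReal.tsum_le_tsum fun k => ?_
      rcases eq_or_lt_of_le (ENNReal.toReal_nonneg (a := volume (I k))) with h0 | h0
      · have : volume (I k) = 0 := by
          rcases (ENNReal.toReal_eq_zero_iff _).1 h0.symm with h | h
          · exact h
          · exact absurd h (measure_ne_top _ _)
        have h2 : ∀ n, volume (I k ∩ nbhd E n) = 0 := fun n =>
          measure_mono_null inter_subset_left this
        simp [h2]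
      · exact (ENNReal.tsum_le_tsum fun n => hk k n).trans (hC _ h0)
  have := ENNReal.summable_toReal hfin
  refine this.congr fun n => ?_
  rw [ENNReal.toReal_ofReal (by positivity)]

/-- The radii `1 - 2⁻ⁿ`. -/
def rad (n : ℕ) : ℝ := 1 - (1 / 2) ^ n

/-- Quotients of consecutive radii. -/
def rho (n : ℕ) : ℝ := rad n / rad (n + 1)

lemma half_pow_le_one (n : ℕ) : (1 / 2 : ℝ) ^ n ≤ 1 := pow_le_one₀ (by norm_num) (by norm_num)

lemma rad_nonneg (n : ℕ) : 0 ≤ rad n := by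
  have := half_pow_le_one n
  unfold rad; linarith

lemma rad_lt_one (n : ℕ) : rad n < 1 := by
  have : (0 : ℝ) < (1 / 2) ^ n := by positivity
  unfold rad; linarith

lemma half_le_rad_succ (n : ℕ) : 1 / 2 ≤ rad (n + 1) := by
  have := half_pow_le_one n
  unfold rad; rw [pow_succ]; linarith

lemma rho_nonneg (n : ℕ) : 0 ≤ rho n := div_nonneg (rad_nonneg n) (rad_nonneg _)

lemma one_sub_rho_le (n : ℕ) : 1 - rho n ≤ (1 / 2) ^ n := by
  have h := half_le_rad_succ n
  have h0 : 0 < rad (n + 1) := by linarith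
  have hp : (0 : ℝ) < (1 / 2) ^ n := by positivity
  rw [rho, sub_le_iff_le_add, ← sub_le_iff_le_add', le_div_iff₀ h0]
  have e : rad (n + 1) = rad n + (1 / 2) ^ n / 2 := by unfold rad; rw [pow_succ]; ring
  nlinarith

lemma rho_lt_one (n : ℕ) : rho n < 1 := by
  have h := half_le_rad_succ n
  have h0 : 0 < rad (n + 1) := by linarith
  rw [rho, div_lt_one h0]
  have hp : (0 : ℝ) < (1 / 2) ^ n := by positivity
  unfold rad; rw [pow_succ]; linarith

/-- The mass that the Poisson kernel moves from `E` to the complement of its neighbourhood. -/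
def leak (E : Set UnitCircle) (n : ℕ) : ℝ :=
  ∫ x in (nbhd E (n + 1))ᶜ, pint (rho n) (E.indicator fun _ => 1) x

lemma bddMeas_one_indicator {s : Set UnitCircle} (hs : MeasurableSet s) :
    BddMeas (s.indicator fun _ => (1 : ℝ)) := (BddMeas.const 1).indicator hs

lemma pint_nonneg {r : ℝ} (h0 : 0 ≤ r) (h1 : r < 1) {φ : UnitCircle → ℝ}
    (hφ : ∀ x, 0 ≤ φ x) (x : UnitCircle) : 0 ≤ pint r φ x :=
  integral_nonneg fun y => mul_nonneg (pker_nonneg h0 h1 _) (hφ y)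

lemma indicator_one_nonneg (s : Set UnitCircle) (x : UnitCircle) :
    0 ≤ s.indicator (fun _ => (1 : ℝ)) x := indicator_nonneg (fun _ _ => zero_le_one) x

lemma pint_indicator_le_sum {E : Set UnitCircle} (hE : IsClosed E) (hne : E.Nonempty) (n : ℕ)
    {x : UnitCircle} (hx : x ∉ nbhd E (n + 1)) :
    pint (rho n) (E.indicator fun _ => 1) x ≤
      ∑ j ∈ Finset.range (n + 1), 64 * (1 / 2) ^ (n - j) *
        (nbhd E j \ E).indicator (fun _ => 1) x := by
  obtain ⟨j, hjn, hj, hj'⟩ : ∃ j ≤ n, x ∈ nbhd E j ∧ x ∉ nbhd E (j + 1) := by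
    by_contra hcon
    push Not at hcon
    have : ∀ j ≤ n + 1, x ∈ nbhd E j := by
      intro j
      induction j with
      | zero => intro _; rw [nbhd_zero E hne]; trivial
      | succ j ih => intro hj; exact hcon j (by omega) (ih (by omega))
    exact hx (this _ le_rfl)
  have hxE : x ∉ E := fun h => hj' (subset_nbhd E _ h)
  have hd : 2 * (1 / 2 : ℝ) ^ j < Metric.infDist x E := by
    have : ¬ Metric.infDist x E ≤ 4 * (1 / 2) ^ (j + 1) := hj'
    rw [pow_succ] at this
    linarith [not_le.1 this]
  have h1 := pint_indicator_le (rho_nonneg n) (rho_lt_one n) hE.measurableSet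
    (s := 2 * (1 / 2) ^ j) (x := x) (by positivity)
    (by have := half_pow_le_one j; linarith)
    (fun y hy => by
      rw [← dist_eq_norm]
      exact hd.le.trans (Metric.infDist_le_dist_of_mem hy))
  have h2 : 128 * ((1 - rho n) / (2 * (1 / 2) ^ j)) ≤ 64 * (1 / 2) ^ (n - j) := by
    have e : (1 / 2 : ℝ) ^ n = (1 / 2) ^ (n - j) * (1 / 2) ^ j := by
      rw [← pow_add]; congr 1; omega
    have := one_sub_rho_le n
    calc _ ≤ 128 * ((1 / 2) ^ n / (2 * (1 / 2 : ℝ) ^ j)) := by gcongr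
      _ = _ := by rw [e]; field_simp; ring
  refine (h1.trans h2).trans ?_
  have := Finset.single_le_sum (f := fun j => 64 * (1 / 2 : ℝ) ^ (n - j) *
        (nbhd E j \ E).indicator (fun _ => 1) x) (s := Finset.range (n + 1))
    (fun i _ => mul_nonneg (by positivity) (indicator_one_nonneg _ _))
    (Finset.mem_range.2 (Nat.lt_succ_of_le hjn))
  simpa [hj, hxE] using this

lemma measurableSet_nbhd_diff {E : Set UnitCircle} (hE : IsClosed E) (n : ℕ) :
    MeasurableSet (nbhd E n \ E) := (isClosed_nbhd E n).measurableSet.diff hE.measurableSet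

lemma leak_nonneg (E : Set UnitCircle) (n : ℕ) : 0 ≤ leak E n :=
  integral_nonneg fun x =>
    pint_nonneg (rho_nonneg n) (rho_lt_one n) (indicator_one_nonneg E) x

lemma integral_indicator_one' {s : Set UnitCircle} (hs : MeasurableSet s) :
    ∫ x, s.indicator (fun _ => (1 : ℝ)) x = volume.real s := integral_indicator_one hs

lemma leak_le {E : Set UnitCircle} (hE : IsClosed E) (hne : E.Nonempty) (n : ℕ) :
    leak E n ≤ ∑ j ∈ Finset.range (n + 1), 64 * (1 / 2) ^ (n - j) *
      volume.real (nbhd E j \ E) := by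
  have hi : ∀ j, Integrable fun x => 64 * (1 / 2 : ℝ) ^ (n - j) *
        (nbhd E j \ E).indicator (fun _ => 1) x := fun j =>
    (bddMeas_one_indicator (measurableSet_nbhd_diff hE j)).integrable.const_mul _
  calc leak E n ≤ ∫ x in (nbhd E (n + 1))ᶜ, ∑ j ∈ Finset.range (n + 1),
        64 * (1 / 2) ^ (n - j) * (nbhd E j \ E).indicator (fun _ => 1) x := by
        refine setIntegral_mono_on ?_ ?_ (isClosed_nbhd E _).measurableSet.compl
          fun x hx => pint_indicator_le_sum hE hne n hx
        · exact ((bddMeas_one_indicator hE.measurableSet).pint (rho_nonneg n)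
            (rho_lt_one n)).integrable.integrableOn
        · exact (integrable_finsetSum _ fun j _ => hi j).integrableOn
    _ ≤ ∫ x, ∑ j ∈ Finset.range (n + 1),
        64 * (1 / 2) ^ (n - j) * (nbhd E j \ E).indicator (fun _ => 1) x := by
        refine setIntegral_le_integral (integrable_finsetSum _ fun j _ => hi j)
          (ae_of_all _ fun x => Finset.sum_nonneg fun j _ =>
            mul_nonneg (by positivity) (indicator_one_nonneg _ _))
    _ = _ := by
        rw [integral_finsetSum _ fun j _ => hi j]
        refine Finset.sum_congr rfl fun j _ => ?_
        rw [integral_const_mul, integral_indicator_one' (measurableSet_nbhd_diff hE j)]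

lemma summable_leak {α : ℝ} (hα0 : 0 < α) (hα1 : α < 1) {E : Set UnitCircle}
    (hE : IsAlphaCarlesonSet α E) (hne : E.Nonempty) :
    Summable fun n : ℕ => ((2 : ℝ) ^ (1 - α)) ^ n * leak E n := by
  have hs := summable_nbhd hα0 hα1 hE hne
  obtain ⟨q, hq⟩ : ∃ q : ℝ, q = 2 ^ (1 - α) := ⟨_, rfl⟩
  rw [← hq] at hs ⊢
  have hq0 : 0 < q := by rw [hq]; positivity
  have hq2 : q < 2 := by
    calc q = 2 ^ (1 - α) := hq
      _ < 2 ^ (1 : ℝ) := Real.rpow_lt_rpow_of_exponent_lt one_lt_two (by linarith)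
      _ = 2 := Real.rpow_one 2
  have hg := summable_geometric_of_lt_one (r := q / 2) (by positivity) (by linarith)
  have := (summable_norm_sum_mul_range_of_summable_norm hs.norm hg.norm).mul_left 64
  refine Summable.of_nonneg_of_le (fun n => mul_nonneg (by positivity) (leak_nonneg E n))
    (fun n => ?_) this
  calc q ^ n * leak E n ≤ q ^ n * ∑ j ∈ Finset.range (n + 1), 64 * (1 / 2) ^ (n - j) *
      volume.real (nbhd E j \ E) :=
        mul_le_mul_of_nonneg_left (leak_le hE.1 hne n) (by positivity)
    _ = 64 * ∑ k ∈ Finset.range (n + 1), q ^ k * volume.real (nbhd E k \ E) *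
        (q / 2) ^ (n - k) := by
        rw [Finset.mul_sum, Finset.mul_sum]
        refine Finset.sum_congr rfl fun j hj => ?_
        have hj' : j ≤ n := Nat.lt_succ_iff.1 (Finset.mem_range.1 hj)
        have : q ^ n = q ^ j * q ^ (n - j) := by rw [← pow_add]; congr 1; omega
        rw [this, div_eq_mul_one_div q 2, mul_pow]
        ring
    _ ≤ _ := mul_le_mul_of_nonneg_left (le_abs_self _) (by norm_num)

/-- The density obtained from `1` at level `n₀` by stopping outside the neighbourhoods of `E`
and spreading the rest with the Poisson kernel. -/
def sweep (E : Set UnitCircle) (n₀ : ℕ) : ℕ → UnitCircle → ℝ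
  | 0 => fun _ => 1
  | k + 1 => pint (rho (n₀ + k)) ((nbhd E (n₀ + k)).indicator (sweep E n₀ k))

lemma sweep_bddMeas (E : Set UnitCircle) (n₀ k : ℕ) : BddMeas (sweep E n₀ k) := by
  induction k with
  | zero => exact BddMeas.const 1
  | succ k ih =>
    exact (ih.indicator (isClosed_nbhd E _).measurableSet).pint (rho_nonneg _) (rho_lt_one _)

lemma sweep_nonneg (E : Set UnitCircle) (n₀ k : ℕ) (x : UnitCircle) : 0 ≤ sweep E n₀ k x := by
  induction k generalizing x with
  | zero => exact zero_le_one
  | succ k ih =>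
    exact pint_nonneg (rho_nonneg _) (rho_lt_one _) (fun y => indicator_nonneg (fun z _ => ih z) y) x

lemma sweep_le_one (E : Set UnitCircle) (n₀ k : ℕ) (x : UnitCircle) : sweep E n₀ k x ≤ 1 := by
  induction k generalizing x with
  | zero => exact le_rfl
  | succ k ih =>
    rw [← pint_const (rho_nonneg (n₀ + k)) (rho_lt_one _) 1 x]
    refine pint_mono (rho_nonneg _) (rho_lt_one _)
      ((sweep_bddMeas E n₀ k).indicator (isClosed_nbhd E _).measurableSet) (BddMeas.const 1)
      (fun y => ?_) x
    exact indicator_apply_le' (fun _ => ih y) (fun _ => zero_le_one)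

lemma setIntegral_sweep_compl_le {E : Set UnitCircle} (hE : IsClosed E) (n₀ k : ℕ) :
    ∫ x in (nbhd E (n₀ + k + 1))ᶜ, sweep E n₀ (k + 1) x ≤
      leak E (n₀ + k) + volume.real (nbhd E (n₀ + k) \ E) := by
  set n := n₀ + k with hn
  have h0 := rho_nonneg n
  have h1 := rho_lt_one n
  have hm1 := bddMeas_one_indicator hE.measurableSet
  have hm2 := bddMeas_one_indicator (measurableSet_nbhd_diff hE n)
  have hpt : ∀ x, sweep E n₀ (k + 1) x ≤ pint (rho n) (E.indicator fun _ => 1) x +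
      pint (rho n) ((nbhd E n \ E).indicator fun _ => 1) x := by
    intro x
    rw [← pint_add h0 h1 hm1 hm2]
    refine pint_mono h0 h1 ((sweep_bddMeas E n₀ k).indicator (isClosed_nbhd E _).measurableSet)
      (hm1.add hm2) (fun y => ?_) x
    change (nbhd E n).indicator (sweep E n₀ k) y ≤ _
    have := sweep_le_one E n₀ k y
    by_cases hyE : y ∈ E
    · have hy := subset_nbhd E n hyE
      simpa [hyE, hy]
    · by_cases hy : y ∈ nbhd E n
      · simpa [hyE, hy]
      · simp [hyE, hy]
  calc _ ≤ ∫ x in (nbhd E (n + 1))ᶜ, (pint (rho n) (E.indicator fun _ => 1) x +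
      pint (rho n) ((nbhd E n \ E).indicator fun _ => 1) x) :=
        integral_mono (sweep_bddMeas E n₀ (k + 1)).integrable.integrableOn
          ((hm1.pint h0 h1).add (hm2.pint h0 h1)).integrable.integrableOn hpt
    _ = leak E n + ∫ x in (nbhd E (n + 1))ᶜ,
        pint (rho n) ((nbhd E n \ E).indicator fun _ => 1) x :=
        integral_add (hm1.pint h0 h1).integrable.integrableOn
          (hm2.pint h0 h1).integrable.integrableOn
    _ ≤ leak E n + ∫ x, pint (rho n) ((nbhd E n \ E).indicator fun _ => 1) x := by
        refine add_le_add le_rfl ?_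
        exact setIntegral_le_integral (hm2.pint h0 h1).integrable
          (ae_of_all _ fun x => pint_nonneg h0 h1 (indicator_one_nonneg _) x)
    _ = _ := by
        congr 1
        have := integral_pint_mul h0 h1 hm2.integrable (BddMeas.const 1)
        simp only [pint_const h0 h1, mul_one] at this
        rw [this, integral_indicator_one' (measurableSet_nbhd_diff hE n)]

lemma setIntegral_one_sub_sweep_le {E : Set UnitCircle} (hE : IsClosed E) (n₀ k : ℕ) :
    ∫ x in E, (1 - sweep E n₀ (k + 1) x) ≤ (∫ x in E, (1 - sweep E n₀ k x)) +
      (leak E (n₀ + k) + volume.real (nbhd E (n₀ + k) \ E)) := by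
  set n := n₀ + k with hn
  have h0 := rho_nonneg n
  have h1 := rho_lt_one n
  have hUm := fun j => (isClosed_nbhd E j).measurableSet
  have hm1 := bddMeas_one_indicator hE.measurableSet
  have hm2 := (sweep_bddMeas E n₀ k).indicator (hUm n)
  have hg : BddMeas fun x => 1 - (nbhd E n).indicator (sweep E n₀ k) x := (BddMeas.const 1).sub hm2
  have hp := hm1.pint h0 h1
  have hp1 : ∀ x, pint (rho n) (E.indicator fun _ => 1) x ≤ 1 := fun x => by
    refine (pint_mono h0 h1 hm1 (BddMeas.const 1) (fun y => ?_) x).trans_eq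
      (pint_const h0 h1 1 x)
    exact indicator_apply_le' (fun _ => le_rfl) (fun _ => zero_le_one)
  have hp0 := pint_nonneg h0 h1 (indicator_one_nonneg E)
  have e1 : ∫ x in E, (1 - sweep E n₀ (k + 1) x) =
      ∫ x, (1 - (nbhd E n).indicator (sweep E n₀ k) x) *
        pint (rho n) (E.indicator fun _ => 1) x := by
    rw [← integral_pint_mul h0 h1 hg.integrable hm1, ← integral_indicator hE.measurableSet]
    congr 1
    ext x
    rw [pint_sub h0 h1 (BddMeas.const 1) hm2, pint_const h0 h1]
    by_cases hx : x ∈ E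
    · simp only [hx, indicator_of_mem, mul_one]; rfl
    · simp [hx]
  rw [e1]
  have hpt : ∀ x, (1 - (nbhd E n).indicator (sweep E n₀ k) x) *
        pint (rho n) (E.indicator fun _ => 1) x ≤
      E.indicator (fun x => 1 - sweep E n₀ k x) x +
      ((nbhd E (n + 1))ᶜ.indicator (pint (rho n) (E.indicator fun _ => 1)) x +
        (nbhd E n \ E).indicator (fun _ => 1) x) := by
    intro x
    have a1 := sweep_le_one E n₀ k x
    have a0 := sweep_nonneg E n₀ k x
    have b1 := hp1 x
    have b0 := hp0 x
    have c0 : 0 ≤ (nbhd E n).indicator (sweep E n₀ k) x :=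
      indicator_nonneg (fun z _ => sweep_nonneg E n₀ k z) x
    have c1 : (nbhd E n).indicator (sweep E n₀ k) x ≤ 1 :=
      indicator_apply_le' (fun _ => a1) (fun _ => zero_le_one)
    by_cases hx : x ∈ E
    · have h3 := subset_nbhd E n hx
      have h4 := subset_nbhd E (n + 1) hx
      simp only [hx, h3, h4, indicator_of_mem, mem_compl_iff, not_true, not_false_eq_true,
        indicator_of_notMem, Set.mem_sdiff, and_false]
      nlinarith
    · by_cases hx2 : x ∈ nbhd E (n + 1)
      · have h3 := nbhd_succ_subset E n hx2
        simp only [hx, hx2, h3, indicator_of_mem, mem_compl_iff, not_true, not_false_eq_true,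
          indicator_of_notMem, Set.mem_sdiff, and_true] at c0 c1 ⊢
        nlinarith
      · have h5 := indicator_one_nonneg (nbhd E n \ E) x
        simp only [hx, hx2, indicator_of_mem, mem_compl_iff, not_false_eq_true,
          indicator_of_notMem]
        nlinarith
  have i1 : BddMeas (E.indicator (fun x => 1 - sweep E n₀ k x)) :=
    ((BddMeas.const 1).sub (sweep_bddMeas E n₀ k)).indicator hE.measurableSet
  have i2 := hp.indicator (hUm (n + 1)).compl
  have i3 := bddMeas_one_indicator (measurableSet_nbhd_diff hE n)
  refine (integral_mono (hg.mul hp).integrable (i1.add (i2.add i3)).integrable hpt).trans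
    (le_of_eq ?_)
  rw [integral_add i1.integrable (i2.add i3).integrable,
    integral_add i2.integrable i3.integrable, integral_indicator hE.measurableSet,
    integral_indicator (hUm (n + 1)).compl, integral_indicator_one' (measurableSet_nbhd_diff hE n)]
  rfl

lemma integral_le_sweep {E : Set UnitCircle} {u : ℕ → UnitCircle → ℝ}
    (hu : ∀ n, BddMeas (u n)) (hsub : ∀ n x, u n x ≤ pint (rho n) (u (n + 1)) x)
    {B : ℕ → ℝ} (hB : ∀ n x, u n x ≤ B n) (n₀ k : ℕ) :
    ∫ x, u n₀ x ≤ (∑ i ∈ Finset.range k, B (n₀ + i) *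
      ∫ x in (nbhd E (n₀ + i))ᶜ, sweep E n₀ i x) + ∫ x, u (n₀ + k) x * sweep E n₀ k x := by
  induction k with
  | zero => simp [sweep]
  | succ k ih =>
    refine ih.trans ?_
    rw [Finset.sum_range_succ, add_assoc]
    refine add_le_add le_rfl ?_
    set n := n₀ + k with hn
    have hUm := (isClosed_nbhd E n).measurableSet
    have hs := sweep_bddMeas E n₀ k
    have hm := (hu n).mul hs
    rw [← integral_add_compl hUm hm.integrable, add_comm]
    refine add_le_add ?_ ?_
    · rw [← integral_const_mul]
      exact integral_mono hm.integrable.integrableOn (hs.integrable.const_mul _).integrableOn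
        fun x => mul_le_mul_of_nonneg_right (hB n x) (sweep_nonneg E n₀ k x)
    · have hs' := hs.indicator hUm
      have e := integral_pint_mul (rho_nonneg n) (rho_lt_one n) (hu (n + 1)).integrable hs'
      change _ ≤ ∫ x, u (n + 1) x * sweep E n₀ (k + 1) x
      change _ = ∫ x, u (n + 1) x * sweep E n₀ (k + 1) x at e
      rw [← e, ← integral_indicator hUm]
      refine integral_mono (hm.indicator hUm).integrable
        (((hu (n + 1)).pint (rho_nonneg n) (rho_lt_one n)).mul hs').integrable fun x => ?_
      by_cases hx : x ∈ nbhd E n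
      · simp only [hx, indicator_of_mem]
        exact mul_le_mul_of_nonneg_right (hsub n x) (sweep_nonneg E n₀ k x)
      · simp [hx]

lemma exists_sum_sweep_le {α : ℝ} (hα0 : 0 < α) (hα1 : α < 1) {E : Set UnitCircle}
    (hE : IsAlphaCarlesonSet α E) (hne : E.Nonempty) (n₀ : ℕ) :
    ∃ S : ℝ, ∀ k, ∑ i ∈ Finset.range k, ((2 : ℝ) ^ (1 - α)) ^ (n₀ + i) *
      (∫ x in (nbhd E (n₀ + i))ᶜ, sweep E n₀ i x) ≤ S := by
  have hs := (summable_leak hα0 hα1 hE hne).add (summable_nbhd hα0 hα1 hE hne)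
  obtain ⟨q, hq⟩ : ∃ q : ℝ, q = 2 ^ (1 - α) := ⟨_, rfl⟩
  rw [← hq] at hs ⊢
  have hq0 : 0 < q := by rw [hq]; positivity
  have hnn : ∀ n, 0 ≤ leak E n + volume.real (nbhd E n \ E) := fun n =>
    add_nonneg (leak_nonneg E n) measureReal_nonneg
  have hs' : Summable fun i : ℕ => q ^ (n₀ + i + 1) *
      (leak E (n₀ + i) + volume.real (nbhd E (n₀ + i) \ E)) := by
    have := ((summable_nat_add_iff n₀).2 hs).mul_left q
    refine this.congr fun i => ?_
    rw [add_comm i n₀, pow_succ]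
    ring
  refine ⟨(∑' i : ℕ, q ^ (n₀ + i + 1) *
      (leak E (n₀ + i) + volume.real (nbhd E (n₀ + i) \ E))) + q ^ n₀ * (2 * Real.pi),
    fun k => ?_⟩
  cases k with
  | zero =>
    simp only [Finset.range_zero, Finset.sum_empty]
    have : 0 ≤ ∑' i : ℕ, q ^ (n₀ + i + 1) *
        (leak E (n₀ + i) + volume.real (nbhd E (n₀ + i) \ E)) :=
      tsum_nonneg fun i => mul_nonneg (pow_pos hq0 (n₀ + i + 1)).le (hnn (n₀ + i))
    positivity
  | succ k =>
    rw [Finset.sum_range_succ']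
    refine add_le_add ?_ ?_
    · refine le_trans (Finset.sum_le_sum fun i _ => ?_)
        (hs'.sum_le_tsum (Finset.range k) fun i _ => mul_nonneg (by positivity) (hnn _))
      exact mul_le_mul_of_nonneg_left (setIntegral_sweep_compl_le hE.1 n₀ i) (by positivity)
    · refine mul_le_mul_of_nonneg_left ?_ (by positivity)
      simp only [sweep]
      refine (setIntegral_le_integral (integrable_const 1)
        (ae_of_all _ fun _ => zero_le_one)).trans_eq ?_
      rw [integral_const_circle, mul_one]

lemma exists_half_le_sweep {α : ℝ} (hα0 : 0 < α) (hα1 : α < 1) {E : Set UnitCircle}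
    (hE : IsAlphaCarlesonSet α E) (hpos : 0 < volume.real E) :
    ∃ n₀ : ℕ, ∀ k, volume.real E / 2 ≤ ∫ x in E, sweep E n₀ k x := by
  have hne : E.Nonempty := by
    rw [nonempty_iff_ne_empty]; rintro rfl; simp at hpos
  have hs := (summable_leak hα0 hα1 hE hne).add (summable_nbhd hα0 hα1 hE hne)
  have hnn : ∀ n, 0 ≤ leak E n + volume.real (nbhd E n \ E) := fun n =>
    add_nonneg (leak_nonneg E n) measureReal_nonneg
  have hs1 : Summable fun n => leak E n + volume.real (nbhd E n \ E) := by
    refine Summable.of_nonneg_of_le hnn (fun n => ?_) hs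
    have h1 : (1 : ℝ) ≤ (2 ^ (1 - α)) ^ n :=
      one_le_pow₀ (Real.one_le_rpow one_le_two (by linarith))
    rw [← mul_add]
    exact le_mul_of_one_le_left (hnn n) h1
  obtain ⟨n₀, hn₀⟩ := ((tendsto_sum_nat_add fun n => leak E n + volume.real (nbhd E n \ E)).eventually
    (gt_mem_nhds (show 0 < volume.real E / 2 by linarith))).exists
  refine ⟨n₀, fun k => ?_⟩
  have hk : ∫ x in E, (1 - sweep E n₀ k x) ≤ ∑ i ∈ Finset.range k,
      (leak E (n₀ + i) + volume.real (nbhd E (n₀ + i) \ E)) := by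
    induction k with
    | zero => simp [sweep]
    | succ k ih =>
      rw [Finset.sum_range_succ]
      exact (setIntegral_one_sub_sweep_le hE.1 n₀ k).trans (add_le_add ih le_rfl)
  have h2 : ∑ i ∈ Finset.range k, (leak E (n₀ + i) + volume.real (nbhd E (n₀ + i) \ E)) ≤
      volume.real E / 2 := by
    refine le_trans ?_ hn₀.le
    have := ((summable_nat_add_iff n₀).2 hs1).sum_le_tsum (Finset.range k) fun i _ => hnn _
    refine le_trans (le_of_eq ?_) this
    exact Finset.sum_congr rfl fun i _ => by rw [add_comm n₀ i]
  rw [integral_sub (integrable_const 1).integrableOn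
    (sweep_bddMeas E n₀ k).integrable.integrableOn] at hk
  simp only [setIntegral_const, smul_eq_mul, mul_one] at hk
  linarith

/-- The function `log max(|p|, η)` on the circle of radius `rad n`. -/
def levelLog (p : Polynomial ℂ) (η : ℝ) (n : ℕ) (x : UnitCircle) : ℝ :=
  Real.log (max ‖p.eval (rad n * circleEmbed x)‖ η)

lemma levelLog_bddMeas (p : Polynomial ℂ) {η : ℝ} (hη : 0 < η) (n : ℕ) :
    BddMeas (levelLog p η n) := BddMeas.of_continuous (continuous_log_max p hη _)

lemma levelLog_le_pint (p : Polynomial ℂ) {η : ℝ} (hη : 0 < η) (n : ℕ) (x : UnitCircle) :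
    levelLog p η n x ≤ pint (rho n) (levelLog p η (n + 1)) x := by
  have h := log_max_le_poisson (p.comp (Polynomial.C (rad (n + 1) : ℂ) * Polynomial.X)) hη
    (rho_nonneg n) (rho_lt_one n) x
  simp only [Polynomial.eval_comp, Polynomial.eval_mul, Polynomial.eval_C, Polynomial.eval_X,
    ← mul_assoc] at h
  have h0 : (rad (n + 1) : ℝ) ≠ 0 := by linarith [half_le_rad_succ n]
  have e : ((rad (n + 1) : ℝ) : ℂ) * (rho n : ℝ) = (rad n : ℝ) := by
    rw [← Complex.ofReal_mul, rho, mul_div_cancel₀ _ h0]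
  rw [e] at h
  exact h

lemma log_max_zero_le_levelLog (p : Polynomial ℂ) {η : ℝ} (hη : 0 < η) (n : ℕ) :
    2 * Real.pi * Real.log (max ‖p.eval 0‖ η) ≤ ∫ x, levelLog p η n x := by
  have h := log_max_zero_le (p.comp (Polynomial.C (rad n : ℂ) * Polynomial.X)) hη
  simpa [levelLog] using h

lemma tendsto_rad : Tendsto rad atTop (𝓝 1) := by
  have := (tendsto_pow_atTop_nhds_zero_of_lt_one (r := (1 / 2 : ℝ)) (by norm_num)
    (by norm_num)).const_sub 1
  rw [sub_zero] at this
  exact this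

lemma exists_levelLog_bound (p : Polynomial ℂ) {η : ℝ} (hη : 0 < η) :
    ∃ M : ℝ, 0 ≤ M ∧ ∀ n x, |levelLog p η n x| ≤ M := by
  have hc : Continuous fun z : ℂ => Real.log (max ‖p.eval z‖ η) :=
    Continuous.log (by fun_prop) fun y => (lt_max_of_lt_right hη).ne'
  obtain ⟨M, hM⟩ := (isCompact_closedBall (0 : ℂ) 1).exists_bound_of_continuousOn hc.continuousOn
  refine ⟨max M 0, le_max_right _ _, fun n x => (hM _ ?_).trans (le_max_left _ _)⟩
  simpa [abs_of_nonneg (rad_nonneg n)] using (rad_lt_one n).le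

lemma eventually_levelLog_le (p : Polynomial ℂ) {η : ℝ} (hη : 0 < η) {δ : ℝ} (hδ : 0 < δ) :
    ∀ᶠ n in atTop, ∀ x, levelLog p η n x ≤ Real.log (max ‖p.eval (circleEmbed x)‖ η) + δ := by
  have hc : Continuous fun z : ℂ => Real.log (max ‖p.eval z‖ η) :=
    Continuous.log (by fun_prop) fun y => (lt_max_of_lt_right hη).ne'
  have hu := (isCompact_closedBall (0 : ℂ) 1).uniformContinuousOn_of_continuous hc.continuousOn
  obtain ⟨κ, hκ, h⟩ := Metric.uniformContinuousOn_iff.1 hu δ hδ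
  filter_upwards [tendsto_rad.eventually (Metric.ball_mem_nhds 1 hκ)] with n hn x
  have := h (rad n * circleEmbed x)
    (by simpa [abs_of_nonneg (rad_nonneg n)] using (rad_lt_one n).le) (circleEmbed x)
    (by simp) (by
      rw [dist_eq_norm, ← sub_one_mul, norm_mul, norm_circleEmbed, mul_one]
      rw [← dist_eq_norm]
      have e : dist ((rad n : ℝ) : ℂ) 1 = dist (rad n) 1 := by
        rw [dist_eq_norm, dist_eq_norm, ← Complex.ofReal_one, ← Complex.ofReal_sub,
          Complex.norm_real]
      rw [e]; exact hn)
  rw [Real.dist_eq] at this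
  have := (abs_lt.1 this).2
  rw [levelLog]
  linarith

lemma measurable_nlog : Measurable nlog := by
  unfold nlog
  exact Measurable.ite (measurableSet_singleton 0) measurable_const
    (ENNReal.measurable_ofReal.comp (Real.measurable_log.comp measurable_inv))

lemma neg_log_le_toReal_nlog {s : ℝ} (hs : s ≠ 0) : -Real.log s ≤ (nlog s).toReal := by
  rw [nlog, if_neg hs, Real.log_inv, ENNReal.toReal_ofReal']
  exact le_max_left _ _

lemma setIntegral_log_max_le {t : ℝ} (ht : 0 < t) {w : UnitCircle → ℝ} (hw0 : ∀ ζ, 0 ≤ w ζ)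
    (hw1 : Integrable w) {E : Set UnitCircle}
    (hL : ∫⁻ ζ in E, nlog (w ζ) ≠ ⊤) (p : Polynomial ℂ) {η c V : ℝ} (hη : 0 < η) (hc : 0 < c)
    (hc1 : c ≤ 1) {m : UnitCircle → ℝ} (hm : BddMeas m) (hm0 : ∀ x, 0 ≤ m x)
    (hm1 : ∀ x, m x ≤ 1) (hV : V ≤ ∫ x in E, m x)
    (hp : ∫ x, ‖p.eval (circleEmbed x)‖ ^ t * w x ≤ c / 2)
    (hη' : η ^ t * ∫ x, w x ≤ c / 2) :
    t * ∫ x in E, Real.log (max ‖p.eval (circleEmbed x)‖ η) * m x ≤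
      Real.log c * V + 1 + ∫ x in E, (nlog (w x)).toReal := by
  have hnm : AEMeasurable (fun ζ => nlog (w ζ)) (volume.restrict E) :=
    (measurable_nlog.comp_aemeasurable hw1.aemeasurable).restrict
  have hni : Integrable (fun x => (nlog (w x)).toReal) (volume.restrict E) :=
    integrable_toReal_of_lintegral_ne_top hnm hL
  have hwE : ∀ᵐ x ∂volume.restrict E, w x ≠ 0 := by
    filter_upwards [ae_lt_top' hnm hL] with x hx h0
    simp [nlog, h0] at hx
  have hcont : Continuous fun x => ‖p.eval (circleEmbed x)‖ ^ t :=
    Continuous.rpow_const (by fun_prop) fun _ => Or.inr ht.le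
  have hbd : ∀ φ : UnitCircle → ℝ, Continuous φ → Integrable fun x => φ x * w x := by
    intro φ hφ
    obtain ⟨C, hC⟩ := (BddMeas.of_continuous hφ).2
    exact hw1.bdd_mul hφ.aestronglyMeasurable (ae_of_all _ hC)
  have hi1 := hbd _ hcont
  have hmaxc : Continuous fun x => (max ‖p.eval (circleEmbed x)‖ η) ^ t :=
    Continuous.rpow_const (by fun_prop) fun _ => Or.inr ht.le
  have hi2 := hbd _ hmaxc
  have hle2 : ∫ x, (max ‖p.eval (circleEmbed x)‖ η) ^ t * w x ≤ c := by
    calc _ ≤ ∫ x, (‖p.eval (circleEmbed x)‖ ^ t * w x + η ^ t * w x) := by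
          refine integral_mono hi2 (hi1.add (hw1.const_mul _)) fun x => ?_
          rw [← add_mul]
          exact mul_le_mul_of_nonneg_right (rpow_max_le (norm_nonneg _) hη.le) (hw0 x)
      _ = (∫ x, ‖p.eval (circleEmbed x)‖ ^ t * w x) + η ^ t * ∫ x, w x := by
          rw [integral_add hi1 (hw1.const_mul _), integral_const_mul]
      _ ≤ c := by linarith
  have hlc : Continuous fun x => Real.log (max ‖p.eval (circleEmbed x)‖ η) :=
    Continuous.log (by fun_prop) fun y => (lt_max_of_lt_right hη).ne'
  have hbm := (BddMeas.of_continuous hlc).mul hm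
  have hlog : Real.log c ≤ 0 := Real.log_nonpos hc.le hc1
  calc t * ∫ x in E, Real.log (max ‖p.eval (circleEmbed x)‖ η) * m x
      = ∫ x in E, t * (Real.log (max ‖p.eval (circleEmbed x)‖ η) * m x) :=
        (integral_const_mul _ _).symm
    _ ≤ ∫ x in E, (Real.log c * m x + c⁻¹ * ((max ‖p.eval (circleEmbed x)‖ η) ^ t * w x) +
          (nlog (w x)).toReal) := by
        refine integral_mono_ae (hbm.integrable.const_mul t).integrableOn
          (((hm.integrable.const_mul _).integrableOn.add
            (hi2.const_mul _).integrableOn).add hni) ?_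
        filter_upwards [hwE] with x hx
        have hwx : 0 < w x := lt_of_le_of_ne (hw0 x) (Ne.symm hx)
        set X := max ‖p.eval (circleEmbed x)‖ η with hX
        have hX0 : 0 < X := lt_max_of_lt_right hη
        have hXt : 0 < X ^ t := Real.rpow_pos_of_pos hX0 t
        have h1 := log_le_tangent hc (mul_pos hXt hwx)
        rw [Real.log_mul hXt.ne' hwx.ne', Real.log_rpow hX0] at h1
        have h2 := neg_log_le_toReal_nlog hx
        have h3 : 0 ≤ X ^ t * w x / c := by positivity
        have h4 : 0 ≤ (nlog (w x)).toReal := ENNReal.toReal_nonneg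
        have h5 : t * Real.log X ≤ Real.log c + X ^ t * w x / c + (nlog (w x)).toReal := by
          linarith
        have h6 := mul_le_mul_of_nonneg_right h5 (hm0 x)
        have h7 := mul_le_of_le_one_right (add_nonneg h3 h4) (hm1 x)
        have e : c⁻¹ * (X ^ t * w x) = X ^ t * w x / c := by ring
        simp only [e]
        linarith
    _ = Real.log c * (∫ x in E, m x) +
          c⁻¹ * (∫ x in E, (max ‖p.eval (circleEmbed x)‖ η) ^ t * w x) +
          ∫ x in E, (nlog (w x)).toReal := by
        have j1 : Integrable (fun x => Real.log c * m x) (volume.restrict E) :=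
          (hm.integrable.const_mul _).integrableOn
        have j2 : Integrable (fun x => c⁻¹ * ((max ‖p.eval (circleEmbed x)‖ η) ^ t * w x))
            (volume.restrict E) := (hi2.const_mul _).integrableOn
        rw [← integral_const_mul, ← integral_const_mul, ← integral_add j1 j2]
        exact integral_add (j1.add j2) hni
    _ ≤ _ := by
        refine add_le_add (add_le_add ?_ ?_) le_rfl
        · exact mul_le_mul_of_nonpos_left hV hlog
        · rw [inv_mul_le_one₀ hc]
          refine le_trans (setIntegral_le_integral hi2 (ae_of_all _ fun x => ?_)) hle2
          exact mul_nonneg (Real.rpow_nonneg (le_max_of_le_right hη.le) _) (hw0 x)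

lemma setIntegral_levelLog_le {E : Set UnitCircle} (hE : IsClosed E) (p : Polynomial ℂ)
    {η : ℝ} (hη : 0 < η) (hlim : Tendsto (fun n => volume.real (nbhd E n \ E)) atTop (𝓝 0))
    (n₀ : ℕ) {δ : ℝ} (hδ : 0 < δ) :
    ∃ k, ∫ x in nbhd E (n₀ + k), levelLog p η (n₀ + k) x * sweep E n₀ k x ≤
      (∫ x in E, Real.log (max ‖p.eval (circleEmbed x)‖ η) * sweep E n₀ k x) + δ := by
  obtain ⟨M, hM0, hM⟩ := exists_levelLog_bound p hη
  have hV : 0 ≤ volume.real E := measureReal_nonneg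
  have h1 := eventually_levelLog_le p hη (δ := δ / (2 * (volume.real E + 1))) (by positivity)
  have h2 : ∀ᶠ n in atTop, M * volume.real (nbhd E n \ E) < δ / 2 := by
    have := hlim.const_mul M
    rw [mul_zero] at this
    exact this.eventually (gt_mem_nhds (by linarith))
  obtain ⟨N, hN⟩ := eventually_atTop.1 (h1.and h2)
  refine ⟨N, ?_⟩
  obtain ⟨hN1, hN2⟩ := hN (n₀ + N) (by omega)
  set n := n₀ + N
  have hs := sweep_bddMeas E n₀ N
  have hm := (levelLog_bddMeas p hη n).mul hs
  have hlc : Continuous fun x => Real.log (max ‖p.eval (circleEmbed x)‖ η) :=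
    Continuous.log (by fun_prop) fun y => (lt_max_of_lt_right hη).ne'
  have hbm := (BddMeas.of_continuous hlc).mul hs
  have e : nbhd E n = E ∪ (nbhd E n \ E) := (union_sdiff_cancel (subset_nbhd E n)).symm
  rw [e, setIntegral_union disjoint_sdiff_right (measurableSet_nbhd_diff hE n)
    hm.integrable.integrableOn hm.integrable.integrableOn]
  have a1 : ∫ x in E, levelLog p η n x * sweep E n₀ N x ≤
      (∫ x in E, Real.log (max ‖p.eval (circleEmbed x)‖ η) * sweep E n₀ N x) + δ / 2 := by
    calc _ ≤ ∫ x in E, (Real.log (max ‖p.eval (circleEmbed x)‖ η) * sweep E n₀ N x +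
          δ / (2 * (volume.real E + 1))) := by
          refine integral_mono hm.integrable.integrableOn
            (hbm.add (BddMeas.const _)).integrable.integrableOn fun x => ?_
          have b1 := mul_le_mul_of_nonneg_right (hN1 x) (sweep_nonneg E n₀ N x)
          have b2 := mul_le_of_le_one_right
            (show 0 ≤ δ / (2 * (volume.real E + 1)) by positivity) (sweep_le_one E n₀ N x)
          simp only
          linarith
      _ = (∫ x in E, Real.log (max ‖p.eval (circleEmbed x)‖ η) * sweep E n₀ N x) +
          volume.real E * (δ / (2 * (volume.real E + 1))) := by
          rw [integral_add hbm.integrable.integrableOn (integrable_const _).integrableOn]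
          simp
      _ ≤ _ := by
          refine add_le_add le_rfl ?_
          rw [mul_div_assoc', div_le_div_iff₀ (by positivity) (by positivity)]
          nlinarith
  have a2 : ∫ x in nbhd E n \ E, levelLog p η n x * sweep E n₀ N x ≤ δ / 2 := by
    calc _ ≤ ∫ x in nbhd E n \ E, M := by
          refine integral_mono hm.integrable.integrableOn (integrable_const _).integrableOn
            fun x => ?_
          have b1 := mul_le_mul_of_nonneg_right ((le_abs_self _).trans (hM n x))
            (sweep_nonneg E n₀ N x)
          exact b1.trans (mul_le_of_le_one_right hM0 (sweep_le_one E n₀ N x))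
      _ = M * volume.real (nbhd E n \ E) := by simp [mul_comm]
      _ ≤ _ := hN2.le
  linarith

lemma half_pow_rpow (α : ℝ) (n : ℕ) :
    ((1 / 2 : ℝ) ^ n) ^ (α - 1) = ((2 : ℝ) ^ (1 - α)) ^ n := by
  rw [← Real.rpow_natCast, ← Real.rpow_natCast, ← Real.rpow_mul (by norm_num),
    ← Real.rpow_mul (by norm_num), one_div, Real.inv_rpow (by norm_num),
    ← Real.rpow_neg (by norm_num)]
  congr 1
  ring

lemma log_norm_zero_le {t ε α C S V : ℝ} (ht : 0 < t) (hC : 0 < C)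
    (hgrow : ∀ p : Polynomial ℂ, areaInt t ε α (fun y => p.eval y - 1) ≤ 1 →
      ∀ z : ℂ, ‖z‖ < 1 → Real.log (max ‖p.eval z‖ 1) ≤ C * (1 - ‖z‖) ^ (α - 1))
    {w : UnitCircle → ℝ} (hw0 : ∀ ζ, 0 ≤ w ζ) (hw1 : Integrable w)
    {E : Set UnitCircle} (hE : IsClosed E) (hL : ∫⁻ ζ in E, nlog (w ζ) ≠ ⊤)
    (hlim : Tendsto (fun n => volume.real (nbhd E n \ E)) atTop (𝓝 0)) {n₀ : ℕ}
    (hS : ∀ k, ∑ i ∈ Finset.range k, ((2 : ℝ) ^ (1 - α)) ^ (n₀ + i) *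
      (∫ x in (nbhd E (n₀ + i))ᶜ, sweep E n₀ i x) ≤ S)
    (hV : ∀ k, V ≤ ∫ x in E, sweep E n₀ k x) {c : ℝ} (hc : 0 < c) (hc1 : c ≤ 1)
    {p : Polynomial ℂ} (hp : areaInt t ε α (fun y => p.eval y - 1) ≤ 1)
    (hp' : ∫⁻ ζ, (‖p.eval (circleEmbed ζ)‖₊ : ENNReal) ^ t * ENNReal.ofReal (w ζ) ≤
      ENNReal.ofReal (c / 2)) (hp0 : 1 / 2 ≤ ‖p.eval 0‖) :
    2 * Real.pi * Real.log (1 / 2) ≤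
      C * S + (Real.log c * V + 1 + ∫ x in E, (nlog (w x)).toReal) / t + 1 := by
  have hW : 0 ≤ ∫ x, w x := integral_nonneg hw0
  set η : ℝ := (c / 2 / ((∫ x, w x) + 1)) ^ (1 / t) with hηdef
  have hb0 : 0 < c / 2 / ((∫ x, w x) + 1) := by positivity
  have hη : 0 < η := Real.rpow_pos_of_pos hb0 _
  have hη1 : η ≤ 1 := by
    refine Real.rpow_le_one hb0.le ?_ (by positivity)
    rw [div_le_one (by positivity)]
    linarith
  have hηt : η ^ t = c / 2 / ((∫ x, w x) + 1) := by
    rw [hηdef, ← Real.rpow_mul hb0.le, one_div_mul_cancel ht.ne', Real.rpow_one]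
  have hη' : η ^ t * ∫ x, w x ≤ c / 2 := by
    rw [hηt, div_mul_eq_mul_div, div_le_iff₀ (by positivity)]
    nlinarith
  have hpr : ∫ x, ‖p.eval (circleEmbed x)‖ ^ t * w x ≤ c / 2 := by
    rw [integral_eq_lintegral_of_nonneg_ae
      (ae_of_all _ fun x => mul_nonneg (Real.rpow_nonneg (norm_nonneg _) _) (hw0 x))]
    · refine ENNReal.toReal_le_of_le_ofReal (by positivity) (le_trans (le_of_eq ?_) hp')
      refine lintegral_congr fun x => ?_
      rw [ENNReal.ofReal_mul (Real.rpow_nonneg (norm_nonneg _) _),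
        ← ENNReal.ofReal_rpow_of_nonneg (norm_nonneg _) ht.le, ofReal_norm, enorm_eq_nnnorm]
    · exact (Continuous.aestronglyMeasurable (Continuous.rpow_const (by fun_prop)
        fun _ => Or.inr ht.le)).mul hw1.aestronglyMeasurable
  have hB : ∀ n x, levelLog p η n x ≤ C * ((2 : ℝ) ^ (1 - α)) ^ n := by
    intro n x
    have hn : ‖(rad n * circleEmbed x : ℂ)‖ = rad n := by
      simp [abs_of_nonneg (rad_nonneg n)]
    have := hgrow p hp (rad n * circleEmbed x) (by rw [hn]; exact rad_lt_one n)
    rw [hn, show 1 - rad n = (1 / 2) ^ n by unfold rad; ring, half_pow_rpow] at this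
    refine le_trans (Real.log_le_log (lt_max_of_lt_right hη) ?_) this
    exact max_le_max le_rfl hη1
  obtain ⟨k, hk⟩ := setIntegral_levelLog_le hE p hη hlim n₀ one_pos
  have h1 := (log_max_zero_le_levelLog p hη n₀).trans (integral_le_sweep (E := E)
    (levelLog_bddMeas p hη) (levelLog_le_pint p hη) hB n₀ k)
  have hUm := (isClosed_nbhd E (n₀ + k)).measurableSet
  have hs := sweep_bddMeas E n₀ k
  have hm := (levelLog_bddMeas p hη (n₀ + k)).mul hs
  have h2 : ∫ x in (nbhd E (n₀ + k))ᶜ, levelLog p η (n₀ + k) x * sweep E n₀ k x ≤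
      C * ((2 : ℝ) ^ (1 - α)) ^ (n₀ + k) * ∫ x in (nbhd E (n₀ + k))ᶜ, sweep E n₀ k x := by
    rw [← integral_const_mul]
    exact integral_mono hm.integrable.integrableOn (hs.integrable.const_mul _).integrableOn
      fun x => mul_le_mul_of_nonneg_right (hB _ x) (sweep_nonneg E n₀ k x)
  rw [← integral_add_compl hUm hm.integrable] at h1
  have h3 := hS (k + 1)
  rw [Finset.sum_range_succ] at h3
  have h3' := mul_le_mul_of_nonneg_left h3 hC.le
  rw [mul_add, Finset.mul_sum] at h3'
  simp only [mul_assoc] at h1 h2 h3'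
  have h4 := setIntegral_log_max_le ht hw0 hw1 hL p hη hc hc1 hs
    (sweep_nonneg E n₀ k) (sweep_le_one E n₀ k) (hV k) hpr hη'
  have h5 := (le_div_iff₀' ht).2 h4
  have h6 : Real.log (1 / 2) ≤ Real.log (max ‖p.eval 0‖ η) :=
    Real.log_le_log (by norm_num) (le_max_of_le_left hp0)
  have h7 := mul_le_mul_of_nonneg_left h6 Real.two_pi_pos.le
  simp only [mul_assoc] at h7 ⊢
  linarith

theorem lintegral_nlog_eq_top {t ε α : ℝ} (ht : 0 < t) (hε : 0 < ε)
    (hα0 : 0 < α) (hα1 : α < 1) {w : UnitCircle → ℝ} (hw0 : ∀ ζ, 0 ≤ w ζ)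
    (hw1 : Integrable w) {p : ℕ → Polynomial ℂ}
    (hp : Tendsto (fun k => ∫⁻ ζ, (‖(p k).eval (circleEmbed ζ)‖₊ : ENNReal) ^ t *
          ENNReal.ofReal (w ζ)) atTop (𝓝 0))
    (hp' : Tendsto (fun k => areaInt t ε α fun y => (p k).eval y - 1) atTop (𝓝 0))
    {E : Set UnitCircle} (hE : IsAlphaCarlesonSet α E) (hpos : 0 < volume E) :
    ∫⁻ ζ in E, nlog (w ζ) = ⊤ := by
  by_contra hL
  have hV : 0 < volume.real E := ENNReal.toReal_pos hpos.ne' (measure_ne_top _ _)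
  have hne : E.Nonempty := nonempty_of_measure_ne_zero hpos.ne'
  obtain ⟨C, hC, hgrow⟩ := exists_log_growth (α := α) ht hε hα1
  obtain ⟨A, hA, hzero⟩ := exists_norm_zero_ge (α := α) ht hε hα1
  obtain ⟨n₀, hn₀⟩ := exists_half_le_sweep hα0 hα1 hE hV
  obtain ⟨S, hS⟩ := exists_sum_sweep_le hα0 hα1 hE hne n₀
  have hlim : Tendsto (fun n => volume.real (nbhd E n \ E)) atTop (𝓝 0) := by
    refine squeeze_zero (fun _ => measureReal_nonneg) (fun n => ?_)
      (summable_nbhd hα0 hα1 hE hne).tendsto_atTop_zero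
    exact le_mul_of_one_le_left measureReal_nonneg
      (one_le_pow₀ (Real.one_le_rpow one_le_two (by linarith)))
  set L := ∫ x in E, (nlog (w x)).toReal
  have key : ∀ X : ℝ, 0 ≤ X → 2 * Real.pi * Real.log (1 / 2) ≤
      C * S + (-X * (volume.real E / 2) + 1 + L) / t + 1 := by
    intro X hX
    have hc : 0 < Real.exp (-X) := Real.exp_pos _
    have e1 := hp.eventually (eventually_le_nhds (b := ENNReal.ofReal (Real.exp (-X) / 2))
      (ENNReal.ofReal_pos.2 (by positivity)))
    have e2 := hp'.eventually (eventually_le_nhds (b := (1 : ENNReal)) zero_lt_one)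
    have e3 := hp'.eventually (eventually_le_nhds (b := ENNReal.ofReal A) (ENNReal.ofReal_pos.2 hA))
    obtain ⟨k, h1, h2, h3⟩ := (e1.and (e2.and e3)).exists
    have := log_norm_zero_le ht hC hgrow hw0 hw1 hE.1 hL hlim hS hn₀ hc
      (Real.exp_le_one_iff.2 (by linarith)) h2 h1 (hzero _ h3)
    rwa [Real.log_exp] at this
  set K := 2 * Real.pi * Real.log (1 / 2)
  have h := key (max 0 ((C * S + (1 + L) / t + 2 - K) * t * (2 / volume.real E))) (le_max_left _ _)
  have h1 := le_max_right 0 ((C * S + (1 + L) / t + 2 - K) * t * (2 / volume.real E))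
  set X := max 0 ((C * S + (1 + L) / t + 2 - K) * t * (2 / volume.real E))
  have h2 : (C * S + (1 + L) / t + 2 - K) ≤ X * (volume.real E / 2) / t := by
    rw [le_div_iff₀ ht]
    have := mul_le_mul_of_nonneg_right h1 (show 0 ≤ volume.real E / 2 by positivity)
    refine le_trans (le_of_eq ?_) this
    field_simp
  have e : (-X * (volume.real E / 2) + 1 + L) / t =
      (1 + L) / t - X * (volume.real E / 2) / t := by ring
  rw [e] at h
  linarith

/-- The length of a dyadic arc of generation `n`. -/
def dlen (n : ℕ) : ℝ := 2 * Real.pi / 2 ^ n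

/-- The representative of a point of the circle in `[0, 2π)`. -/
def angle (x : UnitCircle) : ℝ := (AddCircle.equivIco (2 * Real.pi) 0 x : ℝ)

/-- The index of the dyadic arc of generation `n` that contains `x`. -/
def dyIdx (n : ℕ) (x : UnitCircle) : ℕ := ⌊angle x / dlen n⌋₊

/-- The half-open dyadic arcs. -/
def cell (n k : ℕ) : Set UnitCircle := {x | dyIdx n x = k}

lemma dlen_pos (n : ℕ) : 0 < dlen n := by unfold dlen; positivity

lemma dlen_succ (n : ℕ) : dlen (n + 1) = dlen n / 2 := by
  unfold dlen; rw [pow_succ]; field_simp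

lemma dlen_anti {m n : ℕ} (h : m ≤ n) : dlen n ≤ dlen m :=
  div_le_div_of_nonneg_left (by positivity) (by positivity)
    (pow_le_pow_right₀ one_le_two h)

lemma tendsto_dlen : Tendsto dlen atTop (𝓝 0) := by
  have := (tendsto_pow_atTop_nhds_zero_of_lt_one (r := (1 / 2 : ℝ)) (by norm_num)
    (by norm_num)).const_mul (2 * Real.pi)
  rw [mul_zero] at this
  refine this.congr fun n => ?_
  rw [dlen, one_div, inv_pow, div_eq_mul_inv]

lemma angle_nonneg (x : UnitCircle) : 0 ≤ angle x := (AddCircle.equivIco (2 * Real.pi) 0 x).2.1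

lemma angle_lt (x : UnitCircle) : angle x < 2 * Real.pi := by
  have h := (AddCircle.equivIco (2 * Real.pi) 0 x).2.2
  exact h.trans_eq (zero_add _)

lemma coe_angle (x : UnitCircle) : ((angle x : ℝ) : UnitCircle) = x :=
  (AddCircle.equivIco (2 * Real.pi) 0).symm_apply_apply x

lemma angle_coe {θ : ℝ} (h0 : 0 ≤ θ) (h1 : θ < 2 * Real.pi) : angle (θ : UnitCircle) = θ := by
  have := (AddCircle.equivIco (2 * Real.pi) 0).apply_symm_apply ⟨θ, h0, by simpa using h1⟩
  exact congrArg Subtype.val this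

lemma measurable_angle : Measurable angle :=
  measurable_subtype_coe.comp (AddCircle.measurableEquivIco (2 * Real.pi) 0).measurable

lemma measurable_dyIdx (n : ℕ) : Measurable (dyIdx n) :=
  Nat.measurable_floor.comp (measurable_angle.div_const _)

lemma measurableSet_cell (n k : ℕ) : MeasurableSet (cell n k) :=
  measurable_dyIdx n (measurableSet_singleton k)

lemma dyIdx_succ_div_two (n : ℕ) (x : UnitCircle) : dyIdx (n + 1) x / 2 = dyIdx n x := by
  unfold dyIdx
  rw [← Nat.floor_div_natCast, dlen_succ]
  congr 1
  have := (dlen_pos n).ne'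
  push_cast
  field_simp

lemma dyIdx_eq_of_le {m n : ℕ} (h : m ≤ n) {x y : UnitCircle} (hxy : dyIdx n x = dyIdx n y) :
    dyIdx m x = dyIdx m y := by
  induction n, h using Nat.le_induction with
  | base => exact hxy
  | succ n _ ih => exact ih (by rw [← dyIdx_succ_div_two, hxy, dyIdx_succ_div_two])

lemma dyIdx_lt (n : ℕ) (x : UnitCircle) : dyIdx n x < 2 ^ n := by
  unfold dyIdx
  rw [Nat.floor_lt (div_nonneg (angle_nonneg x) (dlen_pos n).le), div_lt_iff₀ (dlen_pos n)]
  have : ((2 ^ n : ℕ) : ℝ) * dlen n = 2 * Real.pi := by unfold dlen; push_cast; field_simp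
  rw [this]
  exact angle_lt x

lemma mem_cell_iff {n k : ℕ} {x : UnitCircle} :
    x ∈ cell n k ↔ k * dlen n ≤ angle x ∧ angle x < (k + 1) * dlen n := by
  change ⌊angle x / dlen n⌋₊ = k ↔ _
  rw [Nat.floor_eq_iff (div_nonneg (angle_nonneg x) (dlen_pos n).le), le_div_iff₀ (dlen_pos n),
    div_lt_iff₀ (dlen_pos n)]

lemma cell_disjoint {n k l : ℕ} (h : k ≠ l) : Disjoint (cell n k) (cell n l) :=
  disjoint_left.2 fun _ hx hy => h (hx.symm.trans hy)

lemma cell_subset_or_disjoint {m n : ℕ} (h : m ≤ n) (k l : ℕ) :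
    cell n l ⊆ cell m k ∨ Disjoint (cell n l) (cell m k) := by
  by_cases hd : Disjoint (cell n l) (cell m k)
  · exact Or.inr hd
  · left
    obtain ⟨x, hx, hx'⟩ := not_disjoint_iff.1 hd
    intro y hy
    exact (dyIdx_eq_of_le h (hy.trans hx.symm)).trans hx'

lemma cell_eq_union (n k : ℕ) : cell n k = cell (n + 1) (2 * k) ∪ cell (n + 1) (2 * k + 1) := by
  ext x
  have := dyIdx_succ_div_two n x
  change dyIdx n x = k ↔ dyIdx (n + 1) x = 2 * k ∨ dyIdx (n + 1) x = 2 * k + 1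
  omega

/-- The interior of a dyadic arc. -/
def openCell (n k : ℕ) : Set UnitCircle :=
  (fun θ : ℝ => (θ : UnitCircle)) '' Ioo (k * dlen n) ((k + 1) * dlen n)

lemma isOpen_openCell (n k : ℕ) : IsOpen (openCell n k) :=
  QuotientAddGroup.isOpenMap_coe _ isOpen_Ioo

lemma isPreconnected_openCell (n k : ℕ) : IsPreconnected (openCell n k) :=
  isPreconnected_Ioo.image _ (AddCircle.continuous_mk' _).continuousOn

lemma succ_mul_dlen_le {n k : ℕ} (hk : k < 2 ^ n) : ((k : ℝ) + 1) * dlen n ≤ 2 * Real.pi := by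
  have h1 : ((k : ℝ) + 1) ≤ 2 ^ n := by exact_mod_cast hk
  have : (2 : ℝ) ^ n * dlen n = 2 * Real.pi := by unfold dlen; field_simp
  rw [← this]
  exact mul_le_mul_of_nonneg_right h1 (dlen_pos n).le

lemma openCell_subset_cell {n k : ℕ} (hk : k < 2 ^ n) : openCell n k ⊆ cell n k := by
  rintro _ ⟨θ, ⟨h1, h2⟩, rfl⟩
  have h0 : 0 ≤ θ := le_trans (mul_nonneg (Nat.cast_nonneg k) (dlen_pos n).le) h1.le
  have h3 := succ_mul_dlen_le hk
  simp only [mem_cell_iff, angle_coe h0 (h2.trans_le h3)]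
  exact ⟨h1.le, h2⟩

lemma cell_diff_openCell_subset (n k : ℕ) :
    cell n k \ openCell n k ⊆ {((k * dlen n : ℝ) : UnitCircle)} := by
  rintro x ⟨hx, hx'⟩
  obtain ⟨h1, h2⟩ := mem_cell_iff.1 hx
  rcases h1.eq_or_lt with h | h
  · rw [mem_singleton_iff, h, coe_angle]
  · exact absurd ⟨angle x, ⟨h, h2⟩, coe_angle x⟩ hx'

lemma volume_cell {n k : ℕ} (hk : k < 2 ^ n) : volume (cell n k) = ENNReal.ofReal (dlen n) := by
  have hmp := AddCircle.measurePreserving_mk (2 * Real.pi) 0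
  rw [← hmp.measure_preimage (measurableSet_cell n k).nullMeasurableSet,
    Measure.restrict_apply (AddCircle.measurable_mk' (measurableSet_cell n k))]
  have h0 : 0 ≤ (k : ℝ) * dlen n := mul_nonneg (Nat.cast_nonneg k) (dlen_pos n).le
  have h3 := succ_mul_dlen_le hk
  have e : ENNReal.ofReal (dlen n) = volume (Ioo (k * dlen n) ((k + 1) * dlen n)) := by
    rw [Real.volume_Ioo]; congr 1; ring
  rw [e]
  apply le_antisymm
  · have : volume (Ioo (k * dlen n) ((k + 1) * dlen n)) =
        volume (Ico (k * dlen n) ((k + 1) * dlen n) ∪ {2 * Real.pi}) := by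
      rw [measure_congr (union_ae_eq_left_of_ae_eq_empty (ae_eq_empty.2 (measure_singleton _))),
        Real.volume_Ioo, Real.volume_Ico]
    rw [this]
    refine measure_mono ?_
    rintro θ ⟨h1, h2, h4⟩
    rw [zero_add] at h4
    rcases h4.eq_or_lt with h | h
    · exact Or.inr h
    · left
      have h1' := mem_cell_iff.1 h1
      rwa [angle_coe h2.le h] at h1'
  · refine measure_mono fun θ hθ => ⟨openCell_subset_cell hk ⟨θ, hθ, rfl⟩, h0.trans_lt hθ.1, ?_⟩
    rw [zero_add]
    exact hθ.2.le.trans h3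

lemma volume_real_cell {n k : ℕ} (hk : k < 2 ^ n) : volume.real (cell n k) = dlen n := by
  rw [Measure.real, volume_cell hk, ENNReal.toReal_ofReal (dlen_pos n).le]

lemma volume_circle_singleton (x : UnitCircle) : volume ({x} : Set UnitCircle) = 0 := by
  have := AddCircle.volume_closedBall (2 * Real.pi) (x := x) 0
  rw [Metric.closedBall_zero] at this
  rw [this, mul_zero, min_eq_right Real.two_pi_pos.le, ENNReal.ofReal_zero]

lemma volume_openCell {n k : ℕ} (hk : k < 2 ^ n) :
    volume (openCell n k) = ENNReal.ofReal (dlen n) := by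
  rw [← volume_cell hk]
  refine le_antisymm (measure_mono (openCell_subset_cell hk)) ?_
  calc volume (cell n k) ≤ volume (openCell n k ∪ {((k * dlen n : ℝ) : UnitCircle)}) := by
        refine measure_mono fun x hx => ?_
        by_cases h : x ∈ openCell n k
        · exact Or.inl h
        · exact Or.inr (cell_diff_openCell_subset n k ⟨hx, h⟩)
    _ = _ := measure_congr (union_ae_eq_left_of_ae_eq_empty
        (ae_eq_empty.2 (volume_circle_singleton _)))

lemma cell_eq_empty {n k : ℕ} (hk : 2 ^ n ≤ k) : cell n k = ∅ := by
  refine eq_empty_of_forall_notMem fun x hx => ?_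
  have := dyIdx_lt n x
  have hx' : dyIdx n x = k := hx
  omega

lemma volume_real_cell_le (n k : ℕ) : volume.real (cell n k) ≤ dlen n := by
  rcases lt_or_ge k (2 ^ n) with h | h
  · exact (volume_real_cell h).le
  · rw [cell_eq_empty h]; simpa using (dlen_pos n).le

lemma norm_circleEmbed_sub_le {n k : ℕ} {x y : UnitCircle} (hx : x ∈ cell n k)
    (hy : y ∈ cell n k) : ‖circleEmbed x - circleEmbed y‖ ≤ dlen n := by
  rw [← coe_angle x, ← coe_angle y, circleEmbed_coe, circleEmbed_coe, mul_comm,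
    mul_comm (angle y : ℂ)]
  have h := Real.norm_exp_I_mul_ofReal_sub_one_le (x := angle x - angle y)
  have e : Complex.exp (Complex.I * angle x) - Complex.exp (Complex.I * angle y) =
      Complex.exp (Complex.I * angle y) *
        (Complex.exp (Complex.I * ((angle x - angle y : ℝ) : ℂ)) - 1) := by
    rw [mul_sub, ← Complex.exp_add]
    push_cast
    ring_nf
  rw [e, norm_mul, mul_comm Complex.I, Complex.norm_exp_ofReal_mul_I, one_mul]
  refine h.trans ?_
  obtain ⟨a1, a2⟩ := mem_cell_iff.1 hx
  obtain ⟨b1, b2⟩ := mem_cell_iff.1 hy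
  rw [Real.norm_eq_abs, abs_le]
  constructor <;> nlinarith

lemma integral_eq_sum_cell {F : Type*} [NormedAddCommGroup F] [NormedSpace ℝ F]
    {φ : UnitCircle → F} (hφ : Integrable φ) (n : ℕ) :
    ∫ x, φ x = ∑ k ∈ Finset.range (2 ^ n), ∫ x in cell n k, φ x := by
  rw [← integral_biUnion_finset _ (fun k _ => measurableSet_cell n k)
    (fun k _ l _ h => cell_disjoint h) (fun k _ => hφ.integrableOn)]
  have : (⋃ k ∈ Finset.range (2 ^ n), cell n k) = univ := by
    refine eq_univ_of_forall fun x => ?_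
    simp only [mem_iUnion]
    exact ⟨dyIdx n x, Finset.mem_range.2 (dyIdx_lt n x), rfl⟩
  rw [this, setIntegral_univ]

/-- A finite disjoint family of dyadic subarcs of `cell m k` for which the total capacity of the
family plus the mass of `R` on the uncovered part is at most `c`. -/
def IsCut (δ α : ℝ) (R : UnitCircle → ℝ) (m k : ℕ) (c : ℝ) (F : Finset (ℕ × ℕ)) : Prop :=
  (∀ J ∈ F, m ≤ J.1 ∧ J.2 < 2 ^ J.1 ∧ cell J.1 J.2 ⊆ cell m k) ∧
  (∀ J ∈ F, ∀ J' ∈ F, J ≠ J' → Disjoint (cell J.1 J.2) (cell J'.1 J'.2)) ∧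
  (∑ J ∈ F, δ * dlen J.1 ^ α) + ∫ x in cell m k \ ⋃ J ∈ F, cell J.1 J.2, R x ≤ c

/-- A density below `R` carried by `cell m k`, of total mass `s`, respecting the capacity of
every dyadic arc of generation at least `m`. -/
def IsFlow (δ α : ℝ) (R : UnitCircle → ℝ) (m k : ℕ) (s : ℝ) (g : UnitCircle → ℝ) : Prop :=
  Measurable g ∧ (∀ x, 0 ≤ g x ∧ g x ≤ R x) ∧ (∀ x, x ∉ cell m k → g x = 0) ∧
  ∫ x, g x = s ∧ ∀ j, m ≤ j → ∀ l, ∫ x in cell j l, g x ≤ δ * dlen j ^ α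

lemma bddMeas_of_le {R g : UnitCircle → ℝ} {K : ℝ} (hR : ∀ x, R x ≤ K) (hg : Measurable g)
    (h : ∀ x, 0 ≤ g x ∧ g x ≤ R x) : BddMeas g :=
  ⟨hg, K, fun x => by rw [abs_of_nonneg (h x).1]; exact (h x).2.trans (hR x)⟩

lemma setIntegral_cell_le {R : UnitCircle → ℝ} {K : ℝ} (hR : BddMeas R) (hK0 : 0 ≤ K)
    (hK : ∀ x, R x ≤ K) (j l : ℕ) : ∫ x in cell j l, R x ≤ K * dlen j := by
  calc _ ≤ ∫ x in cell j l, K :=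
        integral_mono hR.integrable.integrableOn (integrable_const _).integrableOn hK
    _ = volume.real (cell j l) * K := by simp
    _ ≤ _ := by
        rw [mul_comm]
        exact mul_le_mul_of_nonneg_left (volume_real_cell_le j l) hK0

lemma rpow_mul_dlen_le {α δ : ℝ} (hδ : 0 < δ) (hα1 : α < 1) {n j : ℕ} (h : n ≤ j) :
    δ * dlen n ^ (α - 1) * dlen j ≤ δ * dlen j ^ α := by
  rw [mul_assoc]
  refine mul_le_mul_of_nonneg_left ?_ hδ.le
  have h1 : dlen n ^ (α - 1) ≤ dlen j ^ (α - 1) :=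
    Real.rpow_le_rpow_of_nonpos (dlen_pos j) (dlen_anti h) (by linarith)
  refine (mul_le_mul_of_nonneg_right h1 (dlen_pos j).le).trans_eq ?_
  rw [← Real.rpow_add_one (dlen_pos j).ne']
  congr 1
  ring

lemma isFlow_base {δ α : ℝ} (hδ : 0 < δ) (hα1 : α < 1) {n : ℕ} {R : UnitCircle → ℝ}
    (hRm : Measurable R) (hR0 : ∀ x, 0 ≤ R x) (hRK : ∀ x, R x ≤ δ * dlen n ^ (α - 1))
    (k : ℕ) {s : ℝ} (hs0 : 0 ≤ s) (hs : s ≤ ∫ x in cell n k, R x) :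
    ∃ g, IsFlow δ α R n k s g := by
  have hR : BddMeas R := bddMeas_of_le hRK hRm fun x => ⟨hR0 x, le_rfl⟩
  have hK0 : 0 ≤ δ * dlen n ^ (α - 1) := mul_nonneg hδ.le (Real.rpow_nonneg (dlen_pos n).le _)
  obtain ⟨a, ha0, ha1, ha⟩ : ∃ a : ℝ, 0 ≤ a ∧ a ≤ 1 ∧ a * ∫ x in cell n k, R x = s := by
    rcases (hs0.trans hs).eq_or_lt with h | h
    · exact ⟨0, le_rfl, zero_le_one, by linarith⟩
    · exact ⟨s / ∫ x in cell n k, R x, by positivity, (div_le_one h).2 hs, div_mul_cancel₀ _ h.ne'⟩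
  have hg : ∀ x, 0 ≤ (cell n k).indicator (fun x => a * R x) x ∧
      (cell n k).indicator (fun x => a * R x) x ≤ R x := fun x =>
    ⟨indicator_nonneg (fun y _ => mul_nonneg ha0 (hR0 y)) x,
      indicator_apply_le' (fun _ => mul_le_of_le_one_left (hR0 x) ha1) fun _ => hR0 x⟩
  have hgm : Measurable ((cell n k).indicator fun x => a * R x) :=
    (hRm.const_mul a).indicator (measurableSet_cell n k)
  refine ⟨_, hgm, hg, fun x hx => indicator_of_notMem hx _, ?_, fun j hj l => ?_⟩
  · rw [integral_indicator (measurableSet_cell n k), integral_const_mul, ha]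
  · exact (setIntegral_cell_le (bddMeas_of_le hRK hgm hg) hK0
      (fun x => (hg x).2.trans (hRK x)) j l).trans (rpow_mul_dlen_le hδ hα1 hj)

lemma setIntegral_eq_zero_of_disjoint {g : UnitCircle → ℝ} {s c : Set UnitCircle}
    (hg : ∀ x, x ∉ c → g x = 0) (hs : MeasurableSet s) (hd : Disjoint s c) :
    ∫ x in s, g x = 0 := by
  rw [setIntegral_congr_fun (g := fun _ => 0) hs fun x hx => hg x (disjoint_left.1 hd hx)]
  simp

lemma isFlow_step {δ α K : ℝ} {R : UnitCircle → ℝ} (hRK : ∀ x, R x ≤ K)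
    {m k : ℕ} {s₁ s₂ : ℝ} {g₁ g₂ : UnitCircle → ℝ}
    (h₁ : IsFlow δ α R (m + 1) (2 * k) s₁ g₁) (h₂ : IsFlow δ α R (m + 1) (2 * k + 1) s₂ g₂)
    (hs : s₁ + s₂ ≤ δ * dlen m ^ α) : IsFlow δ α R m k (s₁ + s₂) fun x => g₁ x + g₂ x := by
  obtain ⟨m1, b1, z1, i1, c1⟩ := h₁
  obtain ⟨m2, b2, z2, i2, c2⟩ := h₂
  have I1 := (bddMeas_of_le hRK m1 b1).integrable
  have I2 := (bddMeas_of_le hRK m2 b2).integrable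
  have hdisj : Disjoint (cell (m + 1) (2 * k)) (cell (m + 1) (2 * k + 1)) :=
    cell_disjoint (by omega)
  have htot : ∫ x, (g₁ x + g₂ x) = s₁ + s₂ := by rw [integral_add I1 I2, i1, i2]
  refine ⟨m1.add m2, fun x => ⟨add_nonneg (b1 x).1 (b2 x).1, ?_⟩, fun x hx => ?_, htot,
    fun j hj l => ?_⟩
  · change g₁ x + g₂ x ≤ R x
    by_cases hx : x ∈ cell (m + 1) (2 * k)
    · rw [z2 x (disjoint_left.1 hdisj hx), add_zero]; exact (b1 x).2
    · rw [z1 x hx, zero_add]; exact (b2 x).2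
  · rw [cell_eq_union, mem_union, not_or] at hx
    change g₁ x + g₂ x = 0
    rw [z1 x hx.1, z2 x hx.2, add_zero]
  · rcases hj.eq_or_lt with rfl | hj
    · refine le_trans (setIntegral_le_integral (I1.add I2)
        (ae_of_all _ fun x => add_nonneg (b1 x).1 (b2 x).1)) ?_
      exact htot.le.trans hs
    · rw [integral_add I1.integrableOn I2.integrableOn]
      rcases cell_subset_or_disjoint (m := m + 1) (n := j) hj (2 * k) l with h | h
      · rw [setIntegral_eq_zero_of_disjoint z2 (measurableSet_cell j l)
          (hdisj.mono_left h), add_zero]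
        exact c1 j hj l
      · rw [setIntegral_eq_zero_of_disjoint z1 (measurableSet_cell j l) h, zero_add]
        exact c2 j hj l

lemma isCut_union {δ α : ℝ} (hδ : 0 < δ) {R : UnitCircle → ℝ} (hR : BddMeas R)
    (hR0 : ∀ x, 0 ≤ R x) {m k : ℕ} {c₁ c₂ : ℝ} {F₁ F₂ : Finset (ℕ × ℕ)}
    (h₁ : IsCut δ α R (m + 1) (2 * k) c₁ F₁) (h₂ : IsCut δ α R (m + 1) (2 * k + 1) c₂ F₂) :
    IsCut δ α R m k (c₁ + c₂) (F₁ ∪ F₂) := by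
  obtain ⟨a1, d1, s1⟩ := h₁
  obtain ⟨a2, d2, s2⟩ := h₂
  have hdisj : Disjoint (cell (m + 1) (2 * k)) (cell (m + 1) (2 * k + 1)) :=
    cell_disjoint (by omega)
  have hu := cell_eq_union m k
  refine ⟨fun J hJ => ?_, fun J hJ J' hJ' hne => ?_, ?_⟩
  · rcases Finset.mem_union.1 hJ with h | h
    · exact ⟨by have := (a1 J h).1; omega, (a1 J h).2.1,
        (a1 J h).2.2.trans (hu ▸ subset_union_left)⟩
    · exact ⟨by have := (a2 J h).1; omega, (a2 J h).2.1,
        (a2 J h).2.2.trans (hu ▸ subset_union_right)⟩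
  · rcases Finset.mem_union.1 hJ with h | h <;> rcases Finset.mem_union.1 hJ' with h' | h'
    · exact d1 J h J' h' hne
    · exact hdisj.mono (a1 J h).2.2 (a2 J' h').2.2
    · exact (hdisj.mono (a1 J' h').2.2 (a2 J h).2.2).symm
    · exact d2 J h J' h' hne
  · have hsum : ∑ J ∈ F₁ ∪ F₂, δ * dlen J.1 ^ α ≤
        ∑ J ∈ F₁, δ * dlen J.1 ^ α + ∑ J ∈ F₂, δ * dlen J.1 ^ α := by
      rw [← Finset.sum_union_inter]
      refine le_add_of_nonneg_right (Finset.sum_nonneg fun J _ => ?_)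
      exact mul_nonneg hδ.le (Real.rpow_nonneg (dlen_pos _).le _)
    set A₁ := cell (m + 1) (2 * k) \ ⋃ J ∈ F₁, cell J.1 J.2
    set A₂ := cell (m + 1) (2 * k + 1) \ ⋃ J ∈ F₂, cell J.1 J.2
    have hm : ∀ (a b : ℕ) (F : Finset (ℕ × ℕ)),
        MeasurableSet (cell a b \ ⋃ J ∈ F, cell J.1 J.2) := fun a b F =>
      (measurableSet_cell _ _).diff (Finset.measurableSet_biUnion _ fun J _ =>
        measurableSet_cell _ _)
    have herglotz : ∫ x in cell m k \ ⋃ J ∈ F₁ ∪ F₂, cell J.1 J.2, R x ≤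
        (∫ x in A₁, R x) + ∫ x in A₂, R x := by
      rw [← setIntegral_union (hdisj.mono sdiff_subset sdiff_subset) (hm _ _ _)
        hR.integrable.integrableOn hR.integrable.integrableOn]
      refine setIntegral_mono_set hR.integrable.integrableOn (ae_of_all _ hR0)
        (LE.le.eventuallyLE ?_)
      rintro x ⟨hx, hx'⟩
      simp only [mem_iUnion, not_exists, Finset.mem_union] at hx'
      rw [hu] at hx
      rcases hx with hx | hx
      · refine Or.inl ⟨hx, ?_⟩
        simp only [mem_iUnion, not_exists]
        exact fun J hJ => hx' J (Or.inl hJ)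
      · refine Or.inr ⟨hx, ?_⟩
        simp only [mem_iUnion, not_exists]
        exact fun J hJ => hx' J (Or.inr hJ)
    linarith

lemma exists_cut_flow {δ α : ℝ} (hδ : 0 < δ) (hα1 : α < 1) {n : ℕ} {R : UnitCircle → ℝ}
    (hRm : Measurable R) (hR0 : ∀ x, 0 ≤ R x) (hRK : ∀ x, R x ≤ δ * dlen n ^ (α - 1)) (j : ℕ) :
    ∀ m k, m + j = n → k < 2 ^ m → ∃ c : ℝ, 0 ≤ c ∧ (∃ F, IsCut δ α R m k c F) ∧
      ∀ s, 0 ≤ s → s ≤ c → ∃ g, IsFlow δ α R m k s g := by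
  have hR : BddMeas R := bddMeas_of_le hRK hRm fun x => ⟨hR0 x, le_rfl⟩
  induction j with
  | zero =>
    rintro m k rfl hk
    refine ⟨∫ x in cell m k, R x, integral_nonneg hR0, ⟨∅, by simp, by simp, by simp⟩,
      fun s hs0 hs => isFlow_base hδ hα1 hRm hR0 hRK k hs0 hs⟩
  | succ j ih =>
    intro m k hm hk
    obtain ⟨c₁, n1, ⟨F₁, cut1⟩, fl1⟩ := ih (m + 1) (2 * k) (by omega) (by rw [pow_succ]; omega)
    obtain ⟨c₂, n2, ⟨F₂, cut2⟩, fl2⟩ := ih (m + 1) (2 * k + 1) (by omega) (by rw [pow_succ]; omega)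
    have hpos : 0 ≤ δ * dlen m ^ α := mul_nonneg hδ.le (Real.rpow_nonneg (dlen_pos _).le _)
    refine ⟨min (δ * dlen m ^ α) (c₁ + c₂), le_min hpos (by linarith), ?_, fun s hs0 hs => ?_⟩
    · rcases min_cases (δ * dlen m ^ α) (c₁ + c₂) with ⟨h, _⟩ | ⟨h, _⟩
      · rw [h]
        refine ⟨{(m, k)}, ?_, ?_, ?_⟩
        · simpa using hk
        · intro J hJ J' hJ' hne
          rw [Finset.mem_singleton] at hJ hJ'
          exact absurd (hJ.trans hJ'.symm) hne
        · simp
      · rw [h]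
        exact ⟨_, isCut_union hδ hR hR0 cut1 cut2⟩
    · obtain ⟨g₁, f1⟩ := fl1 (min s c₁) (le_min hs0 n1) (min_le_right _ _)
      obtain ⟨g₂, f2⟩ := fl2 (s - min s c₁) (by linarith [min_le_left s c₁]) (by
        have := hs.trans (min_le_right _ _)
        rcases min_cases s c₁ with ⟨h, _⟩ | ⟨h, _⟩ <;> rw [h] <;> linarith)
      have := isFlow_step hRK f1 f2 (by
        have := hs.trans (min_le_left _ _); linarith)
      rw [add_sub_cancel] at this
      exact ⟨_, this⟩

/-- The truncation of an extended density at the scale of generation `n`. -/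
def trunc (δ α : ℝ) (ρ : UnitCircle → ENNReal) (n : ℕ) (x : UnitCircle) : ℝ :=
  (min (ρ x) (ENNReal.ofReal (δ * dlen n ^ (α - 1)))).toReal

lemma ofReal_trunc (δ α : ℝ) (ρ : UnitCircle → ENNReal) (n : ℕ) (x : UnitCircle) :
    ENNReal.ofReal (trunc δ α ρ n x) = min (ρ x) (ENNReal.ofReal (δ * dlen n ^ (α - 1))) :=
  ENNReal.ofReal_toReal (ne_top_of_le_ne_top ENNReal.ofReal_ne_top (min_le_right _ _))

lemma trunc_nonneg (δ α : ℝ) (ρ : UnitCircle → ENNReal) (n : ℕ) (x : UnitCircle) :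
    0 ≤ trunc δ α ρ n x := ENNReal.toReal_nonneg

lemma trunc_le {δ : ℝ} (hδ : 0 < δ) (α : ℝ) (ρ : UnitCircle → ENNReal) (n : ℕ) (x : UnitCircle) :
    trunc δ α ρ n x ≤ δ * dlen n ^ (α - 1) :=
  ENNReal.toReal_le_of_le_ofReal (mul_nonneg hδ.le (Real.rpow_nonneg (dlen_pos n).le _))
    (min_le_right _ _)

lemma measurable_trunc {δ α : ℝ} {ρ : UnitCircle → ENNReal} (hρ : Measurable ρ) (n : ℕ) :
    Measurable (trunc δ α ρ n) :=
  (hρ.min measurable_const).ennreal_toReal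

lemma tendsto_trunc_level {δ α : ℝ} (hδ : 0 < δ) (hα1 : α < 1) :
    Tendsto (fun n => δ * dlen n ^ (α - 1)) atTop atTop := by
  refine Tendsto.const_mul_atTop hδ ?_
  have h : Tendsto dlen atTop (𝓝[>] 0) :=
    tendsto_nhdsWithin_iff.2 ⟨tendsto_dlen, Eventually.of_forall dlen_pos⟩
  exact (tendsto_rpow_neg_nhdsGT_zero (by linarith : α - 1 < 0)).comp h

lemma dlen_le_mul_rpow {α : ℝ} (hα1 : α < 1) {M j : ℕ} (h : M ≤ j) :
    dlen j ≤ dlen M ^ (1 - α) * dlen j ^ α := by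
  calc dlen j = dlen j ^ (1 - α) * dlen j ^ α := by
        rw [← Real.rpow_add (dlen_pos j)]; simp
    _ ≤ _ := by
        refine mul_le_mul_of_nonneg_right ?_ (Real.rpow_nonneg (dlen_pos j).le _)
        exact Real.rpow_le_rpow (dlen_pos j).le (dlen_anti h) (by linarith)

lemma tsum_indicator_le_of_cut {δ α c : ℝ} (hδ : 0 < δ) {R : ℕ → UnitCircle → ℝ}
    (hR0 : ∀ n x, 0 ≤ R n x) {m k : ℕ} {F : ℕ → Finset (ℕ × ℕ)} {U : Ultrafilter ℕ}
    (hU : ∀ᶠ n in U, IsCut δ α (R n) m k c (F n)) :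
    ∑' J, {J | ∀ᶠ n in U, J ∈ F n}.indicator
      (fun J : ℕ × ℕ => ENNReal.ofReal (δ * dlen J.1 ^ α)) J ≤ ENNReal.ofReal c := by
  rw [ENNReal.tsum_eq_iSup_sum]
  refine iSup_le fun s => ?_
  have h1 : ∀ᶠ n in U, ∀ J ∈ s, (J ∈ {J | ∀ᶠ n in U, J ∈ F n}) → J ∈ F n := by
    rw [Filter.eventually_all_finset]
    intro J _
    by_cases h : ∀ᶠ n in U, J ∈ F n
    · exact h.mono fun n hn _ => hn
    · exact Eventually.of_forall fun n h' => absurd h' h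
  obtain ⟨n, hn, hcut⟩ := (h1.and hU).exists
  calc _ ≤ ∑ J ∈ F n, {J | ∀ᶠ n in U, J ∈ F n}.indicator
            (fun J : ℕ × ℕ => ENNReal.ofReal (δ * dlen J.1 ^ α)) J :=
        Finset.sum_le_sum_of_ne_zero fun J hJ hne => hn J hJ (mem_of_indicator_ne_zero hne)
    _ ≤ ∑ J ∈ F n, ENNReal.ofReal (δ * dlen J.1 ^ α) :=
        Finset.sum_le_sum fun J _ => indicator_le_self _ _ J
    _ = ENNReal.ofReal (∑ J ∈ F n, δ * dlen J.1 ^ α) :=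
        (ENNReal.ofReal_sum_of_nonneg fun J _ =>
          mul_nonneg hδ.le (Real.rpow_nonneg (dlen_pos _).le _)).symm
    _ ≤ _ := ENNReal.ofReal_le_ofReal (by
        have := hcut.2.2
        have h0 : 0 ≤ ∫ x in cell m k \ ⋃ J ∈ F n, cell J.1 J.2, R n x :=
          integral_nonneg (hR0 n)
        linarith)

lemma lintegral_min_le_of_cut {δ α c : ℝ} (hδ : 0 < δ) (hα1 : α < 1)
    {ρ : UnitCircle → ENNReal} (hρ : Measurable ρ) {m k : ℕ} {F : ℕ → Finset (ℕ × ℕ)}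
    {U : Ultrafilter ℕ} (hU' : (U : Filter ℕ) ≤ atTop)
    (hU : ∀ᶠ n in U, IsCut δ α (trunc δ α ρ n) m k c (F n)) (K M : ℕ) :
    ∫⁻ x in cell m k \ ⋃ J ∈ {J | ∀ᶠ n in U, J ∈ F n}, cell J.1 J.2, min (ρ x) K ≤
      ENNReal.ofReal c + ENNReal.ofReal (K * (dlen M ^ (1 - α) * (c / δ))) := by
  have h1 : ∀ᶠ n in U, ∀ J ∈ Finset.range (M + 1) ×ˢ Finset.range (2 ^ M),
      J ∈ F n → ∀ᶠ n in U, J ∈ F n := by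
    rw [Filter.eventually_all_finset]
    intro J _
    by_cases h : ∀ᶠ n in U, J ∈ F n
    · exact Eventually.of_forall fun n _ => h
    · exact (Ultrafilter.eventually_not.2 h).mono fun n hn hn' => absurd hn' hn
  have h2 : ∀ᶠ n in U, (K : ℝ) ≤ δ * dlen n ^ (α - 1) :=
    hU' ((tendsto_trunc_level hδ hα1).eventually_ge_atTop _)
  obtain ⟨n, hn, hK, hcut⟩ := (h1.and (h2.and hU)).exists
  set P := (F n).filter fun J => M ≤ J.1
  have hsub : cell m k \ ⋃ J ∈ {J | ∀ᶠ n in U, J ∈ F n}, cell J.1 J.2 ⊆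
      (cell m k \ ⋃ J ∈ F n, cell J.1 J.2) ∪ ⋃ J ∈ P, cell J.1 J.2 := by
    rintro x ⟨hx, hx'⟩
    by_cases h : x ∈ ⋃ J ∈ F n, cell J.1 J.2
    · right
      simp only [mem_iUnion] at h hx' ⊢
      obtain ⟨J, hJ, hxJ⟩ := h
      refine ⟨J, Finset.mem_filter.2 ⟨hJ, ?_⟩, hxJ⟩
      by_contra hM
      refine hx' ⟨J, hn J ?_ hJ, hxJ⟩
      have h3 := (hcut.1 J hJ).2.1
      have h4 : 2 ^ J.1 ≤ 2 ^ M := Nat.pow_le_pow_right (by norm_num) (by omega)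
      simp only [Finset.mem_product, Finset.mem_range]
      omega
    · exact Or.inl ⟨hx, h⟩
  have hbdd : BddMeas (trunc δ α ρ n) :=
    bddMeas_of_le (trunc_le hδ α ρ n) (measurable_trunc hρ n)
      fun x => ⟨trunc_nonneg δ α ρ n x, le_rfl⟩
  have hR0 : 0 ≤ ∫ x in cell m k \ ⋃ J ∈ F n, cell J.1 J.2, trunc δ α ρ n x :=
    integral_nonneg (trunc_nonneg δ α ρ n)
  have hsum0 : ∀ J : ℕ × ℕ, 0 ≤ δ * dlen J.1 ^ α := fun J =>
    mul_nonneg hδ.le (Real.rpow_nonneg (dlen_pos _).le _)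
  have hFc := hcut.2.2
  have hFs : 0 ≤ ∑ J ∈ F n, δ * dlen J.1 ^ α := Finset.sum_nonneg fun J _ => hsum0 J
  calc _ ≤ ∫⁻ x in (cell m k \ ⋃ J ∈ F n, cell J.1 J.2) ∪ ⋃ J ∈ P, cell J.1 J.2,
            min (ρ x) K := lintegral_mono_set hsub
    _ ≤ (∫⁻ x in cell m k \ ⋃ J ∈ F n, cell J.1 J.2, min (ρ x) K) +
          ∫⁻ x in ⋃ J ∈ P, cell J.1 J.2, min (ρ x) K := lintegral_union_le _ _ _
    _ ≤ _ := add_le_add ?_ ?_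
  · calc _ ≤ ∫⁻ x in cell m k \ ⋃ J ∈ F n, cell J.1 J.2,
            ENNReal.ofReal (trunc δ α ρ n x) := by
          refine lintegral_mono fun x => ?_
          change _ ≤ ENNReal.ofReal (trunc δ α ρ n x)
          rw [ofReal_trunc]
          refine min_le_min_left _ ?_
          rw [← ENNReal.ofReal_natCast]
          exact ENNReal.ofReal_le_ofReal hK
      _ = ENNReal.ofReal (∫ x in cell m k \ ⋃ J ∈ F n, cell J.1 J.2, trunc δ α ρ n x) :=
          (ofReal_integral_eq_lintegral_ofReal hbdd.integrable.integrableOn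
            (ae_of_all _ (trunc_nonneg δ α ρ n))).symm
      _ ≤ _ := ENNReal.ofReal_le_ofReal (by linarith)
  · calc _ ≤ ∫⁻ x in ⋃ J ∈ P, cell J.1 J.2, (K : ENNReal) :=
          lintegral_mono fun x => min_le_right _ _
      _ = K * volume (⋃ J ∈ P, cell J.1 J.2) := by rw [setLIntegral_const]
      _ ≤ K * ∑ J ∈ P, volume (cell J.1 J.2) := by
          gcongr; exact measure_biUnion_finset_le _ _
      _ = ENNReal.ofReal (K * ∑ J ∈ P, dlen J.1) := by
          rw [ENNReal.ofReal_mul (Nat.cast_nonneg K), ENNReal.ofReal_natCast,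
            ENNReal.ofReal_sum_of_nonneg fun J _ => (dlen_pos _).le]
          congr 1
          refine Finset.sum_congr rfl fun J hJ => ?_
          exact volume_cell (hcut.1 J (Finset.mem_filter.1 hJ).1).2.1
      _ ≤ _ := by
          refine ENNReal.ofReal_le_ofReal (mul_le_mul_of_nonneg_left ?_ (Nat.cast_nonneg K))
          calc ∑ J ∈ P, dlen J.1 ≤ ∑ J ∈ P, dlen M ^ (1 - α) * dlen J.1 ^ α :=
                Finset.sum_le_sum fun J hJ => dlen_le_mul_rpow hα1 (Finset.mem_filter.1 hJ).2
            _ ≤ ∑ J ∈ F n, dlen M ^ (1 - α) * dlen J.1 ^ α :=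
                Finset.sum_le_sum_of_subset_of_nonneg (Finset.filter_subset _ _) fun J _ _ =>
                  mul_nonneg (Real.rpow_nonneg (dlen_pos _).le _)
                    (Real.rpow_nonneg (dlen_pos _).le _)
            _ = dlen M ^ (1 - α) * ((∑ J ∈ F n, δ * dlen J.1 ^ α) / δ) := by
                rw [← Finset.mul_sum, ← Finset.mul_sum, mul_div_cancel_left₀ _ hδ.ne']
            _ ≤ _ := by
                refine mul_le_mul_of_nonneg_left ?_ (Real.rpow_nonneg (dlen_pos _).le _)
                exact div_le_div_of_nonneg_right (by linarith) hδ.le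

lemma lintegral_le_of_cut {δ α c : ℝ} (hδ : 0 < δ) (hα1 : α < 1)
    {ρ : UnitCircle → ENNReal} (hρ : Measurable ρ) {m k : ℕ} {F : ℕ → Finset (ℕ × ℕ)}
    {U : Ultrafilter ℕ} (hU' : (U : Filter ℕ) ≤ atTop)
    (hU : ∀ᶠ n in U, IsCut δ α (trunc δ α ρ n) m k c (F n)) :
    ∫⁻ x in cell m k \ ⋃ J ∈ {J | ∀ᶠ n in U, J ∈ F n}, cell J.1 J.2, ρ x ≤
      ENNReal.ofReal c := by
  set A := cell m k \ ⋃ J ∈ {J | ∀ᶠ n in U, J ∈ F n}, cell J.1 J.2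
  have hK : ∀ K : ℕ, ∫⁻ x in A, min (ρ x) K ≤ ENNReal.ofReal c := by
    intro K
    have hlim : Tendsto (fun M => ENNReal.ofReal c +
        ENNReal.ofReal (K * (dlen M ^ (1 - α) * (c / δ)))) atTop (𝓝 (ENNReal.ofReal c + 0)) := by
      refine Tendsto.const_add _ ?_
      have h1 := (((tendsto_dlen.rpow_const (p := 1 - α) (Or.inr (by linarith))).mul_const
        (c / δ)).const_mul (K : ℝ))
      rw [Real.zero_rpow (by linarith), zero_mul, mul_zero] at h1
      have h2 := ENNReal.tendsto_ofReal h1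
      rwa [ENNReal.ofReal_zero] at h2
    rw [add_zero] at hlim
    exact ge_of_tendsto' hlim fun M => lintegral_min_le_of_cut hδ hα1 hρ hU' hU K M
  have hsup : ∀ x, ρ x = ⨆ K : ℕ, min (ρ x) K := fun x => by
    have := inf_iSup_eq (ρ x) fun K : ℕ => (K : ENNReal)
    rw [ENNReal.iSup_natCast, inf_top_eq] at this
    exact this
  calc ∫⁻ x in A, ρ x = ∫⁻ x in A, ⨆ K : ℕ, min (ρ x) K := by simp_rw [← hsup]
    _ = ⨆ K : ℕ, ∫⁻ x in A, min (ρ x) K :=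
        lintegral_iSup (fun K => hρ.min measurable_const) fun a b hab x =>
          min_le_min_left _ (by exact_mod_cast hab)
    _ ≤ _ := iSup_le hK

/-- The complement of a disjoint family of open dyadic arcs with summable `α`-lengths is an
`α`-Carleson set. -/
lemma isAlphaCarlesonSet_compl_openCell {α : ℝ} (hα0 : 0 < α) {G : Set (ℕ × ℕ)}
    (hG : ∀ J ∈ G, J.2 < 2 ^ J.1)
    (hd : ∀ J ∈ G, ∀ J' ∈ G, J ≠ J' → Disjoint (cell J.1 J.2) (cell J'.1 J'.2))
    (hs : ∑' J, G.indicator (fun J : ℕ × ℕ => ENNReal.ofReal (dlen J.1 ^ α)) J < ⊤) :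
    IsAlphaCarlesonSet α (⋃ J ∈ G, openCell J.1 J.2)ᶜ := by
  classical
  set I : ℕ × ℕ → Set UnitCircle := fun J => if J ∈ G then openCell J.1 J.2 else ∅
  refine ⟨(isOpen_biUnion fun J _ => isOpen_openCell _ _).isClosed_compl,
    fun i => I (Nat.pairEquiv.symm i), fun i => ?_, fun i j hij => ?_, ?_, ?_⟩
  · by_cases h : Nat.pairEquiv.symm i ∈ G
    · simp only [I, h, if_true]
      exact ⟨isOpen_openCell _ _, isPreconnected_openCell _ _⟩
    · simp only [I, h, if_false]
      exact ⟨isOpen_empty, isPreconnected_empty⟩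
  · by_cases h : Nat.pairEquiv.symm i ∈ G
    · by_cases h' : Nat.pairEquiv.symm j ∈ G
      · simp only [I, h, h', if_true]
        exact (hd _ h _ h' (Nat.pairEquiv.symm.injective.ne hij)).mono
          (openCell_subset_cell (hG _ h)) (openCell_subset_cell (hG _ h'))
      · simp only [I, h', if_false, disjoint_empty]
    · simp only [I, h, if_false, empty_disjoint]
  · rw [compl_compl, Nat.pairEquiv.symm.surjective.iUnion_comp I]
    ext x
    simp only [mem_iUnion, I]
    refine exists_congr fun J => ?_
    by_cases h : J ∈ G <;> simp [h]
  · rw [Nat.pairEquiv.symm.tsum_eq fun J => ENNReal.ofReal ((volume (I J)).toReal ^ α)]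
    refine lt_of_eq_of_lt (tsum_congr fun J => ?_) hs
    by_cases h : J ∈ G
    · simp only [I, h, if_true, indicator_of_mem]
      rw [volume_openCell (hG J h), ENNReal.toReal_ofReal (dlen_pos _).le]
    · simp [I, h, Real.zero_rpow hα0.ne']

/-- The left endpoints of all dyadic arcs. -/
def dyadicPoints : Set UnitCircle := range fun J : ℕ × ℕ => ((J.2 * dlen J.1 : ℝ) : UnitCircle)

lemma volume_dyadicPoints : volume dyadicPoints = 0 := by
  rw [dyadicPoints, ← iUnion_singleton_eq_range]
  exact measure_iUnion_null fun J => volume_circle_singleton _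

lemma mem_dyadicPoints {n k : ℕ} {x : UnitCircle} (hx : x ∈ cell n k) (hx' : x ∉ openCell n k) :
    x ∈ dyadicPoints :=
  ⟨(n, k), (mem_singleton_iff.1 (cell_diff_openCell_subset n k ⟨hx, hx'⟩)).symm⟩

lemma volume_eq_zero_of_family {δ α : ℝ} (hδ : 0 < δ) (hα0 : 0 < α)
    {ρ : UnitCircle → ENNReal}
    (hdiv : ∀ E, IsAlphaCarlesonSet α E → 0 < volume E → ∫⁻ x in E, ρ x = ⊤)
    {m k : ℕ} {F : Set (ℕ × ℕ)}
    (hF : ∀ J ∈ F, m ≤ J.1 ∧ J.2 < 2 ^ J.1 ∧ cell J.1 J.2 ⊆ cell m k)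
    (hd : ∀ J ∈ F, ∀ J' ∈ F, J ≠ J' → Disjoint (cell J.1 J.2) (cell J'.1 J'.2))
    (hs : ∑' J, F.indicator (fun J : ℕ × ℕ => ENNReal.ofReal (δ * dlen J.1 ^ α)) J < ⊤)
    (hi : ∫⁻ x in cell m k \ ⋃ J ∈ F, cell J.1 J.2, ρ x < ⊤) :
    volume (cell m k \ ⋃ J ∈ F, cell J.1 J.2) = 0 := by
  set H : Set (ℕ × ℕ) := {J | J.1 = m ∧ J.2 < 2 ^ m ∧ J.2 ≠ k}
  have hHfin : H.Finite := by
    refine ((finite_singleton m).prod (finite_lt_nat (2 ^ m))).subset ?_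
    rintro ⟨a, b⟩ ⟨h1, h2, -⟩
    exact ⟨h1, h2⟩
  have hHd : ∀ J ∈ H, Disjoint (cell J.1 J.2) (cell m k) := by
    rintro ⟨a, b⟩ ⟨h1, -, h3⟩
    simp only at h1 h3 ⊢
    rw [h1]
    exact cell_disjoint h3
  have hcar : IsAlphaCarlesonSet α (⋃ J ∈ F ∪ H, openCell J.1 J.2)ᶜ := by
    refine isAlphaCarlesonSet_compl_openCell hα0 ?_ ?_ ?_
    · rintro J (h | ⟨h1, h2, -⟩)
      · exact (hF J h).2.1
      · rw [h1]; exact h2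
    · rintro J (h | h) J' (h' | h') hne
      · exact hd J h J' h' hne
      · exact ((hHd J' h').mono_right (hF J h).2.2).symm
      · exact (hHd J h).mono_right (hF J' h').2.2
      · have h1 : J.1 = m := h.1
        have h2 : J'.1 = m := h'.1
        rw [h1, h2]
        refine cell_disjoint fun h3 => hne (Prod.ext (h1.trans h2.symm) h3)
    · have hHs : ∑' J, H.indicator (fun J : ℕ × ℕ => ENNReal.ofReal (dlen J.1 ^ α)) J < ⊤ := by
        rw [tsum_eq_sum (s := hHfin.toFinset) fun J hJ => indicator_of_notMem (by simpa using hJ) _]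
        refine ENNReal.sum_lt_top.2 fun J _ => ?_
        exact (indicator_le_self _ _ J).trans_lt ENNReal.ofReal_lt_top
      have hFs : ∑' J, F.indicator (fun J : ℕ × ℕ => ENNReal.ofReal (dlen J.1 ^ α)) J < ⊤ := by
        have : ∀ J, F.indicator (fun J : ℕ × ℕ => ENNReal.ofReal (dlen J.1 ^ α)) J =
            ENNReal.ofReal δ⁻¹ *
              F.indicator (fun J : ℕ × ℕ => ENNReal.ofReal (δ * dlen J.1 ^ α)) J := by
          intro J
          by_cases h : J ∈ F
          · simp only [h, indicator_of_mem]
            rw [← ENNReal.ofReal_mul (by positivity), inv_mul_cancel_left₀ hδ.ne']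
          · simp [h]
        rw [tsum_congr this, ENNReal.tsum_mul_left]
        exact ENNReal.mul_lt_top ENNReal.ofReal_lt_top hs
      calc _ ≤ ∑' J, (F.indicator (fun J : ℕ × ℕ => ENNReal.ofReal (dlen J.1 ^ α)) J +
            H.indicator (fun J : ℕ × ℕ => ENNReal.ofReal (dlen J.1 ^ α)) J) := by
            refine ENNReal.tsum_le_tsum fun J => ?_
            by_cases h : J ∈ F
            · simp [h]
            · by_cases h' : J ∈ H <;> simp [h, h']
        _ < ⊤ := by rw [ENNReal.tsum_add]; exact ENNReal.add_lt_top.2 ⟨hFs, hHs⟩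
  set E := (⋃ J ∈ F ∪ H, openCell J.1 J.2)ᶜ
  set A := cell m k \ ⋃ J ∈ F, cell J.1 J.2
  have hEA : E ⊆ A ∪ dyadicPoints := by
    intro x hx
    by_cases hd : x ∈ dyadicPoints
    · exact Or.inr hd
    have hx' : ∀ J ∈ F ∪ H, x ∉ cell J.1 J.2 := by
      intro J hJ hxJ
      refine hd (mem_dyadicPoints hxJ fun h => hx ?_)
      exact mem_biUnion hJ h
    refine Or.inl ⟨?_, ?_⟩
    · by_contra hk
      exact hx' (m, dyIdx m x) (Or.inr ⟨rfl, dyIdx_lt m x, hk⟩) rfl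
    · simp only [mem_iUnion, not_exists]
      exact fun J hJ => hx' J (Or.inl hJ)
  have hAE : A ⊆ E := by
    rintro x ⟨hx, hx'⟩ h
    simp only [mem_iUnion, not_exists] at hx' h
    obtain ⟨J, hJ | hJ, hxJ⟩ := h
    · exact hx' J hJ (openCell_subset_cell (hF J hJ).2.1 hxJ)
    · refine disjoint_left.1 (hHd J hJ) (openCell_subset_cell ?_ hxJ) hx
      rw [hJ.1]; exact hJ.2.1
  refine measure_mono_null hAE (by_contra fun hne => ?_)
  have htop := hdiv E hcar (pos_iff_ne_zero.2 hne)
  have : ∫⁻ x in E, ρ x ≤ ∫⁻ x in A, ρ x := by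
    calc _ ≤ ∫⁻ x in A ∪ dyadicPoints, ρ x := lintegral_mono_set hEA
      _ ≤ (∫⁻ x in A, ρ x) + ∫⁻ x in dyadicPoints, ρ x := lintegral_union_le _ _ _
      _ = _ := by rw [setLIntegral_measure_zero _ _ volume_dyadicPoints, add_zero]
  rw [htop] at this
  exact absurd hi (not_lt.2 this)

/-- If the density `ρ` diverges on every `α`-Carleson set of positive length, then truncations
of `ρ` carry flows of any prescribed constant density. -/
lemma eventually_exists_flow {δ α N : ℝ} (hδ : 0 < δ) (hα0 : 0 < α) (hα1 : α < 1) (hN : 0 ≤ N)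
    {ρ : UnitCircle → ENNReal} (hρ : Measurable ρ)
    (hdiv : ∀ E, IsAlphaCarlesonSet α E → 0 < volume E → ∫⁻ x in E, ρ x = ⊤)
    {m k : ℕ} (hk : k < 2 ^ m) (hNm : N * dlen m ^ (1 - α) < δ) :
    ∀ᶠ n in atTop, ∃ g, IsFlow δ α (trunc δ α ρ n) m k (N * dlen m) g := by
  by_contra hcon
  rw [not_eventually] at hcon
  have hs0 : 0 ≤ N * dlen m := mul_nonneg hN (dlen_pos m).le
  have hcut : ∃ᶠ n in atTop, ∃ F, IsCut δ α (trunc δ α ρ n) m k (N * dlen m) F := by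
    refine (hcon.and_eventually (eventually_ge_atTop m)).mono ?_
    rintro n ⟨hn, hmn⟩
    obtain ⟨c, -, ⟨F, h1, h2, h3⟩, hfl⟩ := exists_cut_flow hδ hα1 (measurable_trunc hρ n)
      (trunc_nonneg δ α ρ n) (trunc_le hδ α ρ n) (n - m) m k (by omega) hk
    refine ⟨F, h1, h2, h3.trans ?_⟩
    by_contra hc
    exact hn (hfl _ hs0 (not_le.1 hc).le)
  have hex : ∀ n, ∃ F, (∃ F, IsCut δ α (trunc δ α ρ n) m k (N * dlen m) F) →
      IsCut δ α (trunc δ α ρ n) m k (N * dlen m) F := fun n => by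
    by_cases h : ∃ F, IsCut δ α (trunc δ α ρ n) m k (N * dlen m) F
    · exact ⟨h.choose, fun _ => h.choose_spec⟩
    · exact ⟨∅, fun h' => absurd h' h⟩
  choose F hF using hex
  have hfreq : ∃ᶠ n in atTop, n ∈ {n | IsCut δ α (trunc δ α ρ n) m k (N * dlen m) (F n)} :=
    hcut.mono fun n hn => hF n hn
  have hne := frequently_mem_iff_neBot.1 hfreq
  set U := Ultrafilter.of (atTop ⊓ 𝓟 {n | IsCut δ α (trunc δ α ρ n) m k (N * dlen m) (F n)})
  have hU' : (U : Filter ℕ) ≤ atTop := (Ultrafilter.of_le _).trans inf_le_left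
  have hU : ∀ᶠ n in U, IsCut δ α (trunc δ α ρ n) m k (N * dlen m) (F n) :=
    (Ultrafilter.of_le _).trans inf_le_right (mem_principal_self _)
  have hsum := tsum_indicator_le_of_cut hδ (trunc_nonneg δ α ρ) hU
  have herglotz := lintegral_le_of_cut hδ hα1 hρ hU' hU
  set G : Set (ℕ × ℕ) := {J | ∀ᶠ n in U, J ∈ F n}
  have hG : ∀ J ∈ G, m ≤ J.1 ∧ J.2 < 2 ^ J.1 ∧ cell J.1 J.2 ⊆ cell m k := fun J hJ => by
    obtain ⟨n, hn, hc⟩ := (Eventually.and hJ hU).exists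
    exact hc.1 J hn
  have hzero := volume_eq_zero_of_family hδ hα0 hdiv hG (fun J hJ J' hJ' hne => by
    obtain ⟨n, ⟨hn, hn'⟩, hc⟩ := ((Eventually.and hJ hJ').and hU).exists
    exact hc.2.1 J hn J' hn' hne) (hsum.trans_lt ENNReal.ofReal_lt_top)
    (herglotz.trans_lt ENNReal.ofReal_lt_top)
  have hle : ENNReal.ofReal (dlen m) ≤
      ENNReal.ofReal (dlen m ^ (1 - α) * δ⁻¹) * ENNReal.ofReal (N * dlen m) := by
    calc ENNReal.ofReal (dlen m) = volume (cell m k) := (volume_cell hk).symm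
      _ ≤ volume ((cell m k \ ⋃ J ∈ G, cell J.1 J.2) ∪ ⋃ J ∈ G, cell J.1 J.2) :=
          measure_mono (by rw [sdiff_union_self]; exact subset_union_left)
      _ ≤ 0 + volume (⋃ J ∈ G, cell J.1 J.2) := by
          rw [← hzero]; exact measure_union_le _ _
      _ ≤ ∑' J, volume (⋃ (_ : J ∈ G), cell J.1 J.2) := by
          rw [zero_add]; exact measure_iUnion_le _
      _ ≤ ∑' J, ENNReal.ofReal (dlen m ^ (1 - α) * δ⁻¹) *
            G.indicator (fun J : ℕ × ℕ => ENNReal.ofReal (δ * dlen J.1 ^ α)) J := by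
          refine ENNReal.tsum_le_tsum fun J => ?_
          by_cases h : J ∈ G
          · simp only [h, iUnion_true, indicator_of_mem]
            rw [volume_cell (hG J h).2.1, ← ENNReal.ofReal_mul
              (mul_nonneg (Real.rpow_nonneg (dlen_pos m).le _) (by positivity))]
            refine ENNReal.ofReal_le_ofReal ((dlen_le_mul_rpow hα1 (hG J h).1).trans_eq ?_)
            field_simp
          · simp [h]
      _ ≤ _ := by
          rw [ENNReal.tsum_mul_left]
          gcongr
  rw [← ENNReal.ofReal_mul (mul_nonneg (Real.rpow_nonneg (dlen_pos m).le _) (by positivity)),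
    ENNReal.ofReal_le_ofReal_iff (mul_nonneg (mul_nonneg (Real.rpow_nonneg (dlen_pos m).le _)
      (by positivity)) hs0)] at hle
  have h1 : dlen m ^ (1 - α) * δ⁻¹ * (N * dlen m) = (N * dlen m ^ (1 - α) / δ) * dlen m := by
    field_simp
  rw [h1] at hle
  have h2 : N * dlen m ^ (1 - α) / δ < 1 := (div_lt_one hδ).2 hNm
  have := mul_lt_mul_of_pos_right h2 (dlen_pos m)
  linarith

/-- A bounded density below `ρ` with mean `N` on the dyadic arcs of generation `m` and with
controlled mass on the shorter dyadic arcs. -/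
lemma exists_density {δ α N : ℝ} (hδ : 0 < δ) (hα0 : 0 < α) (hα1 : α < 1) (hN : 0 ≤ N)
    {ρ : UnitCircle → ENNReal} (hρ : Measurable ρ)
    (hdiv : ∀ E, IsAlphaCarlesonSet α E → 0 < volume E → ∫⁻ x in E, ρ x = ⊤)
    {m : ℕ} (hNm : N * dlen m ^ (1 - α) < δ) :
    ∃ g : UnitCircle → ℝ, BddMeas g ∧ (∀ x, 0 ≤ g x) ∧ (∀ x, ENNReal.ofReal (g x) ≤ ρ x) ∧
      (∀ k < 2 ^ m, ∫ x in cell m k, g x = N * dlen m) ∧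
      ∀ j, m ≤ j → ∀ l, ∫ x in cell j l, g x ≤ δ * dlen j ^ α := by
  have hev : ∀ᶠ n in atTop, ∀ k ∈ Finset.range (2 ^ m),
      ∃ g, IsFlow δ α (trunc δ α ρ n) m k (N * dlen m) g := by
    rw [Filter.eventually_all_finset]
    exact fun k hk => eventually_exists_flow hδ hα0 hα1 hN hρ hdiv (Finset.mem_range.1 hk) hNm
  obtain ⟨n, hn⟩ := hev.exists
  have hex : ∀ k, ∃ g, k < 2 ^ m → IsFlow δ α (trunc δ α ρ n) m k (N * dlen m) g := fun k => by
    by_cases h : k < 2 ^ m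
    · obtain ⟨g, hg⟩ := hn k (Finset.mem_range.2 h)
      exact ⟨g, fun _ => hg⟩
    · exact ⟨0, fun h' => absurd h' h⟩
  choose f hf using hex
  have hoff : ∀ k < 2 ^ m, ∀ x ∈ cell m k,
      ∑ i ∈ Finset.range (2 ^ m), f i x = f k x := fun k hk x hx => by
    refine Finset.sum_eq_single_of_mem k (Finset.mem_range.2 hk) fun i hi hik => ?_
    refine (hf i (Finset.mem_range.1 hi)).2.2.1 x ?_
    exact disjoint_left.1 (cell_disjoint hik.symm) hx
  have hb : ∀ x, 0 ≤ (∑ i ∈ Finset.range (2 ^ m), f i x) ∧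
      (∑ i ∈ Finset.range (2 ^ m), f i x) ≤ trunc δ α ρ n x := fun x => by
    rw [hoff (dyIdx m x) (dyIdx_lt m x) x rfl]
    exact (hf _ (dyIdx_lt m x)).2.1 x
  refine ⟨fun x => ∑ i ∈ Finset.range (2 ^ m), f i x, ?_, fun x => (hb x).1, fun x => ?_,
    fun k hk => ?_, fun j hj l => ?_⟩
  · exact bddMeas_of_le (trunc_le hδ α ρ n)
      (Finset.measurable_fun_sum _ fun i hi => (hf i (Finset.mem_range.1 hi)).1) hb
  · refine (ENNReal.ofReal_le_ofReal (hb x).2).trans ?_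
    rw [ofReal_trunc]
    exact min_le_left _ _
  · rw [setIntegral_congr_fun (measurableSet_cell m k) (hoff k hk), ← (hf k hk).2.2.2.1]
    refine setIntegral_eq_integral_of_forall_compl_eq_zero (hf k hk).2.2.1
  · rcases lt_or_ge l (2 ^ j) with hl | hl
    · obtain ⟨x, hx⟩ : (cell j l).Nonempty := by
        refine nonempty_of_measure_ne_zero (μ := volume) ?_
        rw [volume_cell hl]
        exact (ENNReal.ofReal_pos.2 (dlen_pos j)).ne'
      have hsub : cell j l ⊆ cell m (dyIdx m x) := fun y hy =>
        dyIdx_eq_of_le hj (hy.trans hx.symm)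
      rw [setIntegral_congr_fun (measurableSet_cell j l) fun y hy =>
        hoff _ (dyIdx_lt m x) y (hsub hy)]
      exact (hf _ (dyIdx_lt m x)).2.2.2.2 j hj l
    · rw [cell_eq_empty hl]
      simpa using mul_nonneg hδ.le (Real.rpow_nonneg (dlen_pos j).le _)

lemma coe_arg_circleEmbed (x : UnitCircle) :
    (((circleEmbed x).arg : ℝ) : UnitCircle) = x := by
  refine AddCircle.injective_toCircle (by positivity) (Subtype.ext ?_)
  change circleEmbed _ = circleEmbed x
  rw [circleEmbed_coe]
  have := Complex.norm_mul_exp_arg_mul_I (circleEmbed x)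
  rwa [norm_circleEmbed, Complex.ofReal_one, one_mul] at this

/-- The Herglotz integral of `u`: the analytic function on the disk whose real part is the
Poisson integral of `u`. -/
def herglotz (u : UnitCircle → ℝ) (z : ℂ) : ℂ :=
  Real.circleAverage
    (fun ζ => herglotzRieszKernel 0 z ζ • ((u ((ζ.arg : ℝ) : UnitCircle) : ℝ) : ℂ)) 0 1

lemma herglotz_eq (u : UnitCircle → ℝ) (z : ℂ) :
    herglotz u z = (2 * Real.pi)⁻¹ •
      ∫ y, (circleEmbed y + z) / (circleEmbed y - z) * (u y : ℂ) := by
  rw [herglotz, circleAverage_eq_integral]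
  simp only [coe_arg_circleEmbed, herglotzRieszKernel_def, sub_zero, smul_eq_mul]

lemma circleIntegrable_comp_arg {u : UnitCircle → ℝ} (hu : BddMeas u) :
    CircleIntegrable (fun ζ : ℂ => u ((ζ.arg : ℝ) : UnitCircle)) 0 1 := by
  obtain ⟨hm, C, hC⟩ := hu
  rw [circleIntegrable_def, intervalIntegrable_iff, uIoc_of_le Real.two_pi_pos.le,
    IntegrableOn]
  refine Integrable.of_bound (Measurable.aestronglyMeasurable ?_) C
    (ae_of_all _ fun θ => hC _)
  exact hm.comp (AddCircle.measurable_mk'.comp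
    (Complex.measurable_arg.comp (continuous_circleMap 0 1).measurable))

lemma differentiableOn_herglotz {u : UnitCircle → ℝ} (hu : BddMeas u) :
    DifferentiableOn ℂ (herglotz u) (Metric.ball 0 1) := by
  refine differentiableOn_circleAverage_herglotzRieszKernel_smul ?_
  have h := circleIntegrable_comp_arg hu
  simp only [CircleIntegrable, intervalIntegrable_iff] at h ⊢
  exact Complex.ofRealCLM.integrable_comp h

lemma re_herglotz {u : UnitCircle → ℝ} (hu : BddMeas u) {r : ℝ} (h0 : 0 ≤ r) (h1 : r < 1)
    (x : UnitCircle) : (herglotz u (r * circleEmbed x)).re = pint r u x := by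
  have hw : (r * circleEmbed x : ℂ) ∈ Metric.ball (0 : ℂ) 1 := by
    simpa [abs_of_nonneg h0] using h1
  rw [herglotz, re_circleAverage_herglotzRieszKernel_smul (circleIntegrable_comp_arg hu) hw,
    circleAverage_eq_integral, ← poissonKernel_eq_re_herglotzRieszKernel, pint,
    ← integral_smul]
  congr 1
  ext y
  rw [pker_sub_eq]
  simp only [Pi.smul_apply', coe_arg_circleEmbed, smul_eq_mul]
  ring

lemma cell_nonempty {n k : ℕ} (hk : k < 2 ^ n) : (cell n k).Nonempty := by
  refine nonempty_of_measure_ne_zero (μ := volume) ?_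
  rw [volume_cell hk]
  exact (ENNReal.ofReal_pos.2 (dlen_pos n)).ne'

lemma one_sub_norm_le_norm_sub (z : ℂ) (y : UnitCircle) : 1 - ‖z‖ ≤ ‖circleEmbed y - z‖ := by
  have := norm_sub_norm_le (circleEmbed y) z
  rwa [norm_circleEmbed] at this

lemma norm_kernel_sub_le {n k : ℕ} {x y : UnitCircle} (hx : x ∈ cell n k) (hy : y ∈ cell n k)
    {z : ℂ} (hz : ‖z‖ < 1) :
    ‖(circleEmbed x + z) / (circleEmbed x - z) - (circleEmbed y + z) / (circleEmbed y - z)‖ ≤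
      2 * dlen n / (1 - ‖z‖) ^ 2 := by
  have hxz := one_sub_norm_le_norm_sub z x
  have hyz := one_sub_norm_le_norm_sub z y
  have hd : 0 < 1 - ‖z‖ := by linarith
  have hx0 : circleEmbed x - z ≠ 0 := norm_pos_iff.1 (hd.trans_le hxz)
  have hy0 : circleEmbed y - z ≠ 0 := norm_pos_iff.1 (hd.trans_le hyz)
  have e : (circleEmbed x + z) / (circleEmbed x - z) - (circleEmbed y + z) / (circleEmbed y - z) =
      2 * z * (circleEmbed y - circleEmbed x) /
        ((circleEmbed x - z) * (circleEmbed y - z)) := by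
    field_simp
    ring
  rw [e, norm_div, norm_mul, norm_mul, norm_mul, Complex.norm_ofNat]
  have h1 := norm_circleEmbed_sub_le hy hx
  refine div_le_div₀ (by have := dlen_pos n; positivity) ?_ (by positivity) ?_
  · have := norm_nonneg z
    have := norm_nonneg (circleEmbed y - circleEmbed x)
    nlinarith
  · rw [sq]
    exact mul_le_mul hxz hyz hd.le (norm_nonneg _)

lemma two_pow_mul_dlen (n : ℕ) : (2 : ℝ) ^ n * dlen n = 2 * Real.pi := by
  unfold dlen; field_simp

/-- The Herglotz integral of a density with zero mean on every dyadic arc of generation `m`. -/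
lemma norm_herglotz_le {u : UnitCircle → ℝ} (hu : BddMeas u) {m : ℕ} {B : ℝ}
    (hmean : ∀ k < 2 ^ m, ∫ x in cell m k, u x = 0)
    (habs : ∀ k < 2 ^ m, ∫ x in cell m k, |u x| ≤ B * dlen m) {z : ℂ} (hz : ‖z‖ < 1) :
    ‖herglotz u z‖ ≤ 2 * B * dlen m / (1 - ‖z‖) ^ 2 := by
  have hd : 0 < 1 - ‖z‖ := by linarith
  set K : UnitCircle → ℂ := fun y => (circleEmbed y + z) / (circleEmbed y - z) with hKdef
  have hK : Continuous K := by
    refine (continuous_circleEmbed.add continuous_const).div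
      (continuous_circleEmbed.sub continuous_const) fun y => ?_
    exact norm_pos_iff.1 (hd.trans_le (one_sub_norm_le_norm_sub z y))
  have huc : Integrable fun y => (u y : ℂ) := hu.integrable.ofReal
  obtain ⟨C, hC⟩ := isCompact_univ.exists_bound_of_continuousOn hK.continuousOn
  have herglotz' : Integrable fun y => K y * (u y : ℂ) :=
    huc.bdd_mul (c := C) hK.aestronglyMeasurable (ae_of_all _ fun y => hC y (mem_univ y))
  have hcell : ∀ k ∈ Finset.range (2 ^ m), ‖∫ y in cell m k, K y * (u y : ℂ)‖ ≤
      2 * dlen m / (1 - ‖z‖) ^ 2 * (B * dlen m) := by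
    intro k hk
    rw [Finset.mem_range] at hk
    obtain ⟨p, hp⟩ := cell_nonempty hk
    have h1 : ∫ y in cell m k, K p * (u y : ℂ) = 0 := by
      rw [integral_const_mul, integral_complex_ofReal, hmean k hk]; simp
    have h2 : ∫ y in cell m k, K y * (u y : ℂ) = ∫ y in cell m k, (K y - K p) * (u y : ℂ) := by
      simp only [sub_mul]
      rw [integral_sub herglotz'.integrableOn (huc.const_mul _).integrableOn, h1, sub_zero]
    have hu' : Integrable fun y => |u y| := hu.integrable.abs
    calc _ = ‖∫ y in cell m k, (K y - K p) * (u y : ℂ)‖ := by rw [h2]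
      _ ≤ ∫ y in cell m k, 2 * dlen m / (1 - ‖z‖) ^ 2 * |u y| := by
          refine norm_integral_le_of_norm_le (hu'.const_mul _).integrableOn ?_
          refine (ae_restrict_iff' (measurableSet_cell m k)).2 (ae_of_all _ fun y hy => ?_)
          rw [norm_mul, Complex.norm_real, Real.norm_eq_abs]
          exact mul_le_mul_of_nonneg_right (norm_kernel_sub_le hy hp hz) (abs_nonneg _)
      _ ≤ _ := by
          rw [integral_const_mul]
          refine mul_le_mul_of_nonneg_left (habs k hk) ?_
          have := dlen_pos m
          positivity
  rw [herglotz_eq, norm_smul, integral_eq_sum_cell herglotz' m]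
  calc _ ≤ ‖(2 * Real.pi)⁻¹‖ * ∑ k ∈ Finset.range (2 ^ m),
          2 * dlen m / (1 - ‖z‖) ^ 2 * (B * dlen m) := by
        refine mul_le_mul_of_nonneg_left ?_ (norm_nonneg _)
        exact (norm_sum_le _ _).trans (Finset.sum_le_sum hcell)
    _ = _ := by
        rw [Finset.sum_const, Finset.card_range, nsmul_eq_mul, Real.norm_eq_abs,
          abs_of_pos (by positivity), ← two_pow_mul_dlen m]
        have := dlen_pos m
        push_cast
        field_simp

lemma pker_le_four_mul {n k : ℕ} {y y' : UnitCircle} (hy : y ∈ cell n k) (hy' : y' ∈ cell n k)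
    {r : ℝ} (h0 : 0 ≤ r) (h1 : r < 1) (hd : dlen n ≤ 1 - r) (x : UnitCircle) :
    pker r (x - y) ≤ 4 * pker r (x - y') := by
  have e : ∀ y, ‖(1 : ℂ) - r * circleEmbed (x - y)‖ = ‖circleEmbed y - r * circleEmbed x‖ := by
    intro y
    have : circleEmbed y * (1 - r * circleEmbed (x - y)) =
        circleEmbed y - r * circleEmbed x := by
      rw [sub_eq_add_neg x y, circleEmbed_add, circleEmbed_neg]
      field_simp [circleEmbed_ne_zero y]
    rw [← this, norm_mul, norm_circleEmbed, one_mul]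
  have hy1 := one_sub_le_norm h0 (x - y)
  have hy2 := one_sub_le_norm h0 (x - y')
  unfold pker
  rw [mul_left_comm]
  refine mul_le_mul_of_nonneg_left ?_ (by positivity)
  rw [e] at hy1 hy2 ⊢
  rw [e]
  have hle : ‖circleEmbed y' - r * circleEmbed x‖ ≤ 2 * ‖circleEmbed y - r * circleEmbed x‖ := by
    have h2 := norm_circleEmbed_sub_le hy' hy
    have h3 := norm_add_le (circleEmbed y' - circleEmbed y) (circleEmbed y - r * circleEmbed x)
    rw [sub_add_sub_cancel] at h3
    linarith
  set a := ‖circleEmbed y - r * circleEmbed x‖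
  set b := ‖circleEmbed y' - r * circleEmbed x‖
  have ha : 0 < a := by linarith
  have hb : 0 < b := by linarith
  have hr : 0 ≤ 1 - r ^ 2 := by nlinarith
  rw [← mul_div_assoc, div_le_div_iff₀ (by positivity) (by positivity)]
  have : b ^ 2 ≤ 4 * a ^ 2 := by nlinarith
  nlinarith

/-- A Harnack type bound for the Poisson integral in terms of dyadic means. -/
lemma pint_le_of_mean_le {g : UnitCircle → ℝ} (hg : BddMeas g) (hg0 : ∀ x, 0 ≤ g x) {n : ℕ}
    {A : ℝ} (hA : ∀ k < 2 ^ n, ∫ x in cell n k, g x ≤ A * dlen n) {r : ℝ} (h0 : 0 ≤ r)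
    (h1 : r < 1) (hd : dlen n ≤ 1 - r) (x : UnitCircle) : pint r g x ≤ 4 * A := by
  have hP := BddMeas.pker h0 h1 x
  have hi := (hP.mul hg).integrable
  have hcell : ∀ k ∈ Finset.range (2 ^ n), ∫ y in cell n k, pker r (x - y) * g y ≤
      4 * A * ∫ y in cell n k, pker r (x - y) := by
    intro k hk
    rw [Finset.mem_range] at hk
    have hpt : ∀ y' ∈ cell n k, ∫ y in cell n k, pker r (x - y) * g y ≤
        4 * A * dlen n * pker r (x - y') := by
      intro y' hy'
      calc _ ≤ ∫ y in cell n k, 4 * pker r (x - y') * g y :=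
            setIntegral_mono_on hi.integrableOn (hg.integrable.const_mul _).integrableOn
              (measurableSet_cell n k) fun y hy =>
              mul_le_mul_of_nonneg_right (pker_le_four_mul hy hy' h0 h1 hd x) (hg0 y)
        _ = 4 * pker r (x - y') * ∫ y in cell n k, g y := integral_const_mul _ _
        _ ≤ 4 * pker r (x - y') * (A * dlen n) :=
            mul_le_mul_of_nonneg_left (hA k hk)
              (mul_nonneg (by norm_num) (pker_nonneg h0 h1 _))
        _ = _ := by ring
    have h2 : ∫ _ in cell n k, (∫ y in cell n k, pker r (x - y) * g y) ≤
        ∫ y' in cell n k, 4 * A * dlen n * pker r (x - y') :=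
      setIntegral_mono_on (integrable_const _).integrableOn
        (hP.integrable.const_mul _).integrableOn (measurableSet_cell n k) hpt
    rw [setIntegral_const, volume_real_cell hk, smul_eq_mul, integral_const_mul] at h2
    refine le_of_mul_le_mul_left (h2.trans_eq ?_) (dlen_pos n)
    ring
  calc pint r g x = ∑ k ∈ Finset.range (2 ^ n), ∫ y in cell n k, pker r (x - y) * g y :=
        integral_eq_sum_cell hi n
    _ ≤ ∑ k ∈ Finset.range (2 ^ n), 4 * A * ∫ y in cell n k, pker r (x - y) :=
        Finset.sum_le_sum hcell
    _ = 4 * A := by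
        rw [← Finset.mul_sum, ← integral_eq_sum_cell hP.integrable n, integral_pker_sub h0 h1,
          mul_one]

/-- Jensen's inequality for the Poisson kernel. -/
lemma exp_pint_le {u : UnitCircle → ℝ} (hu : BddMeas u) {t r : ℝ} (h0 : 0 ≤ r) (h1 : r < 1)
    (he : BddMeas fun x => Real.exp (t * u x)) (x : UnitCircle) :
    Real.exp (t * pint r u x) ≤ pint r (fun x => Real.exp (t * u x)) x := by
  set b := t * pint r u x
  have hP := BddMeas.pker h0 h1 x
  have hPu := (hP.mul hu).integrable
  have hlow : ∫ y, (Real.exp b * (1 - b) * pker r (x - y) +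
      Real.exp b * t * (pker r (x - y) * u y)) = Real.exp b := by
    rw [integral_add (hP.integrable.const_mul _) (hPu.const_mul _), integral_const_mul,
      integral_const_mul, integral_pker_sub h0 h1]
    change Real.exp b * (1 - b) * 1 + Real.exp b * t * pint r u x = _
    have : t * pint r u x = b := rfl
    rw [mul_assoc (Real.exp b) t, this]
    ring
  rw [← hlow]
  refine integral_mono ((hP.integrable.const_mul _).add (hPu.const_mul _))
    (hP.mul he).integrable fun y => ?_
  have h2 := Real.add_one_le_exp (t * u y - b)
  have h3 : Real.exp (t * u y) = Real.exp b * Real.exp (t * u y - b) := by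
    rw [← Real.exp_add]; congr 1; ring
  have h4 := mul_le_mul_of_nonneg_left (mul_le_mul_of_nonneg_left h2 (Real.exp_pos b).le)
    (pker_nonneg h0 h1 (x - y))
  simp only
  rw [h3]
  linarith

lemma exists_trig_integral_sub_le {w : UnitCircle → ℝ} (hw : Integrable w) {κ : ℝ} (hκ : 0 < κ) :
    ∃ A : Polynomial ℂ, ∫ x, |w x - (A.eval (circleEmbed x)).re| ≤ κ := by
  obtain ⟨φ, -, h1, hc, hi⟩ := hw.exists_hasCompactSupport_integral_sub_le (half_pos hκ)
  have hpi : 0 < 2 * (2 * Real.pi) := by positivity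
  obtain ⟨A, hA⟩ := exists_polynomial_re_near hc (div_pos hκ hpi)
  refine ⟨A, ?_⟩
  have hv : Continuous fun x => (A.eval (circleEmbed x)).re :=
    Complex.continuous_re.comp (A.continuous.comp continuous_circleEmbed)
  have i1 : Integrable fun x => |w x - φ x| := (hw.sub hi).abs
  have i2 : Integrable fun x => |φ x - (A.eval (circleEmbed x)).re| :=
    (hi.sub (integrable_of_continuous hv)).abs
  calc _ ≤ ∫ x, (|w x - φ x| + |φ x - (A.eval (circleEmbed x)).re|) :=
        integral_mono (hw.sub (integrable_of_continuous hv)).abs (i1.add i2)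
          fun x => abs_sub_le _ _ _
    _ = (∫ x, |w x - φ x|) + ∫ x, |φ x - (A.eval (circleEmbed x)).re| := integral_add i1 i2
    _ ≤ κ / 2 + ∫ _ : UnitCircle, κ / (2 * (2 * Real.pi)) :=
        add_le_add h1 (integral_mono i2 (integrable_const _) fun x => (hA x).le)
    _ = κ := by
        rw [integral_const_circle]
        field_simp
        ring

lemma exists_radius_re_eval_near (A : Polynomial ℂ) {κ : ℝ} (hκ : 0 < κ) :
    ∃ r : ℝ, 0 ≤ r ∧ r < 1 ∧ ∀ x,
      |(A.eval (r * circleEmbed x)).re - (A.eval (circleEmbed x)).re| ≤ κ := by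
  have huc := (isCompact_closedBall (0 : ℂ) 1).uniformContinuousOn_of_continuous
    A.continuous.continuousOn
  obtain ⟨η, hη, h⟩ := Metric.uniformContinuousOn_iff.1 huc κ hκ
  refine ⟨max 0 (1 - η / 2), le_max_left _ _, max_lt one_pos (by linarith), fun x => ?_⟩
  set r := max 0 (1 - η / 2)
  have hr0 : 0 ≤ r := le_max_left _ _
  have hr1 : r ≤ 1 := max_le zero_le_one (by linarith)
  have hr2 : 1 - η / 2 ≤ r := le_max_right _ _
  have h1 : (r * circleEmbed x : ℂ) ∈ Metric.closedBall (0 : ℂ) 1 := by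
    simpa [abs_of_nonneg hr0] using hr1
  have h2 : circleEmbed x ∈ Metric.closedBall (0 : ℂ) 1 := by simp
  have hd : dist (r * circleEmbed x : ℂ) (circleEmbed x) < η := by
    have e : (r * circleEmbed x - circleEmbed x : ℂ) = ((r - 1 : ℝ) : ℂ) * circleEmbed x := by
      push_cast; ring
    rw [dist_eq_norm, e, norm_mul, norm_circleEmbed, Complex.norm_real, Real.norm_eq_abs,
      abs_sub_comm, abs_of_nonneg (by linarith)]
    linarith
  have := h _ h1 _ h2 hd
  rw [dist_eq_norm] at this
  rw [← Complex.sub_re]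
  exact (Complex.abs_re_le_norm _).trans this.le

lemma exists_radius_integral_le {w ψ : UnitCircle → ℝ} (hw : Integrable w) (hψ : BddMeas ψ)
    {κ : ℝ} (hκ : 0 < κ) :
    ∃ r : ℝ, 0 ≤ r ∧ r < 1 ∧ ∫ x, w x * pint r ψ x ≤ (∫ x, w x * ψ x) + κ := by
  obtain ⟨C, hC⟩ := hψ.2
  set M := max C 1
  have hM1 : 1 ≤ M := le_max_right _ _
  have hM : ∀ x, |ψ x| ≤ M := fun x => (hC x).trans (le_max_left _ _)
  have hpi := Real.pi_pos
  obtain ⟨A, hA⟩ := exists_trig_integral_sub_le hw (κ := κ / (4 * M)) (by positivity)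
  obtain ⟨r, h0, h1, hr⟩ := exists_radius_re_eval_near A (κ := κ / (4 * M * Real.pi))
    (by positivity)
  refine ⟨r, h0, h1, ?_⟩
  set v : UnitCircle → ℝ := fun x => (A.eval (circleEmbed x)).re
  have hvc : Continuous v := Complex.continuous_re.comp (A.continuous.comp continuous_circleEmbed)
  have hv : BddMeas v := BddMeas.of_continuous hvc
  have hpψ := hψ.pint h0 h1
  have hpM : ∀ x, |pint r ψ x| ≤ M := fun x => abs_le.2 ⟨by
    rw [← pint_const h0 h1 (-M) x]
    exact pint_mono h0 h1 (BddMeas.const _) hψ (fun y => (abs_le.1 (hM y)).1) x, by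
    rw [← pint_const h0 h1 M x]
    exact pint_mono h0 h1 hψ (BddMeas.const _) (fun y => (abs_le.1 (hM y)).2) x⟩
  have hpv : ∀ x, pint r v x = (A.eval (r * circleEmbed x)).re := fun x =>
    integral_pker_mul_re h0 h1 x
  have hwb : ∀ {φ : UnitCircle → ℝ}, BddMeas φ → Integrable fun x => w x * φ x := by
    rintro φ ⟨hm, D, hD⟩
    exact hw.mul_bdd (c := D) hm.aestronglyMeasurable (ae_of_all _ hD)
  have e1 : ∫ x, (w x - v x) * (pint r ψ x - ψ x) ≤ κ / 2 := by
    calc _ ≤ ∫ x, |w x - v x| * (2 * M) := by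
          refine integral_mono ?_ ((hw.sub hv.integrable).abs.mul_const _) fun x => ?_
          · refine ((hwb (hpψ.sub hψ)).sub (hv.mul (hpψ.sub hψ)).integrable).congr
              (ae_of_all _ fun x => ?_)
            simp only [Pi.sub_apply]
            ring
          · refine (le_abs_self _).trans ?_
            rw [abs_mul]
            refine mul_le_mul_of_nonneg_left ?_ (abs_nonneg _)
            have := abs_sub (pint r ψ x) (ψ x)
            linarith [hM x, hpM x]
      _ = (∫ x, |w x - v x|) * (2 * M) := integral_mul_const _ _
      _ ≤ κ / (4 * M) * (2 * M) := mul_le_mul_of_nonneg_right hA (by positivity)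
      _ = κ / 2 := by field_simp; ring
  have e2 : ∫ x, (pint r v x - v x) * ψ x ≤ κ / 2 := by
    calc _ ≤ ∫ _ : UnitCircle, κ / (4 * M * Real.pi) * M := by
          refine integral_mono (((hv.pint h0 h1).sub hv).mul hψ).integrable
            (integrable_const _) fun x => ?_
          refine (le_abs_self _).trans ?_
          rw [abs_mul, hpv]
          exact mul_le_mul (hr x) (hM x) (abs_nonneg _) (by positivity)
      _ = κ / 2 := by
          rw [integral_const_circle]
          field_simp
          ring
  have e3 := integral_pint_mul h0 h1 hv.integrable hψ
  have s1 : ∫ x, (w x - v x) * (pint r ψ x - ψ x) =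
      (∫ x, w x * pint r ψ x) - (∫ x, w x * ψ x) - ((∫ x, v x * pint r ψ x) -
        ∫ x, v x * ψ x) := by
    rw [← integral_sub (hwb hpψ) (hwb hψ),
      ← integral_sub (hv.mul hpψ).integrable (hv.mul hψ).integrable,
      ← integral_sub (f := fun x => w x * pint r ψ x - w x * ψ x)
        (g := fun x => v x * pint r ψ x - v x * ψ x) ((hwb hpψ).sub (hwb hψ))
        ((hv.mul hpψ).integrable.sub (hv.mul hψ).integrable)]
    congr 1
    ext x
    ring
  have s2 : ∫ x, (pint r v x - v x) * ψ x = (∫ x, pint r v x * ψ x) - ∫ x, v x * ψ x := by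
    rw [← integral_sub ((hv.pint h0 h1).mul hψ).integrable (hv.mul hψ).integrable]
    congr 1
    ext x
    ring
  linarith

lemma exists_polynomial_near {f : ℂ → ℂ} {R : ℝ} (hR : 1 < R)
    (hf : DifferentiableOn ℂ f (Metric.closedBall 0 R)) {κ : ℝ} (hκ : 0 < κ) :
    ∃ p : Polynomial ℂ, ∀ z, ‖z‖ ≤ 1 → ‖p.eval z - f z‖ ≤ κ := by
  lift R to NNReal using by linarith
  have hR' : 1 < R := by exact_mod_cast hR
  have hps := hf.hasFPowerSeriesOnBall (one_pos.trans hR')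
  obtain ⟨s, hs1, hs2⟩ := exists_between hR'
  have hu := hps.tendstoUniformlyOn (r' := s) (by exact_mod_cast hs2)
  obtain ⟨n, hn⟩ := (Metric.tendstoUniformlyOn_iff.1 hu κ hκ).exists
  set P := cauchyPowerSeries f 0 R
  refine ⟨∑ k ∈ Finset.range n, Polynomial.C (P.coeff k) * Polynomial.X ^ k, fun z hz => ?_⟩
  have hz' : z ∈ Metric.ball (0 : ℂ) s := by
    rw [mem_ball_zero_iff]
    exact hz.trans_lt (by exact_mod_cast hs1)
  have h := hn z hz'
  rw [zero_add, dist_comm, dist_eq_norm] at h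
  refine le_trans (le_of_eq ?_) h.le
  congr 2
  rw [FormalMultilinearSeries.partialSum, Polynomial.eval_finsetSum]
  refine Finset.sum_congr rfl fun k _ => ?_
  rw [FormalMultilinearSeries.apply_eq_pow_smul_coeff, Polynomial.eval_mul, Polynomial.eval_C,
    Polynomial.eval_pow, Polynomial.eval_X, smul_eq_mul, mul_comm]

/-- Control of `areaInt` by a weighted bound on the disk and smallness on a smaller disk. -/
lemma exists_areaInt_le {t ε α C η : ℝ} (ht : 0 < t) (hε : 0 < ε) (hC : 0 < C) (hη : 0 < η) :
    ∃ R κ : ℝ, 0 < R ∧ R < 1 ∧ 0 < κ ∧ ∀ f : ℂ → ℂ,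
      (∀ z, ‖z‖ < 1 → ‖f z‖ ^ t * Real.exp (-ε * (1 - ‖z‖) ^ (α - 1)) ≤ C) →
      (∀ z, ‖z‖ ≤ R → ‖f z‖ ≤ κ) → areaInt t ε α f ≤ ENNReal.ofReal η := by
  have hpi := Real.pi_pos
  obtain ⟨R, hR0, hR1, hRC⟩ : ∃ R : ℝ, 0 < R ∧ R < 1 ∧ C * (Real.pi * (1 - R ^ 2)) ≤ η / 2 := by
    have hlim : Tendsto (fun R : ℝ => C * (Real.pi * (1 - R ^ 2))) (𝓝[<] 1) (𝓝 0) := by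
      have : Continuous fun R : ℝ => C * (Real.pi * (1 - R ^ 2)) := by fun_prop
      have h := this.tendsto 1
      norm_num at h
      exact h.mono_left nhdsWithin_le_nhds
    have h1 := hlim.eventually_le_const (half_pos hη)
    have h2 : ∀ᶠ R : ℝ in 𝓝[<] 1, R ∈ Ioo (0 : ℝ) 1 := Ioo_mem_nhdsLT one_pos
    obtain ⟨R, h3, h4⟩ := (h1.and h2).exists
    exact ⟨R, h4.1, h4.2, h3⟩
  refine ⟨R, (η / (2 * Real.pi)) ^ t⁻¹, hR0, hR1, by positivity, fun f hf hf' => ?_⟩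
  have hG : ∀ z : ℂ, ‖z‖ < 1 → Real.exp (-ε * (1 - ‖z‖) ^ (α - 1)) ≤ 1 := fun z hz => by
    rw [Real.exp_le_one_iff, neg_mul, neg_nonpos]
    exact mul_nonneg hε.le (Real.rpow_nonneg (by linarith) _)
  have e : ∀ z, (‖f z‖₊ : ENNReal) ^ t * ENNReal.ofReal (Real.exp (-ε * (1 - ‖z‖) ^ (α - 1))) =
      ENNReal.ofReal (‖f z‖ ^ t * Real.exp (-ε * (1 - ‖z‖) ^ (α - 1))) := fun z => by
    rw [ENNReal.ofReal_mul (Real.rpow_nonneg (norm_nonneg _) _),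
      ← ENNReal.ofReal_rpow_of_nonneg (norm_nonneg _) ht.le, ofReal_norm, enorm_eq_nnnorm]
  have hsplit : Metric.ball (0 : ℂ) 1 ⊆
      Metric.ball 0 R ∪ (Metric.ball 0 1 \ Metric.ball 0 R) := by
    rw [union_sdiff_self]; exact subset_union_right
  have hvol : volume (Metric.ball (0 : ℂ) 1 \ Metric.ball 0 R) =
      ENNReal.ofReal (Real.pi * (1 - R ^ 2)) := by
    rw [measure_sdiff (Metric.ball_subset_ball hR1.le)
      measurableSet_ball.nullMeasurableSet (measure_ball_lt_top).ne, Complex.volume_ball,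
      Complex.volume_ball, mul_sub, mul_one, ENNReal.ofReal_sub _ (by positivity),
      mul_comm Real.pi, ENNReal.ofReal_mul (by positivity), ENNReal.ofReal_pow hR0.le]
    simp [← NNReal.coe_real_pi, ENNReal.ofReal_coe_nnreal]
  rw [areaInt]
  simp only [e]
  calc _ ≤ (∫⁻ z in Metric.ball (0 : ℂ) R,
            ENNReal.ofReal (‖f z‖ ^ t * Real.exp (-ε * (1 - ‖z‖) ^ (α - 1)))) +
          ∫⁻ z in Metric.ball (0 : ℂ) 1 \ Metric.ball 0 R,
            ENNReal.ofReal (‖f z‖ ^ t * Real.exp (-ε * (1 - ‖z‖) ^ (α - 1))) :=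
        (lintegral_mono_set hsplit).trans (lintegral_union_le _ _ _)
    _ ≤ (∫⁻ z in Metric.ball (0 : ℂ) R, ENNReal.ofReal (η / (2 * Real.pi))) +
          ∫⁻ z in Metric.ball (0 : ℂ) 1 \ Metric.ball 0 R, ENNReal.ofReal C := by
        refine add_le_add (setLIntegral_mono' measurableSet_ball fun z hz => ?_)
          (setLIntegral_mono' (measurableSet_ball.diff measurableSet_ball) fun z hz => ?_)
        · rw [mem_ball_zero_iff] at hz
          refine ENNReal.ofReal_le_ofReal ?_
          have h1 : ‖f z‖ ^ t ≤ η / (2 * Real.pi) := by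
            refine (Real.rpow_le_rpow (norm_nonneg _) (hf' z hz.le) ht.le).trans_eq ?_
            rw [← Real.rpow_mul (by positivity), inv_mul_cancel₀ ht.ne', Real.rpow_one]
          refine (mul_le_of_le_one_right (Real.rpow_nonneg (norm_nonneg _) _)
            (hG z (hz.trans hR1))).trans h1
        · exact ENNReal.ofReal_le_ofReal (hf z (mem_ball_zero_iff.1 hz.1))
    _ ≤ ENNReal.ofReal (η / 2) + ENNReal.ofReal (η / 2) := by
        refine add_le_add ?_ ?_
        · rw [setLIntegral_const]
          calc _ ≤ ENNReal.ofReal (η / (2 * Real.pi)) * volume (Metric.ball (0 : ℂ) 1) := by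
                gcongr
            _ = ENNReal.ofReal (η / 2) := by
                rw [Complex.volume_ball, ENNReal.ofReal_one, one_pow, one_mul,
                  ← ENNReal.ofReal_coe_nnreal, NNReal.coe_real_pi,
                  ← ENNReal.ofReal_mul (by positivity)]
                congr 1
                field_simp
        · rw [setLIntegral_const, hvol, ← ENNReal.ofReal_mul hC.le]
          exact ENNReal.ofReal_le_ofReal hRC
    _ = _ := by
        rw [← ENNReal.ofReal_add (by positivity) (by positivity), add_halves]

lemma exists_dlen_le {m : ℕ} {d : ℝ} (hd : 0 < d) (hm : d ≤ dlen m) :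
    ∃ j, m ≤ j ∧ dlen j ≤ d ∧ d ≤ 2 * dlen j := by
  have hex : ∃ j, dlen j ≤ d :=
    (tendsto_dlen.eventually_le_const hd).exists
  classical
  rcases le_or_gt (Nat.find hex) m with h | h
  · have := (dlen_anti h).trans (Nat.find_spec hex)
    exact ⟨m, le_rfl, this, by linarith [dlen_pos m]⟩
  · refine ⟨Nat.find hex, h.le, Nat.find_spec hex, ?_⟩
    have h1 : ¬ dlen (Nat.find hex - 1) ≤ d := Nat.find_min hex (by omega)
    have h2 := dlen_succ (Nat.find hex - 1)
    rw [Nat.sub_add_cancel (by omega)] at h2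
    linarith [not_le.1 h1]

/-- A density with the properties provided by `exists_density`. -/
structure IsTame (δ α N : ℝ) (m : ℕ) (g : UnitCircle → ℝ) : Prop where
  bddMeas : BddMeas g
  nonneg : ∀ x, 0 ≤ g x
  mean : ∀ k < 2 ^ m, ∫ x in cell m k, g x = N * dlen m
  mass_le : ∀ j, m ≤ j → ∀ l, ∫ x in cell j l, g x ≤ δ * dlen j ^ α

lemma IsTame.norm_herglotz_le {δ α N : ℝ} {m : ℕ} {g : UnitCircle → ℝ} (hg : IsTame δ α N m g)
    (hN : 0 ≤ N) {z : ℂ} (hz : ‖z‖ < 1) :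
    ‖herglotz (fun x => g x - N) z‖ ≤ 4 * N * dlen m / (1 - ‖z‖) ^ 2 := by
  have hi := hg.bddMeas.integrable
  have hc : Integrable fun _ : UnitCircle => N := integrable_const _
  refine (AlphaSplitting.norm_herglotz_le (hg.bddMeas.sub (BddMeas.const N)) (B := 2 * N) (m := m)
    (fun k hk => ?_) (fun k hk => ?_) hz).trans_eq (by ring)
  · rw [integral_sub hi.integrableOn hc.integrableOn, hg.mean k hk, setIntegral_const,
      volume_real_cell hk, smul_eq_mul]
    ring
  · calc ∫ x in cell m k, |g x - N| ≤ ∫ x in cell m k, (g x + N) := by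
          refine integral_mono (hi.sub hc).abs.integrableOn (hi.add hc).integrableOn fun x => ?_
          have h0 := hg.nonneg x
          exact abs_le.2 ⟨by simp only; linarith, by simp only; linarith⟩
      _ = 2 * N * dlen m := by
          rw [integral_add hi.integrableOn hc.integrableOn, hg.mean k hk, setIntegral_const,
            volume_real_cell hk, smul_eq_mul]
          ring

lemma IsTame.re_herglotz_le {δ α N d₀ : ℝ} (hδ : 0 < δ) (hα0 : 0 < α) (hα1 : α < 1) (hN : 0 ≤ N)
    (hd₀ : 0 < d₀) (hd : ∀ d, 0 < d → δ * d ^ (α - 1) < N → d₀ ≤ d)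
    {m : ℕ} {g : UnitCircle → ℝ} (hg : IsTame δ α N m g)
    (hm : 4 * N * dlen m / d₀ ^ 2 ≤ δ) {z : ℂ} (hz : ‖z‖ < 1) :
    (herglotz (fun x => g x - N) z).re ≤ 8 * δ * (1 - ‖z‖) ^ (α - 1) := by
  have hdz : 0 < 1 - ‖z‖ := by linarith
  have hpow : 0 ≤ (1 - ‖z‖) ^ (α - 1) := Real.rpow_nonneg hdz.le _
  rcases lt_or_ge (δ * (1 - ‖z‖) ^ (α - 1)) N with h | h
  · have h1 := hd _ hdz h
    have h2 : 1 ≤ (1 - ‖z‖) ^ (α - 1) :=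
      Real.one_le_rpow_of_pos_of_le_one_of_nonpos hdz (by linarith [norm_nonneg z]) (by linarith)
    calc _ ≤ ‖herglotz (fun x => g x - N) z‖ := Complex.re_le_norm _
      _ ≤ 4 * N * dlen m / (1 - ‖z‖) ^ 2 := hg.norm_herglotz_le hN hz
      _ ≤ 4 * N * dlen m / d₀ ^ 2 := by
          have := dlen_pos m
          gcongr
      _ ≤ δ := hm
      _ ≤ _ := by nlinarith
  · obtain ⟨x, hx⟩ := exists_polar z
    have e : (herglotz (fun x => g x - N) z).re = pint ‖z‖ g x - N := by
      have h1 := re_herglotz (hg.bddMeas.sub (BddMeas.const N)) (norm_nonneg z) hz x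
      rw [← hx, pint_sub (norm_nonneg z) hz hg.bddMeas (BddMeas.const N),
        pint_const (norm_nonneg z) hz] at h1
      exact h1
    rw [e]
    rcases le_or_gt (1 - ‖z‖) (dlen m) with hdm | hdm
    · obtain ⟨j, hmj, hj1, hj2⟩ := exists_dlen_le hdz hdm
      have h1 := pint_le_of_mean_le hg.bddMeas hg.nonneg (n := j) (A := δ * dlen j ^ (α - 1))
        (fun k _ => (hg.mass_le j hmj k).trans_eq (by
          rw [mul_assoc, ← Real.rpow_add_one (dlen_pos j).ne']; simp))
        (norm_nonneg z) hz hj1 x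
      have h2 : dlen j ^ (α - 1) ≤ 2 * (1 - ‖z‖) ^ (α - 1) := by
        calc dlen j ^ (α - 1) ≤ ((1 - ‖z‖) / 2) ^ (α - 1) :=
              Real.rpow_le_rpow_of_nonpos (by linarith) (by linarith) (by linarith)
          _ = 2 ^ (1 - α) * (1 - ‖z‖) ^ (α - 1) := by
              rw [Real.div_rpow hdz.le (by norm_num), div_eq_mul_inv, mul_comm,
                ← Real.rpow_neg (by norm_num), neg_sub]
          _ ≤ _ := by
              refine mul_le_mul_of_nonneg_right ?_ hpow
              calc (2 : ℝ) ^ (1 - α) ≤ 2 ^ (1 : ℝ) :=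
                    Real.rpow_le_rpow_of_exponent_le (by norm_num) (by linarith)
                _ = 2 := Real.rpow_one 2
      nlinarith
    · have h1 := pint_le_of_mean_le hg.bddMeas hg.nonneg (n := m) (A := N)
        (fun k hk => (hg.mean k hk).le) (norm_nonneg z) hz hdm.le x
      nlinarith [mul_nonneg hδ.le hpow]

lemma exists_scale {δ α N : ℝ} (hδ : 0 < δ) (hα1 : α < 1) :
    ∃ d₀, 0 < d₀ ∧ ∀ d, 0 < d → δ * d ^ (α - 1) < N → d₀ ≤ d := by
  have h : Tendsto (fun d : ℝ => δ * d ^ (α - 1)) (𝓝[>] 0) atTop :=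
    (tendsto_rpow_neg_nhdsGT_zero (by linarith : α - 1 < 0)).const_mul_atTop hδ
  obtain ⟨d₀, hd₀, hsub⟩ := (mem_nhdsGT_iff_exists_Ioo_subset).1 (h.eventually_ge_atTop N)
  refine ⟨d₀, hd₀, fun d hd hlt => ?_⟩
  by_contra hcon
  have : N ≤ δ * d ^ (α - 1) := hsub ⟨hd, not_le.1 hcon⟩
  linarith

lemma add_rpow_le {a b t : ℝ} (ha : 0 ≤ a) (hb : 0 ≤ b) (ht : 0 < t) :
    (a + b) ^ t ≤ 2 ^ t * (a ^ t + b ^ t) := by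
  calc (a + b) ^ t ≤ (2 * max a b) ^ t :=
        Real.rpow_le_rpow (by positivity)
          (by linarith [le_max_left a b, le_max_right a b]) ht.le
    _ = 2 ^ t * (max a b) ^ t := Real.mul_rpow (by norm_num) (le_max_of_le_left ha)
    _ ≤ _ := mul_le_mul_of_nonneg_left (rpow_max_le ha hb) (by positivity)

lemma mul_exp_le_max {t w g : ℝ} (ht : 0 < t) (hw : 0 ≤ w)
    (hg : ENNReal.ofReal g ≤ nlog w / ENNReal.ofReal t) : w * Real.exp (t * g) ≤ max 1 w := by
  rcases hw.eq_or_lt with h | h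
  · rw [← h, zero_mul]; exact le_max_of_le_left zero_le_one
  rw [ENNReal.le_div_iff_mul_le (Or.inl (ENNReal.ofReal_pos.2 ht).ne')
    (Or.inl ENNReal.ofReal_ne_top), nlog, if_neg h.ne', ← ENNReal.ofReal_mul' ht.le] at hg
  rcases le_total g 0 with h0 | h0
  · refine le_max_of_le_right (mul_le_of_le_one_right hw (Real.exp_le_one_iff.2 ?_))
    exact mul_nonpos_of_nonneg_of_nonpos ht.le h0
  rcases le_total (Real.log w⁻¹) 0 with h1 | h1
  · rw [ENNReal.ofReal_of_nonpos h1, nonpos_iff_eq_zero, ENNReal.ofReal_eq_zero] at hg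
    refine le_max_of_le_right (mul_le_of_le_one_right hw (Real.exp_le_one_iff.2 ?_))
    linarith
  · rw [ENNReal.ofReal_le_ofReal_iff h1] at hg
    refine le_max_of_le_left ?_
    calc w * Real.exp (t * g) ≤ w * Real.exp (Real.log w⁻¹) := by
          refine mul_le_mul_of_nonneg_left (Real.exp_le_exp.2 ?_) hw
          linarith
      _ = 1 := by rw [Real.exp_log (inv_pos.2 h), mul_inv_cancel₀ h.ne']

lemma exists_pos_mul_exp_le {t c η : ℝ} (ht : 0 < t) (hη : 0 < η) :
    ∃ N : ℝ, 0 ≤ N ∧ c * Real.exp (-(t * N)) ≤ η := by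
  have h : Tendsto (fun N : ℝ => c * Real.exp (-(t * N))) atTop (𝓝 (c * 0)) :=
    (Real.tendsto_exp_neg_atTop_nhds_zero.comp (tendsto_id.const_mul_atTop ht)).const_mul c
  rw [mul_zero] at h
  obtain ⟨N, h1, h2⟩ := ((h.eventually_le_const hη).and (eventually_ge_atTop 0)).exists
  exact ⟨N, h2, h1⟩

lemma exists_pos_mul_rpow_le {t c η b : ℝ} (ht : 0 < t) (hη : 0 < η) (hb : 0 < b) :
    ∃ κ : ℝ, 0 < κ ∧ κ ≤ b ∧ c * κ ^ t ≤ η := by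
  have h : Tendsto (fun κ : ℝ => c * κ ^ t) (𝓝[>] 0) (𝓝 (c * 0)) := by
    have := ((Real.continuous_rpow_const ht.le).tendsto 0).const_mul c
    rw [Real.zero_rpow ht.ne'] at this
    exact this.mono_left nhdsWithin_le_nhds
  rw [mul_zero] at h
  obtain ⟨κ, h1, h2⟩ := ((h.eventually_le_const hη).and (Ioc_mem_nhdsGT hb)).exists
  exact ⟨κ, h2.1, h2.2, h1⟩

lemma BddMeas.exp {u : UnitCircle → ℝ} (hu : BddMeas u) (t : ℝ) :
    BddMeas fun x => Real.exp (t * u x) := by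
  obtain ⟨hm, C, hC⟩ := hu
  refine ⟨(hm.const_mul t).exp, Real.exp (|t| * C), fun x => ?_⟩
  rw [abs_of_pos (Real.exp_pos _)]
  refine Real.exp_le_exp.2 ((le_abs_self _).trans ?_)
  rw [abs_mul]
  exact mul_le_mul_of_nonneg_left (hC x) (abs_nonneg t)

lemma exists_density_of_nlog {t δ α N : ℝ} (hδ : 0 < δ) (hα0 : 0 < α) (hα1 : α < 1)
    (hN : 0 ≤ N) {w : UnitCircle → ℝ} (hw1 : Integrable w)
    (hdiv : ∀ E, IsAlphaCarlesonSet α E → 0 < volume E → ∫⁻ x in E, nlog (w x) = ⊤)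
    {m : ℕ} (hNm : N * dlen m ^ (1 - α) < δ) :
    ∃ g, IsTame δ α N m g ∧ ∀ᵐ x, ENNReal.ofReal (g x) ≤ nlog (w x) / ENNReal.ofReal t := by
  have hm := hw1.aestronglyMeasurable.aemeasurable
  set w' := hm.mk w
  have hww : w =ᵐ[volume] w' := hm.ae_eq_mk
  have hmeas : Measurable fun x => nlog (w' x) := measurable_nlog.comp hm.measurable_mk
  obtain ⟨g, h1, h2, h3, h4, h5⟩ := exists_density hδ hα0 hα1 hN
    (ρ := fun x => nlog (w' x) / ENNReal.ofReal t) (hmeas.div_const _) (fun E hE hpos => by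
      simp only [div_eq_mul_inv]
      rw [lintegral_mul_const _ hmeas]
      have e : ∫⁻ x in E, nlog (w' x) = ⊤ := by
        rw [← hdiv E hE hpos]
        refine lintegral_congr_ae (ae_restrict_of_ae ?_)
        filter_upwards [hww] with x hx
        rw [hx]
      rw [e, ENNReal.top_mul (ENNReal.inv_ne_zero.2 ENNReal.ofReal_ne_top)]) hNm
  refine ⟨g, ⟨h1, h2, h4, h5⟩, ?_⟩
  filter_upwards [hww] with x hx
  rw [hx]
  exact h3 x

lemma lintegral_rpow_mul_le {t η r κ : ℝ} (ht : 0 < t)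
    {w ψ : UnitCircle → ℝ} (hw0 : ∀ x, 0 ≤ w x) (hw1 : Integrable w)
    (h0 : 0 ≤ r) (h1 : r < 1) (hψ : BddMeas ψ) {F : UnitCircle → ℂ}
    (hF : ∀ x, ‖F x‖ ^ t ≤ 2 ^ t * (pint r ψ x + κ ^ t))
    (hle : 2 ^ t * ((∫ x, w x * pint r ψ x) + κ ^ t * ∫ x, w x) ≤ η) :
    ∫⁻ x, (‖F x‖₊ : ENNReal) ^ t * ENNReal.ofReal (w x) ≤ ENNReal.ofReal η := by
  have hb := hψ.pint h0 h1
  obtain ⟨C, hC⟩ := hb.2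
  have hi : Integrable fun x => w x * pint r ψ x :=
    hw1.mul_bdd hb.1.aestronglyMeasurable (ae_of_all _ hC)
  have hi' : Integrable fun x => 2 ^ t * (w x * pint r ψ x + κ ^ t * w x) :=
    (hi.add (hw1.const_mul _)).const_mul _
  have hpt : ∀ x, ‖F x‖ ^ t * w x ≤ 2 ^ t * (w x * pint r ψ x + κ ^ t * w x) := fun x =>
    (mul_le_mul_of_nonneg_right (hF x) (hw0 x)).trans_eq (by ring)
  calc ∫⁻ x, (‖F x‖₊ : ENNReal) ^ t * ENNReal.ofReal (w x)
      ≤ ∫⁻ x, ENNReal.ofReal (2 ^ t * (w x * pint r ψ x + κ ^ t * w x)) := by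
        refine lintegral_mono fun x => ?_
        rw [← enorm_eq_nnnorm, ← ofReal_norm, ENNReal.ofReal_rpow_of_nonneg (norm_nonneg _) ht.le,
          ← ENNReal.ofReal_mul (by positivity)]
        exact ENNReal.ofReal_le_ofReal (hpt x)
    _ = ENNReal.ofReal (∫ x, 2 ^ t * (w x * pint r ψ x + κ ^ t * w x)) :=
        (ofReal_integral_eq_lintegral_ofReal hi' (ae_of_all _ fun x =>
          (mul_nonneg (by positivity) (hw0 x)).trans (hpt x))).symm
    _ ≤ ENNReal.ofReal η := by
        refine ENNReal.ofReal_le_ofReal (le_trans (le_of_eq ?_) hle)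
        rw [integral_const_mul, integral_add hi (hw1.const_mul _), integral_const_mul]

/-- The polynomials approximate `exp` of the dilated Herglotz integral of a tame density. -/
lemma exists_polynomial_splitting {t ε α η : ℝ} (ht : 0 < t) (hε : 0 < ε) (hα0 : 0 < α)
    (hα1 : α < 1) (hη : 0 < η) {w : UnitCircle → ℝ} (hw0 : ∀ ζ, 0 ≤ w ζ) (hw1 : Integrable w)
    (hdiv : ∀ E, IsAlphaCarlesonSet α E → 0 < volume E → ∫⁻ ζ in E, nlog (w ζ) = ⊤) :
    ∃ p : Polynomial ℂ,
      ∫⁻ ζ, (‖p.eval (circleEmbed ζ)‖₊ : ENNReal) ^ t * ENNReal.ofReal (w ζ) ≤ ENNReal.ofReal η ∧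
      areaInt t ε α (fun z => p.eval z - 1) ≤ ENNReal.ofReal η := by
  set δ := ε / (8 * t) with hδdef
  have hδ : 0 < δ := by positivity
  set S := ∫ x, max 1 (w x)
  set W := ∫ x, w x
  obtain ⟨N, hN, hNS⟩ := exists_pos_mul_exp_le (c := 2 ^ t * S) ht (by positivity : 0 < η / 3)
  obtain ⟨R, κ', hR0, hR1, hκ', harea⟩ := exists_areaInt_le (α := α) ht hε
    (by positivity : (0 : ℝ) < 3 ^ t) hη
  obtain ⟨d₀, hd₀, hd⟩ := exists_scale (N := N) hδ hα1
  have hlin (c : ℝ) : Tendsto (fun m => 4 * N * dlen m / c ^ 2) atTop (𝓝 0) := by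
    simpa using (tendsto_dlen.const_mul (4 * N)).div_const (c ^ 2)
  have hpow : Tendsto (fun m => N * dlen m ^ (1 - α)) atTop (𝓝 0) := by
    have := (tendsto_dlen.rpow_const (p := 1 - α) (Or.inr (by linarith))).const_mul N
    rwa [Real.zero_rpow (by linarith), mul_zero] at this
  obtain ⟨m, hm1, hm2, hm3⟩ := ((hpow.eventually_lt_const hδ).and
    (((hlin (1 - R)).eventually_le_const (by positivity : 0 < min 1 (κ' / 4))).and
      ((hlin d₀).eventually_le_const hδ))).exists
  obtain ⟨g, hg, hgw⟩ := exists_density_of_nlog (t := t) hδ hα0 hα1 hN hw1 hdiv hm1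
  have hu : BddMeas fun x => g x - N := hg.bddMeas.sub (BddMeas.const N)
  have hψ := hu.exp t
  obtain ⟨r, hr0, hr1, hr⟩ := exists_radius_integral_le hw1 hψ
    (by positivity : 0 < η / (3 * 2 ^ t))
  obtain ⟨κ, hκ, hκb, hκW⟩ := exists_pos_mul_rpow_le (c := 2 ^ t * W) ht
    (by positivity : 0 < η / 3) (by positivity : 0 < min 1 (κ' / 2))
  have hnorm (z : ℂ) : ‖(r : ℂ) * z‖ = r * ‖z‖ := by
    rw [norm_mul, Complex.norm_real, Real.norm_of_nonneg hr0]
  have hf : DifferentiableOn ℂ (fun z => Complex.exp (herglotz (fun x => g x - N) (r * z)))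
      (Metric.closedBall 0 (2 / (1 + r))) := by
    refine ((differentiableOn_herglotz hu).comp (by fun_prop) fun z hz => ?_).cexp
    rw [mem_closedBall_zero_iff] at hz
    rw [mem_ball_zero_iff, hnorm]
    calc r * ‖z‖ ≤ r * (2 / (1 + r)) := mul_le_mul_of_nonneg_left hz hr0
      _ < 1 := by rw [← mul_div_assoc, div_lt_one (by linarith)]; linarith
  obtain ⟨p, hp⟩ := exists_polynomial_near (by rw [lt_div_iff₀ (by linarith)]; linarith) hf hκ
  have hrz {z : ℂ} (hz : ‖z‖ < 1) : ‖(r : ℂ) * z‖ ≤ ‖z‖ := by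
    rw [hnorm]; exact mul_le_of_le_one_left (norm_nonneg z) hr1.le
  refine ⟨p, ?_, harea _ (fun z hz => ?_) fun z hz => ?_⟩
  · refine lintegral_rpow_mul_le (κ := κ) ht hw0 hw1 hr0 hr1 hψ (fun x => ?_) ?_
    · have h1 := hp (circleEmbed x) (norm_circleEmbed x).le
      have h2 : ‖Complex.exp (herglotz (fun x => g x - N) (r * circleEmbed x))‖ =
          Real.exp (pint r (fun x => g x - N) x) := by
        rw [Complex.norm_exp, re_herglotz hu hr0 hr1]
      have h3 := norm_le_insert' (p.eval (circleEmbed x))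
        (Complex.exp (herglotz (fun x => g x - N) (r * circleEmbed x)))
      calc ‖p.eval (circleEmbed x)‖ ^ t ≤ (Real.exp (pint r (fun x => g x - N) x) + κ) ^ t :=
            Real.rpow_le_rpow (norm_nonneg _) (by linarith) ht.le
        _ ≤ 2 ^ t * (Real.exp (pint r (fun x => g x - N) x) ^ t + κ ^ t) :=
            add_rpow_le (Real.exp_pos _).le hκ.le ht
        _ ≤ _ := by
            have h4 := exp_pint_le hu hr0 hr1 hψ x
            rw [← Real.exp_mul, mul_comm _ t]
            gcongr
    · have hS : ∫ x, w x * Real.exp (t * (g x - N)) ≤ Real.exp (-(t * N)) * S := by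
        obtain ⟨C, hC⟩ := hψ.2
        rw [← integral_const_mul]
        refine integral_mono_ae (hw1.mul_bdd hψ.1.aestronglyMeasurable (ae_of_all _ hC))
          (((integrable_const 1).sup hw1).const_mul _) ?_
        filter_upwards [hgw] with x hx
        calc w x * Real.exp (t * (g x - N))
            = Real.exp (-(t * N)) * (w x * Real.exp (t * g x)) := by
              rw [show t * (g x - N) = -(t * N) + t * g x by ring, Real.exp_add]; ring
          _ ≤ _ := mul_le_mul_of_nonneg_left (mul_exp_le_max ht (hw0 x) hx) (Real.exp_pos _).le
      have h2t : (0 : ℝ) < 2 ^ t := by positivity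
      calc 2 ^ t * ((∫ x, w x * pint r (fun x => Real.exp (t * (g x - N))) x) + κ ^ t * W)
          ≤ 2 ^ t * ((Real.exp (-(t * N)) * S + η / (3 * 2 ^ t)) + κ ^ t * W) := by
            gcongr; exact hr.trans (by gcongr)
        _ = 2 ^ t * S * Real.exp (-(t * N)) + η / 3 + 2 ^ t * W * κ ^ t := by
            field_simp
        _ ≤ η := by linarith
  · have hdz : 0 < 1 - ‖z‖ := by linarith
    set D := (1 - ‖z‖) ^ (α - 1)
    have hD : 0 ≤ D := Real.rpow_nonneg hdz.le _
    have h1 : (herglotz (fun x => g x - N) (r * z)).re ≤ 8 * δ * D := by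
      refine (hg.re_herglotz_le hδ hα0 hα1 hN hd₀ hd hm3 ((hrz hz).trans_lt hz)).trans ?_
      refine mul_le_mul_of_nonneg_left ?_ (by positivity)
      exact Real.rpow_le_rpow_of_nonpos hdz (by linarith [hrz hz]) (by linarith)
    have h2 : ‖p.eval z - 1‖ ≤ 3 * Real.exp (8 * δ * D) := by
      have h3 := hp z hz.le
      have h4 : ‖Complex.exp (herglotz (fun x => g x - N) (r * z))‖ ≤ Real.exp (8 * δ * D) := by
        rw [Complex.norm_exp]; exact Real.exp_le_exp.2 h1
      have h5 : 1 ≤ Real.exp (8 * δ * D) := Real.one_le_exp (by positivity)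
      have h6 := norm_le_insert' (p.eval z) (Complex.exp (herglotz (fun x => g x - N) (r * z)))
      have h7 := norm_sub_le (p.eval z) 1
      rw [norm_one] at h7
      linarith [hκb.trans (min_le_left _ _)]
    calc ‖p.eval z - 1‖ ^ t * Real.exp (-ε * D)
        ≤ (3 * Real.exp (8 * δ * D)) ^ t * Real.exp (-ε * D) := by gcongr
      _ = 3 ^ t := by
          rw [Real.mul_rpow (by norm_num) (Real.exp_pos _).le, ← Real.exp_mul, mul_assoc,
            ← Real.exp_add, show 8 * δ * D * t + -ε * D = 0 by rw [hδdef]; field_simp; ring,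
            Real.exp_zero, mul_one]
  · have hz1 : ‖z‖ < 1 := hz.trans_lt hR1
    have h1 : ‖herglotz (fun x => g x - N) (r * z)‖ ≤ min 1 (κ' / 4) := by
      refine (hg.norm_herglotz_le hN ((hrz hz1).trans_lt hz1)).trans (le_trans ?_ hm2)
      have := dlen_pos m
      have := hrz hz1
      gcongr; linarith
    have h2 := Complex.norm_exp_sub_one_le (h1.trans (min_le_left _ _))
    have h3 := norm_sub_le_norm_sub_add_norm_sub (p.eval z)
      (Complex.exp (herglotz (fun x => g x - N) (r * z))) 1
    linarith [hp z hz1.le, h1.trans (min_le_right _ _), hκb.trans (min_le_right _ _)]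

end AlphaSplitting

/-- For `dμ = exp(-ε(1-|z|)^{α-1}) dA + w |dz|`, the space
`P^t(μ)` splits (equivalently, there are polynomials `p_k → 0` in `L^t(w|dz|)` and
`p_k → 1` in `L^t(exp(-ε(1-|z|)^{α-1}) dA)`) if and only if `∫_E log w |dz| = -∞`
for every `α`-Carleson set `E ⊆ 𝕋` of positive arclength measure. -/
theorem splitting_alpha (t ε α : ℝ) (ht : 0 < t) (hε : 0 < ε)
    (hα0 : 0 < α) (hα1 : α < 1)
    (w : UnitCircle → ℝ) (hw0 : ∀ ζ, 0 ≤ w ζ) (hw1 : Integrable w volume) :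
    (∃ p : ℕ → Polynomial ℂ,
      Tendsto (fun k => ∫⁻ ζ, (‖(p k).eval (circleEmbed ζ)‖₊ : ENNReal) ^ t *
          ENNReal.ofReal (w ζ)) atTop (𝓝 0) ∧
      Tendsto (fun k => ∫⁻ z in Metric.ball (0 : ℂ) 1,
          (‖(p k).eval z - 1‖₊ : ENNReal) ^ t *
            ENNReal.ofReal (Real.exp (-ε * (1 - ‖z‖) ^ (α - 1))))
        atTop (𝓝 0)) ↔
    (∀ E : Set UnitCircle, IsAlphaCarlesonSet α E → 0 < volume E →
      ∫⁻ ζ in E, nlog (w ζ) = ⊤) := by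
  constructor
  · rintro ⟨p, hp, hp'⟩ E hE hpos
    exact AlphaSplitting.lintegral_nlog_eq_top ht hε hα0 hα1 hw0 hw1 hp hp' hE hpos
  · intro hdiv
    have hpos (k : ℕ) : (0 : ℝ) < 1 / ((k : ℝ) + 1) := by positivity
    choose p hp hp' using fun k : ℕ =>
      AlphaSplitting.exists_polynomial_splitting ht hε hα0 hα1 (hpos k) hw0 hw1 hdiv
    have hlim : Tendsto (fun k : ℕ => ENNReal.ofReal (1 / ((k : ℝ) + 1))) atTop (𝓝 0) := by
      simpa using ENNReal.tendsto_ofReal (tendsto_one_div_add_atTop_nhds_zero_nat (𝕜 := ℝ))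
    exact ⟨p, tendsto_of_tendsto_of_tendsto_of_le_of_le tendsto_const_nhds hlim
      (fun _ => zero_le) hp, tendsto_of_tendsto_of_tendsto_of_le_of_le tendsto_const_nhds hlim
      (fun _ => zero_le) hp'⟩
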